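/- Let k ≥ 3, let g ∈ S_{2^k} be a 2^k-cycle, let x ∈ S_{2^k} be a picky element of Type II, and let P be the unique Sylow 2-subgroup of S_{2^k} containing x. Then there exists a bijection Γ : Irr^x(S_{2^k}) → Irr^x(P) satisfying: (I) Γ(χ)(1)_2 = χ(1)_2 for every χ ∈ Irr^x(S_{2^k}); (II) Γ(χ)(x) = ±χ(x) for every χ ∈ Irr^x(S_{2^k}); (III) for each χ ∈ Irr_{2'}(S_{2^k}) there exists ε ∈ {1, −1} such that Γ(χ)(x) = ε·χ(x) and Γ(χ)(g) = ε·χ(g). Moreover, for H ∈ {S_{2^k}, P}: (a) if χ ∈ Irr_{2'}(H) then χ(x) = ±1; (b) if χ ∈ Irr^x(H) \ Irr_{2'}(H) then χ(x) = ±2. -/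

import Mathlib

open CategoryTheory

noncomputable section

/-- The set of irreducible complex characters of a group `G`. -/
def Irr (G : Type) [Group G] : Set (G → ℂ) :=
  {χ | ∃ V : FDRep ℂ G, Simple V ∧ V.character = χ}

/-- The irreducible characters of `G` that do not vanish at `g`. -/
def IrrX (G : Type) [Group G] (g : G) : Set (G → ℂ) :=
  {χ | χ ∈ Irr G ∧ χ g ≠ 0}

/-- The irreducible characters of `G` of degree not divisible by `p`. -/
def IrrP' (p : ℕ) (G : Type) [Group G] : Set (G → ℂ) :=
  {χ | ∃ V : FDRep ℂ G, Simple V ∧ V.character = χ ∧ ¬ (p ∣ Module.finrank ℂ V)}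

/-- The degree of a character, recovered from its value at `1`. -/
def charDeg {G : Type} [Group G] (χ : G → ℂ) : ℕ := ⌊(χ 1).re⌋₊

/-- The `p`-part of a natural number. -/
def pPart (p m : ℕ) : ℕ := p ^ (m.factorization p)

/-- `x` is a picky `p`-element: a `p`-element lying in a unique Sylow `p`-subgroup. -/
def IsPicky (p : ℕ) {G : Type*} [Group G] (x : G) : Prop :=
  (∃ k, orderOf x = p ^ k) ∧ ∃! Q : Sylow p G, x ∈ Q

/-- `H` is a normal subgroup of `K` (both subgroups of an ambient group `G`). -/
def NormalIn {G : Type*} [Group G] (H K : Subgroup G) : Prop :=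
  H ≤ K ∧ ∀ k ∈ K, ∀ h ∈ H, k * h * k⁻¹ ∈ H

/-- `H` is subnormal in `K`: there is a finite chain of subgroups from `H` to `K`,
each normal in the next. -/
def IsSubnormalIn {G : Type*} [Group G] (H K : Subgroup G) : Prop :=
  Relation.ReflTransGen NormalIn H K

/-- The subnormalizer of `x` in `G`: the subgroup generated by all `g` such that
`⟨x⟩` is subnormal in `⟨x, g⟩`. -/
def subnormalizer {G : Type*} [Group G] (x : G) : Subgroup G :=
  Subgroup.closure {g | IsSubnormalIn (Subgroup.zpowers x) (Subgroup.closure {x, g})}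

lemma mem_subnormalizer_self {G : Type*} [Group G] (x : G) : x ∈ subnormalizer x :=
  Subgroup.subset_closure (by
    show IsSubnormalIn (Subgroup.zpowers x) (Subgroup.closure {x, x})
    rw [Set.pair_eq_singleton, ← Subgroup.zpowers_eq_closure]
    exact Relation.ReflTransGen.refl)

/-- The full cycle type of a permutation of `Fin n`: the multiset of the lengths of
all its cycles, with fixed points counted as cycles of length `1`. -/
def fullCycleType {n : ℕ} (x : Equiv.Perm (Fin n)) : Multiset ℕ :=
  x.cycleType + Multiset.replicate (n - x.support.card) 1

/-- The multiset of cycle lengths of a `p`-adic element of `S_n`: `a_i` cycles of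
length `p ^ i`, where `n = Σ a_i p ^ i` is the `p`-adic expansion of `n`. -/
def padicCycleMultiset (p n : ℕ) : Multiset ℕ :=
  ∑ i ∈ Finset.range (Nat.digits p n).length,
    Multiset.replicate ((Nat.digits p n).getD i 0) (p ^ i)

/-- A `p`-adic element of `S_n`. -/
def IsPAdic (p : ℕ) {n : ℕ} (x : Equiv.Perm (Fin n)) : Prop :=
  fullCycleType x = padicCycleMultiset p n

/-- A picky element of Type II: a `2`-adic element on `n - 2` points together with
two fixed points. -/
def IsTypeII {n : ℕ} (x : Equiv.Perm (Fin n)) : Prop :=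
  fullCycleType x = padicCycleMultiset 2 (n - 2) + Multiset.replicate 2 1

/-- A picky element of Type III: a `3`-adic element on `n - 3` points together with
three fixed points. -/
def IsTypeIII {n : ℕ} (x : Equiv.Perm (Fin n)) : Prop :=
  fullCycleType x = padicCycleMultiset 3 (n - 3) + Multiset.replicate 3 1

set_option linter.unusedSectionVars false

/-- The bilinear form on complex functions on a finite group for which the irreducible characters
are orthonormal. -/
def charInner {G : Type} [Group G] [Fintype G] (f h : G → ℂ) : ℂ :=
  (Nat.card G : ℂ)⁻¹ * ∑ g, f g * h g⁻¹

/-- Functions that are constant on conjugacy classes. -/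
def IsClassFun {G : Type} [Group G] (f : G → ℂ) : Prop := ∀ g h, f (h * g * h⁻¹) = f g

section
variable {G : Type} [Group G] [Fintype G]

lemma natCard_ne_zero_complex : (Nat.card G : ℂ) ≠ 0 := by simp

lemma charInner_comm (f h : G → ℂ) : charInner f h = charInner h f := by
  unfold charInner
  congr 1
  rw [← Equiv.sum_comp (Equiv.inv G)]
  simp [mul_comm]

lemma charInner_sum_left {ι : Type*} (s : Finset ι) (f : ι → G → ℂ) (h : G → ℂ) :
    charInner (∑ i ∈ s, f i) h = ∑ i ∈ s, charInner (f i) h := by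
  simp only [charInner, Finset.sum_apply, Finset.sum_mul, Finset.mul_sum]
  rw [Finset.sum_comm]

lemma charInner_smul_left (c : ℂ) (f h : G → ℂ) :
    charInner (c • f) h = c * charInner f h := by
  simp only [charInner, Pi.smul_apply, smul_eq_mul, Finset.mul_sum]
  refine Finset.sum_congr rfl fun g _ => by ring

lemma charInner_sub_left (f f' h : G → ℂ) :
    charInner (f - f') h = charInner f h - charInner f' h := by
  simp only [charInner, Pi.sub_apply, sub_mul, Finset.sum_sub_distrib, mul_sub]

/-- Pairing of two characters is a dimension. -/
lemma charInner_character {V W : Type} [AddCommGroup V] [Module ℂ V] [FiniteDimensional ℂ V]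
    [AddCommGroup W] [Module ℂ W] [FiniteDimensional ℂ W]
    (ρ : Representation ℂ G V) (σ : Representation ℂ G W) :
    charInner σ.character ρ.character = Module.finrank ℂ (ρ.IntertwiningMap σ) := by
  have : Invertible (Nat.card G : ℂ) := invertibleOfNonzero natCard_ne_zero_complex
  exact Representation.card_inv_mul_sum_char_mul_char_eq_finrank ρ σ

lemma FDRep.character_eq_rep (V : FDRep ℂ G) : V.character = Representation.character V.ρ := by
  ext g; rfl

lemma Irr_of_charInner_self {V : Type} [AddCommGroup V] [Module ℂ V] [FiniteDimensional ℂ V]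
    (ρ : Representation ℂ G V) (h : charInner ρ.character ρ.character = 1) :
    ρ.character ∈ Irr G := by
  refine ⟨FDRep.of ρ, ?_, ?_⟩
  · rw [FDRep.simple_iff_char_is_norm_one]
    have : ∀ g, (FDRep.of ρ).character g = ρ.character g := fun g => rfl
    simp only [this]
    unfold charInner at h
    rwa [inv_mul_eq_one₀ natCard_ne_zero_complex, eq_comm] at h
  · rfl

lemma Irr_of_irreducible {V : Type} [AddCommGroup V] [Module ℂ V] [FiniteDimensional ℂ V]
    (ρ : Representation ℂ G V) [ρ.IsIrreducible] : ρ.character ∈ Irr G := by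
  apply Irr_of_charInner_self
  rw [charInner_character, Representation.IsIrreducible.finrank_intertwiningMap_self, Nat.cast_one]

lemma Irr_isClassFun {χ : G → ℂ} (h : χ ∈ Irr G) : IsClassFun χ := by
  obtain ⟨V, -, rfl⟩ := h
  intro g h
  exact FDRep.char_conj V g h

lemma charInner_Irr_self {χ : G → ℂ} (h : χ ∈ Irr G) : charInner χ χ = 1 := by
  obtain ⟨V, hV, rfl⟩ := h
  have : Invertible (Nat.card G : ℂ) := invertibleOfNonzero natCard_ne_zero_complex
  have := FDRep.char_orthonormal V V
  rw [if_pos ⟨Iso.refl V⟩] at this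
  exact this

lemma charInner_Irr_ne {χ ψ : G → ℂ} (h : χ ∈ Irr G) (h' : ψ ∈ Irr G) (hne : χ ≠ ψ) :
    charInner χ ψ = 0 := by
  obtain ⟨V, hV, rfl⟩ := h
  obtain ⟨W, hW, rfl⟩ := h'
  have : Invertible (Nat.card G : ℂ) := invertibleOfNonzero natCard_ne_zero_complex
  have := FDRep.char_orthonormal V W
  rw [if_neg] at this
  · exact this
  · rintro ⟨i⟩
    exact hne (FDRep.char_iso i)

open Classical in
lemma charInner_Irr {χ ψ : G → ℂ} (h : χ ∈ Irr G) (h' : ψ ∈ Irr G) :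
    charInner χ ψ = if χ = ψ then 1 else 0 := by
  split_ifs with he
  · subst he; exact charInner_Irr_self h
  · exact charInner_Irr_ne h h' he

lemma sum_classFun_smul_eq_zero {V : Type} [AddCommGroup V] [Module ℂ V] [FiniteDimensional ℂ V]
    (ρ : Representation ℂ G V) [hρ : ρ.IsIrreducible] {f : G → ℂ} (hf : IsClassFun f)
    (h : charInner f ρ.character = 0) : ∑ g, f g⁻¹ • ρ g = 0 := by
  let T : ρ.IntertwiningMap ρ :=
    { toLinearMap := ∑ g, f g⁻¹ • ρ g
      isIntertwining' := by
        intro a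
        rw [← Module.End.mul_eq_comp, ← Module.End.mul_eq_comp, Finset.sum_mul, Finset.mul_sum,
          ← Equiv.sum_comp (MulAut.conj a).toEquiv]
        refine Finset.sum_congr rfl fun g _ => ?_
        have : f (a * g * a⁻¹)⁻¹ = f g⁻¹ := by
          rw [← hf g⁻¹ a]; congr 1; group
        simp only [MulEquiv.toEquiv_eq_coe, MulEquiv.coe_toEquiv, MulAut.conj_apply, this,
          smul_mul_assoc, mul_smul_comm]
        congr 1
        rw [← map_mul, ← map_mul]
        simp }
  obtain ⟨c, hc⟩ :=
    (Representation.IsIrreducible.algebraMap_intertwiningMap_bijective_of_isAlgClosed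
      (ρ := ρ)).2 T
  have hc' : ∑ g, f g⁻¹ • ρ g = c • LinearMap.id := by
    have := congrArg (fun F => F.toLinearMap) hc
    exact this.symm
  have h1 : ∑ g, f g * ρ.character g⁻¹ = 0 := by
    rcases mul_eq_zero.1 h with h0 | h0
    · exact absurd h0 (inv_ne_zero natCard_ne_zero_complex)
    · exact h0
  have h2 := congrArg (LinearMap.trace ℂ _) hc'
  rw [map_sum] at h2
  have h3 : ∑ g, (LinearMap.trace ℂ V) (f g⁻¹ • ρ g) = 0 := by
    rw [← h1, ← Equiv.sum_comp (Equiv.inv G)]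
    refine Finset.sum_congr rfl fun g _ => ?_
    simp [Representation.character]
  rw [h3, map_smul, LinearMap.trace_id, smul_eq_mul, eq_comm, mul_eq_zero] at h2
  rcases h2 with h2 | h2
  · rw [hc', h2, zero_smul]
  · have : Module.finrank ℂ V = 0 := by exact_mod_cast h2
    have := Module.finrank_zero_iff.1 this
    ext v
    exact Subsingleton.elim _ _

lemma smul_simple_eq_zero {f : G → ℂ} (hf : IsClassFun f)
    (h : ∀ χ ∈ Irr G, charInner f χ = 0) (M : Type) [AddCommGroup M]
    [Module (MonoidAlgebra ℂ G) M] [IsSimpleModule (MonoidAlgebra ℂ G) M] (v : M) :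
    (∑ g : G, MonoidAlgebra.single g (f g⁻¹)) • v = 0 := by
  let _ : Module ℂ M := Module.compHom M (algebraMap ℂ (MonoidAlgebra ℂ G))
  have : IsScalarTower ℂ (MonoidAlgebra ℂ G) M := IsScalarTower.of_algebraMap_smul fun _ _ => rfl
  have : FiniteDimensional ℂ M := Module.Finite.trans (MonoidAlgebra ℂ G) _
  let ρ := Representation.ofModule' (k := ℂ) (G := G) M
  have hρ : ∀ r (m : M), ρ.asAlgebraHom r m = r • m := by
    intro r m
    have : ρ.asAlgebraHom = Algebra.lsmul ℂ ℂ M := Equiv.apply_symm_apply _ _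
    rw [this]
    rfl
  let e : ρ.asModule ≃ₗ[MonoidAlgebra ℂ G] M :=
    { toAddEquiv := ρ.asModuleEquiv.toAddEquiv
      map_smul' := fun r m => hρ r _ }
  have hirr : ρ.IsIrreducible := by
    rw [Representation.irreducible_iff_isSimpleModule_asModule]
    exact IsSimpleModule.congr e
  have h1 := sum_classFun_smul_eq_zero _ hf (h _ (Irr_of_irreducible ρ))
  have h2 := congrArg (fun F => F v) h1
  rw [← hρ]
  simpa [Representation.asAlgebraHom_single] using h2

/-- A class function orthogonal to all irreducible characters vanishes. -/
lemma classFun_eq_zero {f : G → ℂ} (hf : IsClassFun f)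
    (h : ∀ χ ∈ Irr G, charInner f χ = 0) : f = 0 := by
  have hz : (∑ g : G, MonoidAlgebra.single g (f g⁻¹)) ∈ Ring.jacobson (MonoidAlgebra ℂ G) := by
    rw [Ring.jacobson, Module.jacobson, Submodule.mem_sInf]
    intro m hm
    have : IsSimpleModule (MonoidAlgebra ℂ G) (MonoidAlgebra ℂ G ⧸ m) :=
      isSimpleModule_iff_isCoatom.2 hm
    have h2 := smul_simple_eq_zero hf h (MonoidAlgebra ℂ G ⧸ m) (Submodule.Quotient.mk (p := m) 1)
    rwa [← Submodule.Quotient.mk_smul, Submodule.Quotient.mk_eq_zero, smul_eq_mul, mul_one] at h2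
  rw [IsSemisimpleRing.jacobson_eq_bot, Submodule.mem_bot] at hz
  ext g
  classical
  have := congrArg (fun F : MonoidAlgebra ℂ G => F.coeff g⁻¹) hz
  simpa [MonoidAlgebra.coeff_sum, Finsupp.finsetSum_apply, Finsupp.single_apply] using this

end

/-- The traces of the powers of an operator of finite order are power sums of roots of unity. -/
lemma exists_trace_pow_eq {V : Type} [AddCommGroup V] [Module ℂ V] [FiniteDimensional ℂ V]
    (T : Module.End ℂ V) {n : ℕ} (hn : n ≠ 0) (hT : T ^ n = 1) :
    ∃ (S : Finset ℂ) (d : ℂ → ℕ), (∀ μ ∈ S, μ ^ n = 1) ∧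
      ∀ j : ℕ, LinearMap.trace ℂ V (T ^ j) = ∑ μ ∈ S, (d μ : ℂ) * μ ^ j := by
  classical
  have hss : T.IsSemisimple := by
    refine Module.End.isSemisimple_of_squarefree_aeval_eq_zero (p := Polynomial.X ^ n - 1) ?_ ?_
    · exact (Polynomial.X_pow_sub_one_separable_iff.2 (by exact_mod_cast hn)).squarefree
    · simp [hT]
  have hint : DirectSum.IsInternal T.eigenspace :=
    (DirectSum.isInternal_submodule_iff_iSupIndep_and_iSup_eq_top _).2
      ⟨T.eigenspaces_iSupIndep, hss.iSup_eigenspace_eq_top⟩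
  have hfin : {μ | T.eigenspace μ ≠ ⊥}.Finite := Module.End.finite_hasEigenvalue T
  refine ⟨hfin.toFinset, fun μ => Module.finrank ℂ (T.eigenspace μ), ?_, ?_⟩
  · intro μ hμ
    rw [Set.Finite.mem_toFinset] at hμ
    obtain ⟨v, hv, hv0⟩ := (Submodule.ne_bot_iff _).1 hμ
    have h1 : ((T ^ n : Module.End ℂ V)) v = μ ^ n • v :=
      Module.End.HasEigenvector.pow_apply ⟨hv, hv0⟩ n
    rw [hT, Module.End.one_apply] at h1
    have h2 : (μ ^ n - 1) • v = 0 := by rw [sub_smul, ← h1, one_smul, sub_self]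
    rcases smul_eq_zero.1 h2 with h | h
    · exact sub_eq_zero.1 h
    · exact absurd h hv0
  · intro j
    have happ : ∀ μ, ∀ v ∈ T.eigenspace μ, (T ^ j : Module.End ℂ V) v = μ ^ j • v := by
      intro μ v hv
      by_cases h0 : v = 0
      · simp [h0]
      · exact Module.End.HasEigenvector.pow_apply ⟨hv, h0⟩ j
    have hmaps : ∀ μ, Set.MapsTo (T ^ j : Module.End ℂ V) (T.eigenspace μ) (T.eigenspace μ) := by
      intro μ v hv
      rw [happ μ v hv]
      exact Submodule.smul_mem _ _ hv
    rw [LinearMap.trace_eq_sum_trace_restrict' hint hfin hmaps]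
    refine Finset.sum_congr rfl fun μ _ => ?_
    have : (T ^ j : Module.End ℂ V).restrict (hmaps μ) = μ ^ j • LinearMap.id := by
      ext v
      exact happ μ v.1 v.2
    rw [this, map_smul, LinearMap.trace_id, smul_eq_mul, mul_comm]

section
variable {G : Type} [Group G] [Fintype G]

lemma Irr_natural_values {χ : G → ℂ} (hχ : χ ∈ Irr G) (g : G) {n : ℕ} (hn : n ≠ 0)
    (hg : g ^ n = 1) :
    ∃ (S : Finset ℂ) (d : ℂ → ℕ), (∀ μ ∈ S, μ ^ n = 1) ∧
      ∀ j : ℕ, χ (g ^ j) = ∑ μ ∈ S, (d μ : ℂ) * μ ^ j := by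
  obtain ⟨V, -, rfl⟩ := hχ
  have hT : (V.ρ g : Module.End ℂ V) ^ n = 1 := by
    rw [← map_pow, hg, map_one]
  obtain ⟨S, d, h1, h2⟩ := exists_trace_pow_eq (V.ρ g) hn hT
  refine ⟨S, d, h1, fun j => ?_⟩
  rw [← h2]
  show LinearMap.trace ℂ V (V.ρ (g ^ j)) = _
  rw [map_pow]

lemma Irr_inv {χ : G → ℂ} (hχ : χ ∈ Irr G) (g : G) : χ g⁻¹ = (starRingEnd ℂ) (χ g) := by
  have hn : Fintype.card G ≠ 0 := Fintype.card_ne_zero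
  obtain ⟨S, d, h1, h2⟩ := Irr_natural_values hχ g hn (pow_card_eq_one)
  have hinv : g⁻¹ = g ^ (Fintype.card G - 1) := by
    rw [inv_eq_iff_mul_eq_one, ← pow_succ', Nat.sub_add_cancel (Nat.pos_of_ne_zero hn),
      pow_card_eq_one]
  have hg : χ g = ∑ μ ∈ S, (d μ : ℂ) * μ ^ 1 := by rw [← h2, pow_one]
  rw [hinv, h2, hg, map_sum]
  refine Finset.sum_congr rfl fun μ hμ => ?_
  have hu : μ ^ Fintype.card G = 1 := h1 μ hμ
  have hμ0 : μ ≠ 0 := by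
    rintro rfl
    rw [zero_pow hn] at hu
    exact zero_ne_one hu
  have hnorm : ‖μ‖ = 1 := Complex.norm_eq_one_of_pow_eq_one hu hn
  rw [map_mul, Complex.conj_natCast, pow_one, ← Complex.inv_eq_conj hnorm]
  congr 1
  rw [← mul_eq_one_iff_eq_inv₀ hμ0, ← pow_succ, Nat.sub_add_cancel (Nat.pos_of_ne_zero hn), hu]

lemma Irr_one {χ : G → ℂ} (hχ : χ ∈ Irr G) : χ 1 = charDeg χ := by
  obtain ⟨V, -, rfl⟩ := hχ
  simp [charDeg, FDRep.char_one]

/-- A character vanishing on an element of 2-power order has even degree. -/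
lemma even_charDeg {χ : G → ℂ} (hχ : χ ∈ Irr G) {g : G} {k : ℕ} (hg : g ^ 2 ^ k = 1)
    (h0 : χ g = 0) : 2 ∣ charDeg χ := by
  obtain ⟨S, d, h1, h2⟩ := Irr_natural_values hχ g (pow_ne_zero k two_ne_zero) hg
  let A := integralClosure ℤ ℂ
  have hint : ∀ μ ∈ S, IsIntegral ℤ μ := fun μ hμ =>
    IsIntegral.of_pow (pow_pos two_pos k) (by rw [h1 μ hμ]; exact isIntegral_one)
  let u : S → A := fun μ => ⟨μ.1, hint _ μ.2⟩
  have hsum0 : ∑ μ : S, ((d μ.1 : ℕ) : A) * u μ = 0 := by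
    apply Subtype.ext
    rw [AddSubmonoidClass.coe_finsetSum]
    rw [← pow_one g, h2] at h0
    rw [← Finset.sum_coe_sort] at h0
    simpa [u] using h0
  have hu : ∀ μ, u μ ^ 2 ^ k = 1 := fun μ => Subtype.ext (by simpa [u] using h1 _ μ.2)
  have hdeg : ((charDeg χ : ℕ) : A) = ∑ μ : S, ((d μ.1 : ℕ) : A) := by
    apply Subtype.ext
    have := h2 0
    rw [pow_zero, Irr_one hχ, ← Finset.sum_coe_sort] at this
    simpa using this
  have hmem : ((charDeg χ : ℕ) : A) ∈ Ideal.span {(2 : A)} := by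
    rw [← Ideal.Quotient.eq_zero_iff_mem]
    have h2z : (2 : A ⧸ Ideal.span {(2 : A)}) = 0 := by
      have : Ideal.Quotient.mk (Ideal.span {(2 : A)}) 2 = 0 :=
        Ideal.Quotient.eq_zero_iff_mem.2 (Ideal.subset_span rfl)
      rwa [map_ofNat] at this
    set q := Ideal.Quotient.mk (Ideal.span {(2 : A)})
    by_cases h10 : (1 : A ⧸ Ideal.span {(2 : A)}) = 0
    · rw [← mul_one (q _), h10, mul_zero]
    have := CharTwo.of_one_ne_zero_of_two_eq_zero h10 h2z
    have hpow : ∀ m : ℕ, (m : A ⧸ Ideal.span {(2 : A)}) ^ 2 ^ k = m := by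
      intro m
      rcases Nat.even_or_odd' m with ⟨c, rfl | rfl⟩
      · simp [h2z]
      · simp [h2z]
    have := congrArg (fun z => q z ^ 2 ^ k) hsum0
    simp only [map_sum, map_mul, map_natCast, map_zero] at this
    rw [sum_pow_char_pow, zero_pow (by positivity)] at this
    rw [hdeg, map_sum, ← this]
    refine Finset.sum_congr rfl fun μ _ => ?_
    rw [mul_pow, hpow, ← map_pow, hu, map_one, mul_one, map_natCast]
  rw [Ideal.mem_span_singleton] at hmem
  obtain ⟨b, hb⟩ := hmem
  have hb' : (charDeg χ : ℂ) = 2 * (b : ℂ) := by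
    have := congrArg A.val hb
    rwa [map_natCast, map_mul, map_ofNat] at this
  have hbi : IsIntegral ℤ ((charDeg χ : ℚ) / 2) := by
    have : IsIntegral ℤ (algebraMap ℚ ℂ ((charDeg χ : ℚ) / 2)) := by
      have e : algebraMap ℚ ℂ ((charDeg χ : ℚ) / 2) = b := by
        simp [hb']
      rw [e]; exact b.2
    exact (isIntegral_algebraMap_iff (algebraMap ℚ ℂ).injective).1 this
  obtain ⟨z, hz⟩ := IsIntegrallyClosed.isIntegral_iff.1 hbi
  have : (charDeg χ : ℤ) = 2 * z := by
    have h : (z : ℚ) = (charDeg χ : ℚ) / 2 := by simpa using hz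
    have : ((charDeg χ : ℤ) : ℚ) = ((2 * z : ℤ) : ℚ) := by push_cast; rw [h]; ring
    exact_mod_cast this
  omega

end

section
variable {G : Type} [Group G] [Fintype G]

variable (G) in
lemma Irr_finite : (Irr G).Finite := by
  classical
  have hli : LinearIndependent ℂ (fun χ : Irr G => (χ : G → ℂ)) := by
    rw [linearIndependent_iff']
    intro s c hs χ hχ
    have h1 : charInner (∑ ψ ∈ s, c ψ • (ψ : G → ℂ)) χ = 0 := by
      rw [hs]; simp [charInner]
    rw [charInner_sum_left, Finset.sum_eq_single χ] at h1
    · simpa [charInner_smul_left, charInner_Irr_self χ.2] using h1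
    · intro ψ _ hne
      rw [charInner_smul_left, charInner_Irr_ne ψ.2 χ.2 (fun h => hne (Subtype.ext h)), mul_zero]
    · intro h; exact absurd hχ h
  exact LinearIndependent.setFinite hli

variable (G) in
/-- The irreducible characters as a finset. -/
def irrFinset : Finset (G → ℂ) := (Irr_finite G).toFinset

lemma mem_irrFinset {χ : G → ℂ} : χ ∈ irrFinset G ↔ χ ∈ Irr G := Set.Finite.mem_toFinset _

lemma IsClassFun.sum {ι : Type*} (s : Finset ι) {f : ι → G → ℂ} (h : ∀ i ∈ s, IsClassFun (f i)) :
    IsClassFun (∑ i ∈ s, f i) := by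
  intro a b
  simp only [Finset.sum_apply]
  exact Finset.sum_congr rfl fun i hi => h i hi a b

lemma classFun_eq_sum {f : G → ℂ} (hf : IsClassFun f) :
    f = ∑ χ ∈ irrFinset G, charInner f χ • χ := by
  classical
  rw [← sub_eq_zero]
  refine classFun_eq_zero ?_ ?_
  · have h1 : IsClassFun (∑ χ ∈ irrFinset G, charInner f χ • χ) :=
      IsClassFun.sum _ fun χ hχ a b => by
        simp only [Pi.smul_apply, Irr_isClassFun (mem_irrFinset.1 hχ) a b]
    intro a b
    simp only [Pi.sub_apply, hf a b, h1 a b]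
  · intro ψ hψ
    rw [charInner_sub_left, charInner_sum_left, Finset.sum_eq_single ψ]
    · rw [charInner_smul_left, charInner_Irr_self hψ, mul_one, sub_self]
    · intro χ hχ hne
      rw [charInner_smul_left, charInner_Irr_ne (mem_irrFinset.1 hχ) hψ hne, mul_zero]
    · intro h; exact absurd (mem_irrFinset.2 hψ) h

/-- Second orthogonality relation. -/
lemma sum_Irr_inv_mul (x y : G) :
    ∑ χ ∈ irrFinset G, χ x⁻¹ * χ y = (Nat.card {h : G // h * x * h⁻¹ = y} : ℂ) := by
  classical
  let f : G → ℂ := fun y => (Nat.card {h : G // h * x * h⁻¹ = y} : ℂ)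
  have hfs : ∀ y, f y = ∑ h : G, if h * x * h⁻¹ = y then 1 else 0 := by
    intro y
    simp [f, Nat.card_eq_fintype_card, Fintype.card_subtype]
  have hf : IsClassFun f := by
    intro a b
    rw [hfs, hfs, ← Equiv.sum_comp (Equiv.mulLeft b)]
    refine Finset.sum_congr rfl fun h _ => ?_
    have : b * h * x * (b * h)⁻¹ = b * a * b⁻¹ ↔ h * x * h⁻¹ = a := by
      rw [show b * h * x * (b * h)⁻¹ = b * (h * x * h⁻¹) * b⁻¹ by group]
      simp
    simp only [Equiv.coe_mulLeft, this]
  have hin : ∀ χ ∈ Irr G, charInner f χ = χ x⁻¹ := by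
    intro χ hχ
    have hc := Irr_isClassFun hχ
    unfold charInner
    have : ∑ g, f g * χ g⁻¹ = ∑ h : G, χ x⁻¹ := by
      simp only [hfs, Finset.sum_mul]
      rw [Finset.sum_comm]
      refine Finset.sum_congr rfl fun h _ => ?_
      simp only [ite_mul, one_mul, zero_mul, Finset.sum_ite_eq, Finset.mem_univ, if_true]
      rw [← hc x⁻¹ h]
      congr 1; group
    rw [this, Finset.sum_const, Finset.card_univ, nsmul_eq_mul, ← Nat.card_eq_fintype_card,
      ← mul_assoc, inv_mul_cancel₀ natCard_ne_zero_complex, one_mul]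
  have := congrFun (classFun_eq_sum hf) y
  show _ = f y
  rw [this, Finset.sum_apply]
  refine Finset.sum_congr rfl fun χ hχ => ?_
  rw [Pi.smul_apply, smul_eq_mul, hin χ (mem_irrFinset.1 hχ)]

lemma sum_Irr_normSq (x : G) :
    ∑ χ ∈ irrFinset G, Complex.normSq (χ x) = (Nat.card (Subgroup.centralizer {x}) : ℝ) := by
  have h := sum_Irr_inv_mul x x
  have h1 : ∑ χ ∈ irrFinset G, χ x⁻¹ * χ x =
      ((∑ χ ∈ irrFinset G, Complex.normSq (χ x) : ℝ) : ℂ) := by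
    rw [Complex.ofReal_sum]
    refine Finset.sum_congr rfl fun χ hχ => ?_
    rw [Irr_inv (mem_irrFinset.1 hχ), Complex.normSq_eq_conj_mul_self]
  have h2 : Nat.card {h : G // h * x * h⁻¹ = x} = Nat.card (Subgroup.centralizer {x}) := by
    refine Nat.card_congr (Equiv.subtypeEquivRight fun h => ?_)
    rw [Subgroup.mem_centralizer_singleton_iff, mul_inv_eq_iff_eq_mul]
  rw [h1, h2] at h
  exact_mod_cast h

/-- If the squares of the values at `x` over a set of irreducible characters already exhaust the
order of the centralizer, all other irreducible characters vanish at `x`. -/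
lemma Irr_eq_zero_of_card_centralizer_le {x : G} {Φ : Finset (G → ℂ)} (hΦ : ∀ χ ∈ Φ, χ ∈ Irr G)
    (h : (Nat.card (Subgroup.centralizer {x}) : ℝ) ≤ ∑ χ ∈ Φ, Complex.normSq (χ x))
    {χ : G → ℂ} (hχ : χ ∈ Irr G) (hnot : χ ∉ Φ) : χ x = 0 := by
  classical
  have hsub : insert χ Φ ⊆ irrFinset G := by
    intro ψ hψ
    rw [mem_irrFinset]
    rcases Finset.mem_insert.1 hψ with rfl | h
    · exact hχ
    · exact hΦ _ h
  have h1 := Finset.sum_le_sum_of_subset_of_nonneg hsub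
    (f := fun χ => Complex.normSq (χ x)) (fun _ _ _ => Complex.normSq_nonneg _)
  rw [sum_Irr_normSq, Finset.sum_insert hnot] at h1
  have h2 := Complex.normSq_nonneg (χ x)
  exact Complex.normSq_eq_zero.1 (by linarith)

/-- An integral virtual character of norm one is irreducible up to sign. -/
lemma Irr_or_neg_of_norm_one {f : G → ℂ} (hf : IsClassFun f)
    (hint : ∀ χ ∈ Irr G, ∃ z : ℤ, charInner f χ = z) (h1 : charInner f f = 1) :
    f ∈ Irr G ∨ -f ∈ Irr G := by
  classical
  choose! z hz using hint
  have he := classFun_eq_sum hf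
  have hsq : ∑ χ ∈ irrFinset G, z χ ^ 2 = 1 := by
    have : charInner f f = ∑ χ ∈ irrFinset G, ((z χ : ℂ)) ^ 2 := by
      conv_lhs => rw [he]
      rw [charInner_sum_left]
      refine Finset.sum_congr rfl fun χ hχ => ?_
      rw [charInner_smul_left, ← he, charInner_comm χ f, hz χ (mem_irrFinset.1 hχ), sq]
    rw [h1] at this
    exact_mod_cast this.symm
  obtain ⟨χ, hχ, hne⟩ : ∃ χ ∈ irrFinset G, z χ ≠ 0 := by
    by_contra! hcon
    rw [Finset.sum_eq_zero (fun χ hχ => by rw [hcon χ hχ]; rfl)] at hsq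
    exact zero_ne_one hsq
  have hχ1 : 1 ≤ z χ ^ 2 := by
    have := pow_pos (abs_pos.2 hne) 2
    rw [sq_abs] at this
    omega
  rw [← Finset.add_sum_erase _ _ hχ] at hsq
  have hnn : 0 ≤ ∑ ψ ∈ (irrFinset G).erase χ, z ψ ^ 2 := Finset.sum_nonneg fun _ _ => sq_nonneg _
  have h0 : ∑ ψ ∈ (irrFinset G).erase χ, z ψ ^ 2 = 0 := by omega
  rw [Finset.sum_eq_zero_iff_of_nonneg (fun _ _ => sq_nonneg _)] at h0
  have hf' : f = (z χ : ℂ) • χ := by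
    rw [he, ← Finset.add_sum_erase _ _ hχ, Finset.sum_eq_zero, add_zero,
      hz χ (mem_irrFinset.1 hχ)]
    intro ψ hψ
    rw [hz ψ (mem_irrFinset.1 (Finset.mem_of_mem_erase hψ)),
      pow_eq_zero_iff two_ne_zero |>.1 (h0 ψ hψ)]
    simp
  have : z χ ^ 2 = 1 := by omega
  rcases mul_self_eq_one_iff.1 ((sq _).symm.trans this) with h | h
  · left; rw [hf', h]; simpa using mem_irrFinset.1 hχ
  · right; rw [hf', h]; simpa using mem_irrFinset.1 hχ

end

/-- The number of orbits producing characters of degree with 2-part `2 ^ a`. -/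
def pickyCount : ℕ → ℕ → ℕ
  | 0, _ => 0
  | _ + 1, 0 => 0
  | k + 1, 1 => 2 ^ (k - 1) * (2 ^ (k - 1) - 1)
  | k + 1, a + 2 => 2 ^ k * pickyCount k (a + 1)

/-- The order of the centralizer of a picky element of Type II in `S_{2^k}`. -/
def pickyCentralizer : ℕ → ℕ
  | 0 => 2
  | k + 1 => 2 ^ k * pickyCentralizer k

lemma sum_pickyCount {k : ℕ} (hk : 1 ≤ k) :
    2 ^ k + 4 * ∑ a ∈ Finset.range k, pickyCount k (a + 1) = pickyCentralizer k := by
  induction k, hk using Nat.le_induction with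
  | base => simp [pickyCount, pickyCentralizer]
  | succ k hk ih =>
    rw [Finset.sum_range_succ', pickyCentralizer, ← ih]
    simp only [pickyCount]
    rw [← Finset.mul_sum]
    obtain ⟨m, rfl⟩ : ∃ m, k = m + 1 := ⟨k - 1, by omega⟩
    simp only [Nat.add_sub_cancel]
    have h1 : 1 ≤ 2 ^ m := Nat.one_le_two_pow
    obtain ⟨q, hq⟩ : ∃ q, 2 ^ m = q + 1 := ⟨2 ^ m - 1, by omega⟩
    simp only [pow_succ, hq, Nat.add_sub_cancel]
    ring

/-- The pattern of values shared by the character tables of `S_{2^k}` and of its Sylow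
2-subgroup at a picky element `x` and a full cycle `g`. -/
def PickyTable (G : Type) [Group G] (x g : G) (k : ℕ) : Prop :=
  ∃ Ψ : ℕ → Finset (G → ℂ),
    (∀ a, ∀ ψ ∈ Ψ a, ψ ∈ Irr G ∧ pPart 2 (charDeg ψ) = 2 ^ a) ∧
    (∀ ψ ∈ Ψ 0, (ψ x = 1 ∨ ψ x = -1) ∧ (ψ g = 1 ∨ ψ g = -1)) ∧
    (∀ a, ∀ ψ ∈ Ψ (a + 1), (ψ x = 2 ∨ ψ x = -2) ∧ ψ g = 0) ∧
    (Ψ 0).card = 2 ^ k ∧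
    Nat.card {ψ // ψ ∈ Ψ 0 ∧ ψ x = ψ g} = 2 ^ (k - 1) ∧
    (∀ a, (Ψ (a + 1)).card = pickyCount k (a + 1)) ∧
    (∀ ψ ∈ Irr G, ψ x ≠ 0 → ∃ a, ψ ∈ Ψ a) ∧
    (∀ ψ ∈ Irr G, ¬ 2 ∣ charDeg ψ → ψ ∈ Ψ 0)

lemma pickyTable_of_families {G : Type} [Group G] [Finite G] {x g : G} {k : ℕ} (hk : 1 ≤ k)
    (hgk : g ^ 2 ^ k = 1) (hxg : ¬ IsConj x g)
    (hcx : Nat.card (Subgroup.centralizer {x}) ≤ pickyCentralizer k)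
    (hcg : Nat.card (Subgroup.centralizer {g}) ≤ 2 ^ k)
    (Ψ : ℕ → Finset (G → ℂ))
    (hdeg : ∀ a, ∀ ψ ∈ Ψ a, ψ ∈ Irr G ∧ pPart 2 (charDeg ψ) = 2 ^ a)
    (h0 : ∀ ψ ∈ Ψ 0, (ψ x = 1 ∨ ψ x = -1) ∧ (ψ g = 1 ∨ ψ g = -1))
    (h1 : ∀ a, ∀ ψ ∈ Ψ (a + 1), ψ x = 2 ∨ ψ x = -2)
    (hc0 : (Ψ 0).card = 2 ^ k)
    (hc1 : ∀ a, (Ψ (a + 1)).card = pickyCount k (a + 1)) : PickyTable G x g k := by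
  classical
  have := Fintype.ofFinite G
  have hdisj : ∀ a b, a ≠ b → Disjoint (Ψ a) (Ψ b) := by
    intro a b hab
    rw [Finset.disjoint_left]
    intro ψ ha hb
    have := (hdeg a ψ ha).2.symm.trans (hdeg b ψ hb).2
    exact hab (Nat.pow_right_injective le_rfl this)
  let Φ := (Finset.range (k + 1)).biUnion Ψ
  have hΦ : ∀ χ ∈ Φ, χ ∈ Irr G := by
    intro χ hχ
    obtain ⟨a, -, ha⟩ := Finset.mem_biUnion.1 hχ
    exact (hdeg a χ ha).1
  have hsum : ∑ χ ∈ Φ, Complex.normSq (χ x) = pickyCentralizer k := by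
    rw [Finset.sum_biUnion (fun a _ b _ hab => hdisj a b hab), Finset.sum_range_succ',
      ← sum_pickyCount hk]
    have e0 : ∑ χ ∈ Ψ 0, Complex.normSq (χ x) = 2 ^ k := by
      rw [Finset.sum_congr rfl (g := fun _ => (1 : ℝ)), Finset.sum_const, hc0]
      · simp
      · intro χ hχ
        rcases (h0 χ hχ).1 with h | h <;> simp [h]
    have e1 : ∀ a, ∑ χ ∈ Ψ (a + 1), Complex.normSq (χ x) = 4 * pickyCount k (a + 1) := by
      intro a
      rw [Finset.sum_congr rfl (g := fun _ => (4 : ℝ)), Finset.sum_const, hc1]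
      · simp [mul_comm]
      · intro χ hχ
        rcases h1 a χ hχ with h | h <;> simp [h] <;> norm_num
    simp only [e0, e1]
    rw [← Finset.mul_sum]
    push_cast
    ring
  have hcompx : ∀ ψ ∈ Irr G, ψ x ≠ 0 → ∃ a, ψ ∈ Ψ a := by
    intro ψ hψ hne
    by_contra! hcon
    refine hne (Irr_eq_zero_of_card_centralizer_le hΦ ?_ hψ ?_)
    · rw [hsum]; exact_mod_cast hcx
    · intro h
      obtain ⟨a, -, ha⟩ := Finset.mem_biUnion.1 h
      exact hcon a ha
  have hcompg : ∀ ψ ∈ Irr G, ψ ∉ Ψ 0 → ψ g = 0 := by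
    intro ψ hψ hnot
    refine Irr_eq_zero_of_card_centralizer_le (fun χ hχ => (hdeg 0 χ hχ).1) ?_ hψ hnot
    rw [Finset.sum_congr rfl (g := fun _ => (1 : ℝ)), Finset.sum_const, hc0]
    · simp only [nsmul_eq_mul, mul_one]; exact_mod_cast hcg
    · intro χ hχ
      rcases (h0 χ hχ).2 with h | h <;> simp [h]
  refine ⟨Ψ, hdeg, h0, fun a ψ hψ => ⟨h1 a ψ hψ, hcompg ψ (hdeg _ ψ hψ).1
    (Finset.disjoint_right.1 (hdisj 0 (a + 1) (by omega)) hψ)⟩, hc0, ?_, hc1, hcompx, ?_⟩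
  · have hz := sum_Irr_inv_mul g x
    have : IsEmpty {h : G // h * g * h⁻¹ = x} :=
      ⟨fun h => hxg (isConj_comm.1 (isConj_iff.2 ⟨h.1, h.2⟩))⟩
    rw [Nat.card_of_isEmpty, Nat.cast_zero, ← Finset.sum_subset (s₁ := Ψ 0)
      (fun ψ hψ => mem_irrFinset.2 (hdeg 0 ψ hψ).1) ?_] at hz
    · rw [Finset.sum_congr rfl (g := fun ψ => if ψ x = ψ g then (1 : ℂ) else -1)] at hz
      · rw [Finset.sum_ite, Finset.sum_const, Finset.sum_const] at hz
        have hcard := Finset.card_filter_add_card_filter_not (s := Ψ 0) (fun ψ => ψ x = ψ g)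
        have : ((Ψ 0).filter (fun ψ => ψ x = ψ g)).card
            = ((Ψ 0).filter (fun ψ => ¬ ψ x = ψ g)).card := by
          have : (((Ψ 0).filter (fun ψ => ψ x = ψ g)).card : ℂ)
            = ((Ψ 0).filter (fun ψ => ¬ ψ x = ψ g)).card := by
            simp only [nsmul_eq_mul, mul_one, mul_neg] at hz
            linear_combination hz
          exact_mod_cast this
        have hpow : 2 ^ k = 2 * 2 ^ (k - 1) := by
          rw [← pow_succ', Nat.sub_add_cancel hk]
        have e : Nat.card {ψ // ψ ∈ Ψ 0 ∧ ψ x = ψ g}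
            = ((Ψ 0).filter (fun ψ => ψ x = ψ g)).card := by
          rw [← Nat.card_eq_finsetCard]
          exact Nat.card_congr (Equiv.subtypeEquivRight (by simp))
        omega
      · intro ψ hψ
        rw [Irr_inv (hdeg 0 ψ hψ).1]
        obtain ⟨hx, hg⟩ := h0 ψ hψ
        rcases hx with hx | hx <;> rcases hg with hg | hg <;> rw [hx, hg] <;> norm_num
    · intro ψ hψ hnot
      rw [Irr_inv (mem_irrFinset.1 hψ), hcompg ψ (mem_irrFinset.1 hψ) hnot, map_zero, zero_mul]
  · intro ψ hψ hodd
    by_contra hnot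
    exact hodd (even_charDeg hψ hgk (hcompg ψ hψ hnot))

lemma charDeg_ne_zero {G : Type} [Group G] [Finite G] {χ : G → ℂ} (hχ : χ ∈ Irr G) :
    charDeg χ ≠ 0 := by
  have := Fintype.ofFinite G
  intro h
  have h1 := charInner_Irr_self hχ
  have hz : ∀ g, χ g = 0 := by
    obtain ⟨V, hV, rfl⟩ := hχ
    have : Module.finrank ℂ V = 0 := by
      simpa [charDeg, FDRep.char_one] using h
    have := Module.finrank_zero_iff.1 this
    intro g
    have : V.ρ g = 0 := Subsingleton.elim _ _
    show LinearMap.trace ℂ V (V.ρ g) = 0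
    rw [this, map_zero]
  simp [charInner, hz] at h1

lemma mem_IrrP'_iff {G : Type} [Group G] [Finite G] {p : ℕ} {χ : G → ℂ} :
    χ ∈ IrrP' p G ↔ χ ∈ Irr G ∧ ¬ p ∣ charDeg χ := by
  have key : ∀ V : FDRep ℂ G, charDeg V.character = Module.finrank ℂ V := by
    intro V; simp [charDeg, FDRep.char_one]
  constructor
  · rintro ⟨V, hV, rfl, h⟩
    exact ⟨⟨V, hV, rfl⟩, by rwa [key]⟩
  · rintro ⟨⟨V, hV, rfl⟩, h⟩
    exact ⟨V, hV, rfl, by rwa [key] at h⟩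

lemma pPart_eq_one_iff {m : ℕ} (hm : m ≠ 0) : pPart 2 m = 1 ↔ ¬ 2 ∣ m := by
  unfold pPart
  rw [Nat.pow_eq_one]
  simp [Nat.factorization_eq_zero_iff, Nat.prime_two, hm]

/-- The size of the set of characters in a `PickyTable` with 2-part of the degree `2 ^ a` and
prescribed product of the values at `x` and `g`. -/
def pickyFibre (k : ℕ) : ℕ → ℂ → ℕ := fun a c => by
  classical
  exact match a with
    | 0 => if c = 1 ∨ c = -1 then 2 ^ (k - 1) else 0
    | a + 1 => if c = 0 then pickyCount k (a + 1) else 0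

lemma PickyTable.summary {G : Type} [Group G] [Finite G] {x g : G} {k : ℕ} (hk : 1 ≤ k)
    (h : PickyTable G x g k) :
    (∀ χ ∈ IrrX G x, (¬ 2 ∣ charDeg χ ∧ (χ x = 1 ∨ χ x = -1) ∧ (χ g = 1 ∨ χ g = -1)) ∨
      (2 ∣ charDeg χ ∧ (χ x = 2 ∨ χ x = -2))) ∧
    (∀ χ ∈ Irr G, ¬ 2 ∣ charDeg χ → χ x ≠ 0) ∧
    (∀ d c, Nat.card {χ : IrrX G x // (pPart 2 (charDeg χ.1), χ.1 x * χ.1 g) = (d, c)} =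
      if d = 2 ^ Nat.log 2 d then pickyFibre k (Nat.log 2 d) c else 0) := by
  classical
  obtain ⟨Ψ, hdeg, h0, h1, hc0, hhalf, hc1, hcx, hodd⟩ := h
  refine ⟨?_, ?_, ?_⟩
  · rintro χ ⟨hχ, hx⟩
    obtain ⟨a, ha⟩ := hcx χ hχ hx
    rcases a with _ | a
    · left
      refine ⟨?_, h0 χ ha⟩
      rw [← pPart_eq_one_iff (charDeg_ne_zero hχ), (hdeg 0 χ ha).2, pow_zero]
    · right
      refine ⟨?_, (h1 a χ ha).1⟩
      by_contra hcon
      rw [← pPart_eq_one_iff (charDeg_ne_zero hχ), (hdeg _ χ ha).2] at hcon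
      simp at hcon
  · intro χ hχ hd
    rcases (h0 χ (hodd χ hχ hd)).1 with h | h <;> rw [h] <;> norm_num
  · have hne : ∀ a, ∀ ψ ∈ Ψ a, ψ x ≠ 0 := by
      intro a ψ hψ
      rcases a with _ | a
      · rcases (h0 ψ hψ).1 with h | h <;> rw [h] <;> norm_num
      · rcases (h1 a ψ hψ).1 with h | h <;> rw [h] <;> norm_num
    intro d c
    split_ifs with hd
    · set a := Nat.log 2 d
      have e : Nat.card {χ : IrrX G x // (pPart 2 (charDeg χ.1), χ.1 x * χ.1 g) = (d, c)}
          = ((Ψ a).filter (fun ψ => ψ x * ψ g = c)).card := by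
        rw [← Nat.card_eq_finsetCard]
        refine Nat.card_congr ⟨fun χ => ⟨χ.1.1, ?_⟩, fun ψ => ⟨⟨ψ.1, ?_, ?_⟩, ?_⟩, ?_, ?_⟩
        · obtain ⟨⟨χ, hχ, hx⟩, hdc⟩ := χ
          rw [Prod.mk.injEq] at hdc
          obtain ⟨b, hb⟩ := hcx χ hχ hx
          have h2 : 2 ^ b = 2 ^ a := by rw [← hd, ← hdc.1, (hdeg b χ hb).2]
          have : b = a := Nat.pow_right_injective le_rfl h2
          subst this
          exact Finset.mem_filter.2 ⟨hb, hdc.2⟩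
        · exact (hdeg a _ (Finset.mem_filter.1 ψ.2).1).1
        · exact hne a _ (Finset.mem_filter.1 ψ.2).1
        · rw [Prod.mk.injEq]
          exact ⟨(hdeg a _ (Finset.mem_filter.1 ψ.2).1).2.trans hd.symm,
            (Finset.mem_filter.1 ψ.2).2⟩
        · intro _; rfl
        · intro _; rfl
      rw [e]
      rcases ha : a with _ | b
      · simp only [pickyFibre]
        have hhalf' : ((Ψ 0).filter (fun ψ => ψ x = ψ g)).card = 2 ^ (k - 1) := by
          rw [← hhalf, ← Nat.card_eq_finsetCard]
          exact Nat.card_congr (Equiv.subtypeEquivRight (by simp))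
        have hpow : 2 ^ k = 2 * 2 ^ (k - 1) := by
          rw [← pow_succ', Nat.sub_add_cancel hk]
        have hcard := Finset.card_filter_add_card_filter_not (s := Ψ 0) (fun ψ => ψ x = ψ g)
        split_ifs with hc
        · rcases hc with rfl | rfl
          · rw [← hhalf']
            congr 1
            refine Finset.filter_congr fun ψ hψ => ?_
            obtain ⟨hx, hg⟩ := h0 ψ hψ
            rcases hx with hx | hx <;> rcases hg with hg | hg <;> rw [hx, hg] <;> norm_num
          · have : (Ψ 0).filter (fun ψ => ψ x * ψ g = -1)
                = (Ψ 0).filter (fun ψ => ¬ ψ x = ψ g) := by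
              refine Finset.filter_congr fun ψ hψ => ?_
              obtain ⟨hx, hg⟩ := h0 ψ hψ
              rcases hx with hx | hx <;> rcases hg with hg | hg <;> rw [hx, hg] <;> norm_num
            rw [this]
            omega
        · rw [Finset.card_eq_zero, Finset.filter_eq_empty_iff]
          intro ψ hψ hcon
          obtain ⟨hx, hg⟩ := h0 ψ hψ
          apply hc
          rw [← hcon]
          rcases hx with hx | hx <;> rcases hg with hg | hg <;> rw [hx, hg] <;> norm_num
      · simp only [pickyFibre]
        split_ifs with hc
        · rw [← hc1, Finset.filter_true_of_mem]
          intro ψ hψ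
          rw [(h1 b ψ hψ).2, mul_zero, hc]
        · rw [Finset.card_eq_zero, Finset.filter_eq_empty_iff]
          intro ψ hψ hcon
          apply hc
          rw [← hcon, (h1 b ψ hψ).2, mul_zero]
    · rw [Nat.card_eq_zero]
      left
      refine ⟨fun χ => hd ?_⟩
      obtain ⟨⟨χ, hχ, hx⟩, hdc⟩ := χ
      rw [Prod.mk.injEq] at hdc
      obtain ⟨b, hb⟩ := hcx χ hχ hx
      have h2 : d = 2 ^ b := by rw [← hdc.1, (hdeg b χ hb).2]
      rw [h2, Nat.log_pow one_lt_two]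

/-- Two maps with equinumerous finite fibres differ by a bijection of their domains. -/
lemma exists_equiv_of_card_fibre {α β γ : Type*} [Finite α] [Finite β] (f : α → γ) (h : β → γ)
    (hc : ∀ c, Nat.card {a // f a = c} = Nat.card {b // h b = c}) :
    ∃ e : α ≃ β, ∀ a, h (e a) = f a := by
  let e : ∀ c, {a // f a = c} ≃ {b // h b = c} := fun c => (Finite.card_eq.1 (hc c)).some
  refine ⟨(Equiv.sigmaFiberEquiv f).symm.trans
    ((Equiv.sigmaCongrRight e).trans (Equiv.sigmaFiberEquiv h)), fun a => ?_⟩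
  exact (e (f a) ⟨a, rfl⟩).2

lemma exists_equiv_of_pickyTables {G H : Type} [Group G] [Finite G] [Group H] [Finite H]
    {x g : G} {y h : H} {k : ℕ} (hk : 1 ≤ k) (hG : PickyTable G x g k) (hH : PickyTable H y h k) :
    ∃ Γ : ↥(IrrX G x) ≃ ↥(IrrX H y),
      (∀ χ, pPart 2 (charDeg (Γ χ).1) = pPart 2 (charDeg χ.1)) ∧
      (∀ χ, (Γ χ).1 y = χ.1 x ∨ (Γ χ).1 y = - χ.1 x) ∧
      (∀ χ, χ.1 ∈ IrrP' 2 G →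
        ∃ ε : ℂ, (ε = 1 ∨ ε = -1) ∧ (Γ χ).1 y = ε * χ.1 x ∧ (Γ χ).1 h = ε * χ.1 g) := by
  obtain ⟨a1, -, a3⟩ := hG.summary hk
  obtain ⟨b1, -, b3⟩ := hH.summary hk
  have hf : ∀ (K : Type) [Group K] [Finite K] (z : K), Finite (IrrX K z) := by
    intro K _ _ z
    have := Fintype.ofFinite K
    exact ((Irr_finite K).subset fun χ hχ => hχ.1).to_subtype
  have := hf G x
  have := hf H y
  obtain ⟨Γ, hΓ⟩ := exists_equiv_of_card_fibre
    (fun χ : IrrX G x => (pPart 2 (charDeg χ.1), χ.1 x * χ.1 g))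
    (fun χ : IrrX H y => (pPart 2 (charDeg χ.1), χ.1 y * χ.1 h))
    (by rintro ⟨d, c⟩; rw [a3, b3])
  simp only [Prod.mk.injEq] at hΓ
  have hpar : ∀ χ, 2 ∣ charDeg (Γ χ).1 ↔ 2 ∣ charDeg χ.1 := by
    intro χ
    rw [← not_iff_not, ← pPart_eq_one_iff (charDeg_ne_zero (Γ χ).2.1),
      ← pPart_eq_one_iff (charDeg_ne_zero χ.2.1), (hΓ χ).1]
  refine ⟨Γ, fun χ => (hΓ χ).1, fun χ => ?_, fun χ hχ => ?_⟩
  · rcases a1 _ χ.2 with ⟨h1, h2, -⟩ | ⟨h1, h2⟩ <;>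
      rcases b1 _ (Γ χ).2 with ⟨h3, h4, -⟩ | ⟨h3, h4⟩
    · rcases h2 with h2 | h2 <;> rcases h4 with h4 | h4 <;> rw [h2, h4] <;> simp
    · exact absurd ((hpar χ).1 h3) h1
    · exact absurd ((hpar χ).2 h1) h3
    · rcases h2 with h2 | h2 <;> rcases h4 with h4 | h4 <;> rw [h2, h4] <;> simp
  · have hd := (mem_IrrP'_iff.1 hχ).2
    have hp := (hΓ χ).2
    rcases a1 _ χ.2 with ⟨h1, h2, h2'⟩ | ⟨h1, h2⟩
    · rcases b1 _ (Γ χ).2 with ⟨h3, h4, h4'⟩ | ⟨h3, h4⟩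
      · have e1 : χ.1 x * χ.1 x = 1 := by rcases h2 with h2 | h2 <;> rw [h2] <;> norm_num
        have e3 : (Γ χ).1 y * (Γ χ).1 y = 1 := by
          rcases h4 with h | h <;> rw [h] <;> norm_num
        refine ⟨(Γ χ).1 y * χ.1 x, ?_, ?_, ?_⟩
        · rcases h2 with h2 | h2 <;> rcases h4 with h4 | h4 <;> rw [h2, h4] <;> norm_num
        · linear_combination -(Γ χ).1 y * e1
        · linear_combination (Γ χ).1 y * hp - (Γ χ).1 h * e3
      · exact absurd ((hpar χ).1 h3) h1
    · exact absurd h1 hd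

lemma PickyTable.values {G : Type} [Group G] [Finite G] {x g : G} {k : ℕ} (hk : 1 ≤ k)
    (h : PickyTable G x g k) :
    (∀ χ ∈ IrrP' 2 G, χ x = 1 ∨ χ x = -1) ∧
    (∀ χ ∈ IrrX G x, χ ∉ IrrP' 2 G → χ x = 2 ∨ χ x = -2) := by
  obtain ⟨a1, a2, -⟩ := h.summary hk
  refine ⟨fun χ hχ => ?_, fun χ hχ hn => ?_⟩
  · rw [mem_IrrP'_iff] at hχ
    rcases a1 χ ⟨hχ.1, a2 χ hχ.1 hχ.2⟩ with h | h
    · exact h.2.1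
    · exact absurd h.1 hχ.2
  · rw [mem_IrrP'_iff] at hn
    rcases a1 χ hχ with h | h
    · exact absurd ⟨hχ.1, h.1⟩ hn
    · exact h.2

section Content
variable {α ι : Type*} [Fintype α] [DecidableEq α] [Fintype ι] [DecidableEq ι]

/-- The coefficient of a monomial in finitely many variables, indexed by a plain function. -/
def coeffFun (A : ι → ℕ) (p : MvPolynomial ι ℤ) : ℤ :=
  p.coeff (Finsupp.equivFunOnFinite.symm A)

lemma prod_X_pow_eq_monomial (A : ι → ℕ) :
    ∏ i, (MvPolynomial.X i : MvPolynomial ι ℤ) ^ A i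
      = MvPolynomial.monomial (Finsupp.equivFunOnFinite.symm A) 1 := by
  rw [MvPolynomial.monomial_eq, Finsupp.prod_fintype _ _ (by simp)]
  simp

lemma coeffFun_prod_X_pow (A B : ι → ℕ) :
    coeffFun A (∏ i, (MvPolynomial.X i : MvPolynomial ι ℤ) ^ B i) = if B = A then 1 else 0 := by
  rw [coeffFun, prod_X_pow_eq_monomial, MvPolynomial.coeff_monomial]
  simp

lemma coeffFun_sum {κ : Type*} (s : Finset κ) (A : ι → ℕ) (p : κ → MvPolynomial ι ℤ) :
    coeffFun A (∑ i ∈ s, p i) = ∑ i ∈ s, coeffFun A (p i) :=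
  MvPolynomial.coeff_sum _ _ _

lemma coeffFun_intCast_mul (A : ι → ℕ) (c : ℤ) (p : MvPolynomial ι ℤ) :
    coeffFun A (c * p) = c * coeffFun A p := by
  rw [coeffFun, coeffFun, ← MvPolynomial.coeff_C_mul]; rfl

/-- Multiplicities of the values of a function. -/
def content (f : α → ι) : ι → ℕ := fun i => Fintype.card {a // f a = i}

lemma prod_comp_eq_prod_pow_content {M : Type*} [CommMonoid M] (f : α → ι) (x : ι → M) :
    ∏ a, x (f a) = ∏ i, x i ^ content f i := by
  rw [← Finset.prod_fiberwise Finset.univ f]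
  refine Finset.prod_congr rfl fun i _ => ?_
  rw [Finset.prod_congr rfl (g := fun _ => x i) (by simp +contextual), Finset.prod_const, content,
    Fintype.card_subtype]

lemma sum_content (f : α → ι) : ∑ i, content f i = Fintype.card α := by
  unfold content
  rw [← Fintype.card_sigma, Fintype.card_congr (Equiv.sigmaFiberEquiv f)]

lemma card_content_mul_prod_factorial {A : ι → ℕ} (hA : ∑ i, A i = Fintype.card α) :
    (∏ i, (A i).factorial) * (Finset.univ.filter fun f : α → ι => content f = A).card
      = (Fintype.card α).factorial := by
  have h1 : (∑ i, (MvPolynomial.X i : MvPolynomial ι ℤ)) ^ Fintype.card α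
      = ∑ f : α → ι, ∏ i, MvPolynomial.X i ^ content f i := by
    rw [← Finset.card_univ, ← Finset.prod_const, Finset.prod_univ_sum, Fintype.piFinset_univ]
    exact Finset.sum_congr rfl fun f _ => prod_comp_eq_prod_pow_content f _
  rw [Finset.sum_pow_eq_sum_piAntidiag] at h1
  have h2 := congrArg (coeffFun A) h1
  rw [coeffFun_sum, coeffFun_sum, Finset.sum_eq_single A] at h2
  · have h3 := coeffFun_intCast_mul A (Nat.multinomial Finset.univ A)
      (∏ i, (MvPolynomial.X i : MvPolynomial ι ℤ) ^ A i)
    push_cast at h3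
    rw [h3] at h2
    simp only [coeffFun_prod_X_pow] at h2
    rw [Finset.sum_boole] at h2
    simp only [if_true, mul_one] at h2
    have h4 : (Finset.univ.filter fun f : α → ι => content f = A).card
        = Nat.multinomial Finset.univ A := by exact_mod_cast h2.symm
    rw [h4, Nat.multinomial_spec, hA]
  · intro B _ hB
    have h3 := coeffFun_intCast_mul A (Nat.multinomial Finset.univ B)
      (∏ i, (MvPolynomial.X i : MvPolynomial ι ℤ) ^ B i)
    push_cast at h3
    rw [h3, coeffFun_prod_X_pow, if_neg hB, mul_zero]
  · intro h
    exact absurd (by simp [Finset.mem_piAntidiag, hA]) h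

lemma card_stabilizer_eq (f : α → ι) :
    (Finset.univ.filter fun σ : Equiv.Perm α => f ∘ σ = f).card
      = ∏ i, (content f i).factorial := by
  unfold content
  rw [← DomMulAct.stabilizer_card f, Fintype.card_subtype]

/-- Burnside counting for colourings weighted by their content. -/
lemma sum_perm_sum_invariant {R : Type*} [CommSemiring R] (w : (ι → ℕ) → R) :
    ∑ σ : Equiv.Perm α, ∑ f : α → ι with f ∘ σ = f, w (content f)
      = (Fintype.card α).factorial * ∑ A ∈ Finset.piAntidiag Finset.univ (Fintype.card α), w A := by
  simp_rw [Finset.sum_filter]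
  rw [Finset.sum_comm]
  simp_rw [← Finset.sum_filter, Finset.sum_const, card_stabilizer_eq]
  rw [Finset.mul_sum, ← Finset.sum_fiberwise_of_maps_to (s := Finset.univ) (g := content)
    (t := Finset.piAntidiag Finset.univ (Fintype.card α))]
  · refine Finset.sum_congr rfl fun A hA => ?_
    rw [Finset.sum_congr rfl (g := fun _ => (∏ i, (A i).factorial) • w A), Finset.sum_const,
      smul_smul, mul_comm, card_content_mul_prod_factorial (by simpa using hA), nsmul_eq_mul]
    intro f hf
    rw [(Finset.mem_filter.1 hf).2]
  · intro f _
    simp [sum_content]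

end Content

section Perm
variable {α : Type*} [Fintype α] [DecidableEq α] {N : ℕ}

/-- The cycle index of a permutation as a symmetric polynomial: the generating function, by
content, of the invariant colourings. -/
def permPoly (N : ℕ) (σ : Equiv.Perm α) : MvPolynomial (Fin N) ℤ :=
  ∑ f : α → Fin N with f ∘ σ = f, ∏ a, MvPolynomial.X (f a)

/-- The permutation character on colourings with given content. -/
def colourCount (μ : Fin N → ℕ) (σ : Equiv.Perm α) : ℕ :=
  (Finset.univ.filter fun f : α → Fin N => f ∘ σ = f ∧ content f = μ).card

lemma permPoly_eq_sum_content (σ : Equiv.Perm α) :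
    permPoly N σ = ∑ f : α → Fin N with f ∘ σ = f, ∏ i, MvPolynomial.X i ^ content f i :=
  Finset.sum_congr rfl fun f _ => prod_comp_eq_prod_pow_content f _

lemma coeffFun_permPoly (μ : Fin N → ℕ) (σ : Equiv.Perm α) :
    coeffFun μ (permPoly N σ) = colourCount μ σ := by
  rw [permPoly_eq_sum_content, coeffFun_sum]
  simp_rw [coeffFun_prod_X_pow]
  rw [Finset.sum_boole, Finset.filter_filter]
  rfl

/-- The complete homogeneous symmetric polynomial. -/
def homPoly (N m : ℕ) : MvPolynomial (Fin N) ℤ :=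
  ∑ B ∈ Finset.piAntidiag Finset.univ m, ∏ j, MvPolynomial.X j ^ B j

lemma sum_colourCount_mul_permPoly {μ : Fin N → ℕ} (hμ : ∑ i, μ i = Fintype.card α) :
    ∑ σ : Equiv.Perm α, (colourCount μ σ : MvPolynomial (Fin N) ℤ) * permPoly N σ
      = (Fintype.card α).factorial * ∏ i, homPoly N (μ i) := by
  classical
  let w : (Fin N × Fin N → ℕ) → MvPolynomial (Fin N) ℤ := fun A =>
    if (fun i => ∑ j, A (i, j)) = μ then ∏ j, MvPolynomial.X j ^ ∑ i, A (i, j) else 0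
  have hfst : ∀ f : α → Fin N × Fin N, (fun i => ∑ j, content f (i, j))
      = content (fun a => (f a).1) := by
    intro f
    ext i
    unfold content
    rw [← Fintype.card_sigma]
    refine Fintype.card_congr ⟨fun x => ⟨x.2.1, by simp [x.2.2]⟩,
      fun x => ⟨(f x.1).2, x.1, Prod.ext x.2 rfl⟩, ?_, ?_⟩
    · rintro ⟨j, a, ha⟩
      have : j = (f a).2 := by rw [ha]
      subst this
      rfl
    · rintro ⟨a, rfl⟩; rfl
  have hsnd : ∀ (f : α → Fin N × Fin N) j, ∑ i, content f (i, j)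
      = content (fun a => (f a).2) j := by
    intro f j
    unfold content
    rw [← Fintype.card_sigma]
    refine Fintype.card_congr ⟨fun x => ⟨x.2.1, by simp [x.2.2]⟩,
      fun x => ⟨(f x.1).1, x.1, Prod.ext rfl x.2⟩, ?_, ?_⟩
    · rintro ⟨j, a, ha⟩
      have : j = (f a).1 := by rw [ha]
      subst this
      rfl
    · rintro ⟨a, rfl⟩; rfl
  have key := sum_perm_sum_invariant (α := α) w
  rw [show ∑ A ∈ Finset.piAntidiag Finset.univ (Fintype.card α), w A
      = ∏ i, homPoly N (μ i) from ?_] at key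
  · rw [← key]
    refine Finset.sum_congr rfl fun σ _ => ?_
    have e1 : (colourCount μ σ : MvPolynomial (Fin N) ℤ)
        = ∑ f : α → Fin N with f ∘ σ = f, if content f = μ then 1 else 0 := by
      rw [Finset.sum_boole, Finset.filter_filter]
      rfl
    rw [e1, permPoly_eq_sum_content, Finset.sum_mul_sum, ← Finset.sum_product']
    refine Finset.sum_bij' (fun p _ a => (p.1 a, p.2 a))
      (fun f _ => (fun a => (f a).1, fun a => (f a).2)) ?_ ?_ ?_ ?_ ?_
    · rintro ⟨f1, f2⟩ h
      simp only [Finset.mem_product, Finset.mem_filter, Finset.mem_univ, true_and] at h ⊢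
      ext a : 1
      exact Prod.ext (congrFun h.1 a) (congrFun h.2 a)
    · intro f h
      simp only [Finset.mem_product, Finset.mem_filter, Finset.mem_univ, true_and] at h ⊢
      exact ⟨funext fun a => congrArg Prod.fst (congrFun h a),
        funext fun a => congrArg Prod.snd (congrFun h a)⟩
    · intros; rfl
    · intros; rfl
    · rintro ⟨f1, f2⟩ h
      simp only [w, hfst, hsnd]
      split_ifs <;> simp
  · unfold homPoly
    rw [Finset.prod_univ_sum]
    simp only [w]
    rw [← Finset.sum_filter]
    refine Finset.sum_bij' (fun A _ i j => A (i, j)) (fun p _ x => p x.1 x.2) ?_ ?_ ?_ ?_ ?_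
    · intro A hA
      simp only [Finset.mem_filter, Finset.mem_piAntidiag] at hA
      simp only [Fintype.mem_piFinset, Finset.mem_piAntidiag, Finset.mem_univ, implies_true,
        and_true]
      exact fun i => congrFun hA.2 i
    · intro p hp
      simp only [Fintype.mem_piFinset, Finset.mem_piAntidiag, Finset.mem_univ, implies_true,
        and_true] at hp
      simp only [Finset.mem_filter, Finset.mem_piAntidiag, Finset.mem_univ, implies_true,
        and_true]
      exact ⟨by rw [Fintype.sum_prod_type]; simp [hp, hμ], funext hp⟩
    · intros; rfl
    · intros; rfl
    · intro A hA
      rw [Finset.prod_comm]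
      refine Finset.prod_congr rfl fun j _ => ?_
      rw [Finset.prod_pow_eq_pow_sum]

end Perm

section Alternant
variable {N : ℕ}

lemma homPoly_zero : homPoly N 0 = 1 := by
  unfold homPoly
  rw [Finset.sum_eq_single 0]
  · simp
  · intro B hB hne
    refine absurd ?_ hne
    simp only [Finset.mem_piAntidiag, Finset.mem_univ, implies_true, and_true,
      Finset.sum_eq_zero_iff, true_imp_iff] at hB
    exact funext hB
  · intro h
    exact absurd (by simp) h

lemma coeff_prod_geometric (m : ℕ) :
    PowerSeries.coeff m (∏ l : Fin N, PowerSeries.mk fun d =>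
      (MvPolynomial.X l : MvPolynomial (Fin N) ℤ) ^ d) = homPoly N m := by
  classical
  rw [PowerSeries.coeff_prod, homPoly]
  refine Finset.sum_bij' (fun l _ => (l : Fin N → ℕ))
    (fun B _ => Finsupp.equivFunOnFinite.symm B) ?_ ?_ ?_ ?_ ?_
  · intro l hl
    simpa [Finset.mem_finsuppAntidiag] using hl
  · intro B hB
    simpa [Finset.mem_finsuppAntidiag] using hB
  · intro l _
    ext; rfl
  · intro B _
    rfl
  · intro l _
    simp

lemma geometric_mul_one_sub {R : Type*} [CommRing R] (x : R) :
    (PowerSeries.mk fun d => x ^ d) * (1 - PowerSeries.C x * PowerSeries.X) = 1 := by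
  ext n
  rw [mul_sub, mul_one, ← mul_assoc, mul_comm _ (PowerSeries.C x), mul_assoc, map_sub,
    PowerSeries.coeff_C_mul]
  rcases n with _ | n
  · simp
  · rw [PowerSeries.coeff_succ_mul_X, PowerSeries.coeff_mk, PowerSeries.coeff_mk,
      PowerSeries.coeff_one, if_neg (by omega), pow_succ']
    ring

/-- The coefficients of `∏_{l ≠ i} (1 - x_l t)`. -/
def omitPoly (i : Fin N) : Polynomial (MvPolynomial (Fin N) ℤ) :=
  ∏ l ∈ Finset.univ.erase i, (1 - Polynomial.C (MvPolynomial.X l) * Polynomial.X)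

lemma natDegree_omitPoly_lt (i : Fin N) : (omitPoly i).natDegree < N := by
  refine lt_of_le_of_lt (Polynomial.natDegree_prod_le _ _) ?_
  refine lt_of_le_of_lt (Finset.sum_le_card_nsmul _ _ 1 fun l _ => ?_) ?_
  · refine (Polynomial.natDegree_sub_le _ _).trans ?_
    simp only [Polynomial.natDegree_one, Nat.zero_le, sup_of_le_right]
    exact Polynomial.natDegree_C_mul_le _ _ |>.trans Polynomial.natDegree_X_le
  · rw [Finset.card_erase_of_mem (Finset.mem_univ _), Finset.card_univ, Fintype.card_fin]
    have := i.2
    simp only [smul_eq_mul, mul_one]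
    omega

lemma prod_geometric_mul_omitPoly (i : Fin N) :
    (∏ l : Fin N, PowerSeries.mk fun d => (MvPolynomial.X l : MvPolynomial (Fin N) ℤ) ^ d)
      * (omitPoly i : PowerSeries (MvPolynomial (Fin N) ℤ))
      = PowerSeries.mk fun d => (MvPolynomial.X i) ^ d := by
  have e : (omitPoly i : PowerSeries (MvPolynomial (Fin N) ℤ))
      = ∏ l ∈ Finset.univ.erase i, (1 - PowerSeries.C (MvPolynomial.X l) * PowerSeries.X) := by
    rw [omitPoly, ← Polynomial.coeToPowerSeries.ringHom_apply, map_prod]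
    simp
  rw [e, ← Finset.mul_prod_erase _ _ (Finset.mem_univ i), mul_assoc, ← Finset.prod_mul_distrib,
    Finset.prod_congr rfl fun l _ => geometric_mul_one_sub (MvPolynomial.X l)]
  simp

/-- The matrix of the Jacobi-Trudi identity. -/
def homMatrix (β : Fin N → ℕ) : Matrix (Fin N) (Fin N) (MvPolynomial (Fin N) ℤ) :=
  Matrix.of fun j l => if (j : ℕ) ≤ β l then homPoly N (β l - j) else 0

/-- The alternant with exponents `β`. -/
def alternant (β : Fin N → ℕ) : MvPolynomial (Fin N) ℤ :=
  (Matrix.of fun i l => (MvPolynomial.X i : MvPolynomial (Fin N) ℤ) ^ β l).det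

lemma X_pow_eq_sum (i : Fin N) (b : ℕ) :
    (MvPolynomial.X i : MvPolynomial (Fin N) ℤ) ^ b
      = ∑ j : Fin N, (omitPoly i).coeff j * if (j : ℕ) ≤ b then homPoly N (b - j) else 0 := by
  have h := congrArg (PowerSeries.coeff b) (prod_geometric_mul_omitPoly i)
  rw [PowerSeries.coeff_mk, mul_comm, PowerSeries.coeff_mul,
    Finset.Nat.sum_antidiagonal_eq_sum_range_succ_mk] at h
  simp only [coeff_prod_geometric, Polynomial.coeff_coe] at h
  rw [← h, Fin.sum_univ_eq_sum_range
    (fun j => (omitPoly i).coeff j * if j ≤ b then homPoly N (b - j) else 0)]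
  simp only [mul_ite, mul_zero]
  have e1 : ∀ M, b < M → N ≤ M → ∑ j ∈ Finset.range b.succ, (omitPoly i).coeff j * homPoly N (b - j)
      = ∑ j ∈ Finset.range M, if j ≤ b then (omitPoly i).coeff j * homPoly N (b - j) else 0 := by
    intro M hM _
    rw [← Finset.sum_filter]
    refine Finset.sum_congr ?_ fun _ _ => rfl
    ext j
    simp only [Finset.mem_range, Finset.mem_filter]
    omega
  rw [e1 (max N (b + 1)) (by omega) (by omega)]
  symm
  refine Finset.sum_subset (by simp) fun j _ hj => ?_
  rw [Finset.mem_range, not_lt] at hj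
  rw [Polynomial.coeff_eq_zero_of_natDegree_lt ((natDegree_omitPoly_lt i).trans_le hj)]
  simp

lemma alternant_eq_mul_det (β : Fin N → ℕ) :
    alternant β = alternant (fun i : Fin N => (i : ℕ)) * (homMatrix β).det := by
  let E : Matrix (Fin N) (Fin N) (MvPolynomial (Fin N) ℤ) :=
    Matrix.of fun i j => (omitPoly i).coeff j
  have key : ∀ γ : Fin N → ℕ, alternant γ = E.det * (homMatrix γ).det := by
    intro γ
    rw [← Matrix.det_mul, alternant]
    congr 1
    ext1 i l
    rw [Matrix.of_apply, X_pow_eq_sum, Matrix.mul_apply]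
    rfl
  have h1 : (homMatrix (fun i : Fin N => (i : ℕ))).det = 1 := by
    rw [Matrix.det_of_isUpperTriangular]
    · simp [homMatrix, homPoly_zero]
    · intro i j hij
      have : ¬ (i : ℕ) ≤ j := by simpa using hij
      simp only [homMatrix, Matrix.of_apply, if_neg this]
  rw [key β, key (fun i : Fin N => (i : ℕ)), h1, mul_one]

lemma alternant_eq_sum (β : Fin N → ℕ) :
    alternant β = ∑ w : Equiv.Perm (Fin N), ((Equiv.Perm.sign w : ℤ) : MvPolynomial (Fin N) ℤ)
      * ∏ i, MvPolynomial.X i ^ β (w i) := by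
  rw [alternant, ← Matrix.det_transpose, Matrix.det_apply']
  rfl

lemma coeffFun_alternant (β γ : Fin N → ℕ) :
    coeffFun γ (alternant β)
      = ∑ w : Equiv.Perm (Fin N), if β ∘ w = γ then (Equiv.Perm.sign w : ℤ) else 0 := by
  rw [alternant_eq_sum, coeffFun_sum]
  refine Finset.sum_congr rfl fun w _ => ?_
  rw [coeffFun_intCast_mul, coeffFun_prod_X_pow (A := γ) (B := fun i => β (w i))]
  simp only [mul_ite, mul_one, mul_zero]
  rfl

lemma coeffFun_prod_X_pow_mul (A β : Fin N → ℕ) (Q : MvPolynomial (Fin N) ℤ) :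
    coeffFun β ((∏ i, MvPolynomial.X i ^ A i) * Q)
      = if ∀ i, A i ≤ β i then coeffFun (β - A) Q else 0 := by
  rw [prod_X_pow_eq_monomial, coeffFun, MvPolynomial.coeff_monomial_mul']
  have e : Finsupp.equivFunOnFinite.symm A ≤ Finsupp.equivFunOnFinite.symm β ↔ A ≤ β := Iff.rfl
  simp only [e, one_mul, Pi.le_def]
  split_ifs
  · rw [coeffFun]
    congr 1
    ext i
    rfl
  · rfl

/-- The coefficient of the monomial with exponents `β` in the product of the Vandermonde
determinant with `Q`; for `Q` a product of power sums this is a character value. -/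
def frobChar (β : Fin N → ℕ) (Q : MvPolynomial (Fin N) ℤ) : ℤ :=
  coeffFun β (alternant (fun i : Fin N => (i : ℕ)) * Q)

lemma frobChar_eq_sum (β : Fin N → ℕ) (Q : MvPolynomial (Fin N) ℤ) :
    frobChar β Q = ∑ w : Equiv.Perm (Fin N), (Equiv.Perm.sign w : ℤ) *
      if ∀ i, (w i : ℕ) ≤ β i then coeffFun (β - fun i => (w i : ℕ)) Q else 0 := by
  rw [frobChar, alternant_eq_sum, Finset.sum_mul, coeffFun_sum]
  refine Finset.sum_congr rfl fun w _ => ?_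
  rw [mul_assoc, coeffFun_intCast_mul, coeffFun_prod_X_pow_mul (fun i => (w i : ℕ))]

section
variable {α : Type*} [Fintype α] [DecidableEq α]

lemma sum_frobChar_mul_frobChar {β : Fin N → ℕ}
    (hβ : ∑ i, β i = Fintype.card α + ∑ i : Fin N, (i : ℕ)) (γ : Fin N → ℕ) :
    ∑ σ : Equiv.Perm α, frobChar β (permPoly N σ) * frobChar γ (permPoly N σ)
      = (Fintype.card α).factorial *
        ∑ w : Equiv.Perm (Fin N), if β ∘ w = γ then (Equiv.Perm.sign w : ℤ) else 0 := by
  rw [← coeffFun_alternant, alternant_eq_mul_det, Matrix.det_apply']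
  have e1 : ∀ σ : Equiv.Perm α, frobChar β (permPoly N σ) * frobChar γ (permPoly N σ)
      = ∑ w : Equiv.Perm (Fin N), (Equiv.Perm.sign w : ℤ) *
        if ∀ i, (w i : ℕ) ≤ β i then
          frobChar γ (colourCount (β - fun i => (w i : ℕ)) σ * permPoly N σ) else 0 := by
    intro σ
    rw [frobChar_eq_sum β, Finset.sum_mul]
    refine Finset.sum_congr rfl fun w _ => ?_
    rw [mul_assoc, coeffFun_permPoly, ite_mul, zero_mul]
    congr 2
    rw [frobChar, frobChar, mul_left_comm]
    exact (coeffFun_intCast_mul _ (colourCount (β - fun i => (w i : ℕ)) σ) _).symm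
  simp_rw [e1]
  rw [Finset.sum_comm, Finset.mul_sum, coeffFun_sum, Finset.mul_sum]
  refine Finset.sum_congr rfl fun w _ => ?_
  rw [← Finset.mul_sum, mul_left_comm, coeffFun_intCast_mul, mul_left_comm]
  congr 1
  split_ifs with hw
  · have hsum : ∑ i, (β - fun i => (w i : ℕ)) i = Fintype.card α := by
      have h1 : ∑ i, (β - fun i => (w i : ℕ)) i + ∑ i, (w i : ℕ) = ∑ i, β i := by
        rw [← Finset.sum_add_distrib]
        exact Finset.sum_congr rfl fun i _ => Nat.sub_add_cancel (hw i)
      rw [Equiv.sum_comp w (fun i => (i : ℕ)), hβ] at h1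
      omega
    have h2 := sum_colourCount_mul_permPoly (α := α) hsum
    have h3 := coeffFun_intCast_mul γ (Fintype.card α).factorial
      (alternant (fun i : Fin N => (i : ℕ)) * ∏ i, homPoly N ((β - fun i => (w i : ℕ)) i))
    push_cast at h3
    simp only [homMatrix, Matrix.of_apply, hw, if_true]
    rw [show ∏ i, homPoly N (β i - (w i : ℕ))
      = ∏ i, homPoly N ((β - fun i => (w i : ℕ)) i) from rfl, ← h3, mul_left_comm, ← h2,
      Finset.mul_sum, coeffFun_sum]
    rfl
  · push Not at hw
    obtain ⟨i, hi⟩ := hw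
    rw [Finset.sum_const_zero, Finset.prod_eq_zero (Finset.mem_univ i)]
    · simp [coeffFun]
    · simp only [homMatrix, Matrix.of_apply]
      rw [if_neg (by omega)]

end
end Alternant

/-- The number of fixed points of a finite group acting on a finite set pairs integrally with
irreducible characters. -/
lemma charInner_card_fixed {G X : Type} [Group G] [Fintype G] [Fintype X] [DecidableEq X]
    (act : G → X → X) (h1 : ∀ x, act 1 x = x) (hmul : ∀ g h x, act (g * h) x = act h (act g x))
    {χ : G → ℂ} (hχ : χ ∈ Irr G) :
    ∃ z : ℤ, charInner (fun g => ((Finset.univ.filter fun x => act g x = x).card : ℂ)) χ = z := by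
  let ρ : Representation ℂ G (X → ℂ) :=
    { toFun := fun g => LinearMap.funLeft ℂ ℂ (act g)
      map_one' := by ext v x; simp [LinearMap.funLeft, h1]
      map_mul' := fun g h => by
        refine LinearMap.ext fun v => funext fun x => ?_
        show v (act (g * h) x) = v (act h (act g x))
        rw [hmul] }
  have hρ : ρ.character = fun g => ((Finset.univ.filter fun x => act g x = x).card : ℂ) := by
    ext g
    show LinearMap.trace ℂ (X → ℂ) (LinearMap.funLeft ℂ ℂ (act g)) = _
    rw [LinearMap.trace_eq_matrix_trace ℂ (Pi.basisFun ℂ X), Matrix.trace]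
    simp only [Matrix.diag_apply, LinearMap.toMatrix_apply, Pi.basisFun_apply, Pi.basisFun_repr,
      LinearMap.funLeft_apply, Pi.single_apply]
    rw [Finset.sum_boole]
  obtain ⟨V, -, rfl⟩ := hχ
  rw [← hρ, FDRep.character_eq_rep, charInner_character]
  exact ⟨_, (Int.cast_natCast _).symm⟩

section
variable {α : Type} [Fintype α] [DecidableEq α] {N : ℕ}

lemma permPoly_conj {α β : Type*} [Fintype α] [DecidableEq α] [Fintype β] [DecidableEq β]
    (e : α ≃ β) (σ : Equiv.Perm α) : permPoly N (e.permCongr σ) = permPoly N σ := by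
  unfold permPoly
  refine Finset.sum_bij' (fun f _ => f ∘ e) (fun f _ => f ∘ e.symm) ?_ ?_ ?_ ?_ ?_
  · intro f hf
    simp only [Finset.mem_filter, Finset.mem_univ, true_and] at hf ⊢
    ext1 a
    have := congrFun hf (e a)
    simpa using this
  · intro f hf
    simp only [Finset.mem_filter, Finset.mem_univ, true_and] at hf ⊢
    ext1 a
    have := congrFun hf (e.symm a)
    simpa using this
  · intro f _; ext a; simp
  · intro f _; ext a; simp
  · intro f _
    exact (Equiv.prod_comp e (fun b => MvPolynomial.X (f b))).symm

lemma permPoly_mul_inv (σ τ : Equiv.Perm α) : permPoly N (τ * σ * τ⁻¹) = permPoly N σ :=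
  permPoly_conj τ σ

lemma permPoly_inv (σ : Equiv.Perm α) : permPoly N σ⁻¹ = permPoly N σ := by
  unfold permPoly
  refine Finset.sum_congr (Finset.filter_congr fun f _ => ?_) fun _ _ => rfl
  constructor
  · intro h
    conv_lhs => rw [← h]
    ext a; simp
  · intro h
    conv_lhs => rw [← h]
    ext a; simp

/-- The virtual character of the symmetric group attached to a vector of exponents. -/
def frobClass (α : Type) [Fintype α] [DecidableEq α] (β : Fin N → ℕ) (σ : Equiv.Perm α) : ℂ :=
  frobChar β (permPoly N σ)

lemma isClassFun_frobClass (β : Fin N → ℕ) : IsClassFun (frobClass α β) := by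
  intro g h
  simp only [frobClass, permPoly_mul_inv]

lemma charInner_colourCount (μ : Fin N → ℕ) {χ : Equiv.Perm α → ℂ} (hχ : χ ∈ Irr (Equiv.Perm α)) :
    ∃ z : ℤ, charInner (fun σ => (colourCount μ σ : ℂ)) χ = z := by
  have hc : ∀ (f : α → Fin N) (σ : Equiv.Perm α), content (f ∘ σ) = content f := by
    intro f σ
    ext i
    exact Fintype.card_congr (σ.subtypeEquiv fun a => Iff.rfl)
  obtain ⟨z, hz⟩ := charInner_card_fixed
    (X := {f : α → Fin N // content f = μ})
    (fun (σ : Equiv.Perm α) f => ⟨f.1 ∘ σ, (hc _ _).trans f.2⟩)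
    (fun f => rfl) (fun σ τ f => rfl) hχ
  refine ⟨z, ?_⟩
  rw [← hz]
  congr 1
  ext σ
  congr 1
  unfold colourCount
  refine Finset.card_bij' (fun f hf => ⟨f, (Finset.mem_filter.1 hf).2.2⟩) (fun f _ => f.1)
    ?_ ?_ ?_ ?_
  · intro f hf
    simp only [Finset.mem_filter, Finset.mem_univ, true_and, Subtype.mk.injEq] at hf ⊢
    exact hf.1
  · rintro ⟨f, hf'⟩ hf
    simp only [Finset.mem_filter, Finset.mem_univ, true_and, Subtype.mk.injEq] at hf ⊢
    exact ⟨hf, hf'⟩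
  · intros; rfl
  · intros; rfl

lemma charInner_frobClass_Irr (β : Fin N → ℕ) {χ : Equiv.Perm α → ℂ}
    (hχ : χ ∈ Irr (Equiv.Perm α)) : ∃ z : ℤ, charInner (frobClass α β) χ = z := by
  have e : frobClass α β = ∑ w : Equiv.Perm (Fin N), ((Equiv.Perm.sign w : ℤ) *
      if ∀ i, (w i : ℕ) ≤ β i then 1 else 0 : ℂ) •
      fun σ : Equiv.Perm α => (colourCount (β - fun i => (w i : ℕ)) σ : ℂ) := by
    ext σ
    rw [frobClass, frobChar_eq_sum, Finset.sum_apply]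
    push_cast
    refine Finset.sum_congr rfl fun w _ => ?_
    rw [Pi.smul_apply, smul_eq_mul, mul_assoc, coeffFun_permPoly]
    split_ifs <;> simp
  choose z hz using fun μ : Fin N → ℕ => charInner_colourCount μ hχ
  refine ⟨∑ w : Equiv.Perm (Fin N), ((Equiv.Perm.sign w : ℤ) *
      if ∀ i, (w i : ℕ) ≤ β i then 1 else 0) * z (β - fun i => (w i : ℕ)), ?_⟩
  rw [e, charInner_sum_left]
  push_cast
  refine Finset.sum_congr rfl fun w _ => ?_
  rw [charInner_smul_left, hz]

lemma charInner_frobClass {β : Fin N → ℕ}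
    (hβ : ∑ i, β i = Fintype.card α + ∑ i : Fin N, (i : ℕ)) (γ : Fin N → ℕ) :
    charInner (frobClass α β) (frobClass α γ)
      = ∑ w : Equiv.Perm (Fin N), if β ∘ w = γ then ((Equiv.Perm.sign w : ℤ) : ℂ) else 0 := by
  have h := sum_frobChar_mul_frobChar (α := α) hβ γ
  have h' := congrArg (fun z : ℤ => (z : ℂ)) h
  push_cast at h'
  unfold charInner frobClass
  simp only [permPoly_inv]
  rw [h', Nat.card_eq_fintype_card, Fintype.card_perm, inv_mul_cancel_left₀]
  exact_mod_cast Nat.factorial_ne_zero _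

/-- The irreducible character of the symmetric group attached to a vector of exponents. -/
def specht (α : Type) [Fintype α] [DecidableEq α] (β : Fin N → ℕ) : Equiv.Perm α → ℂ := by
  classical
  exact if frobClass α β ∈ Irr (Equiv.Perm α) then frobClass α β else -frobClass α β

lemma specht_eq_or (β : Fin N → ℕ) :
    specht α β = frobClass α β ∨ specht α β = -frobClass α β := by
  unfold specht
  split_ifs <;> simp

lemma specht_mem_Irr {β : Fin N → ℕ} (hinj : Function.Injective β)
    (hβ : ∑ i, β i = Fintype.card α + ∑ i : Fin N, (i : ℕ)) :
    specht α β ∈ Irr (Equiv.Perm α) := by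
  have h1 : charInner (frobClass α β) (frobClass α β) = 1 := by
    rw [charInner_frobClass hβ, Finset.sum_eq_single 1]
    · simp
    · intro w _ hw
      rw [if_neg]
      intro h
      exact hw (Equiv.ext fun i => hinj (congrFun h i))
    · simp
  have := Irr_or_neg_of_norm_one (isClassFun_frobClass β)
    (fun χ hχ => charInner_frobClass_Irr β hχ) h1
  unfold specht
  split_ifs with h
  · exact h
  · exact this.resolve_left h

lemma exists_comp_eq_of_specht_eq {β γ : Fin N → ℕ} (hinj : Function.Injective β)
    (hβ : ∑ i, β i = Fintype.card α + ∑ i : Fin N, (i : ℕ))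
    (h : specht α β = specht α γ) : ∃ w : Equiv.Perm (Fin N), β ∘ w = γ := by
  by_contra! hcon
  have h0 : charInner (frobClass α β) (frobClass α γ) = 0 := by
    rw [charInner_frobClass hβ]
    exact Finset.sum_eq_zero fun w _ => if_neg (hcon w)
  have hn : ∀ f g : Equiv.Perm α → ℂ, charInner (-f) g = - charInner f g := by
    intro f g
    simp [charInner]
  have hn' : ∀ f g : Equiv.Perm α → ℂ, charInner f (-g) = - charInner f g := by
    intro f g
    rw [charInner_comm, hn, charInner_comm]
  have h1 : charInner (specht α β) (specht α γ) = 0 := by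
    rcases specht_eq_or (α := α) β with e | e <;> rcases specht_eq_or (α := α) γ with e' | e' <;>
      simp [e, e', hn, hn', h0]
  rw [← h, charInner_Irr_self (specht_mem_Irr hinj hβ)] at h1
  exact one_ne_zero h1

end

section
variable {N : ℕ}

lemma frobChar_add (β : Fin N → ℕ) (P Q : MvPolynomial (Fin N) ℤ) :
    frobChar β (P + Q) = frobChar β P + frobChar β Q := by
  simp [frobChar, coeffFun, mul_add]

lemma frobChar_intCast_mul (β : Fin N → ℕ) (c : ℤ) (Q : MvPolynomial (Fin N) ℤ) :
    frobChar β (c * Q) = c * frobChar β Q := by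
  rw [frobChar, mul_left_comm, coeffFun_intCast_mul]
  rfl

/-- The Murnaghan-Nakayama rule on vectors of exponents. -/
lemma frobChar_psum_mul (β : Fin N → ℕ) (m : ℕ) (Q : MvPolynomial (Fin N) ℤ) :
    frobChar β (MvPolynomial.psum (Fin N) ℤ m * Q)
      = ∑ i, if m ≤ β i then frobChar (Function.update β i (β i - m)) Q else 0 := by
  rw [frobChar, mul_left_comm, MvPolynomial.psum, Finset.sum_mul, coeffFun_sum]
  refine Finset.sum_congr rfl fun i _ => ?_
  have e : (MvPolynomial.X i : MvPolynomial (Fin N) ℤ) ^ m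
      = ∏ j, MvPolynomial.X j ^ (Pi.single i m : Fin N → ℕ) j := by
    rw [Finset.prod_eq_single i]
    · simp
    · intro j _ hj; simp [hj]
    · simp
  rw [e, coeffFun_prod_X_pow_mul]
  have h1 : (∀ j, (Pi.single i m : Fin N → ℕ) j ≤ β j) ↔ m ≤ β i := by
    constructor
    · intro h; simpa using h i
    · intro h j
      by_cases hj : j = i
      · subst hj; simpa using h
      · simp [hj]
  have h2 : β - (Pi.single i m : Fin N → ℕ) = Function.update β i (β i - m) := by
    ext j
    by_cases hj : j = i
    · subst hj; simp
    · simp [hj]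
  simp only [h1, h2]
  rfl

lemma coeffFun_comp {Q : MvPolynomial (Fin N) ℤ} (hQ : Q.IsSymmetric) (μ : Fin N → ℕ)
    (w : Equiv.Perm (Fin N)) : coeffFun (μ ∘ w) Q = coeffFun μ Q := by
  have h := MvPolynomial.coeff_rename_mapDomain (w : Fin N → Fin N) w.injective Q
    (Finsupp.equivFunOnFinite.symm (μ ∘ w))
  rw [hQ w] at h
  rw [coeffFun, coeffFun, ← h]
  congr 1
  ext i
  rw [← w.apply_symm_apply i, Finsupp.mapDomain_apply w.injective]
  simp

lemma frobChar_comp {Q : MvPolynomial (Fin N) ℤ} (hQ : Q.IsSymmetric) (β : Fin N → ℕ)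
    (w : Equiv.Perm (Fin N)) :
    frobChar (β ∘ w) Q = (Equiv.Perm.sign w : ℤ) * frobChar β Q := by
  rw [frobChar_eq_sum, frobChar_eq_sum, Finset.mul_sum, ← Equiv.sum_comp (Equiv.mulRight w)]
  refine Finset.sum_congr rfl fun u _ => ?_
  have h1 : (∀ i, ((Equiv.mulRight w u) i : ℕ) ≤ (β ∘ w) i) ↔ ∀ i, (u i : ℕ) ≤ β i :=
    ⟨fun h i => by simpa using h (w.symm i), fun h i => h (w i)⟩
  have h2 : (β ∘ w - fun i => ((Equiv.mulRight w u) i : ℕ)) = (β - fun i => (u i : ℕ)) ∘ w := rfl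
  simp only [h1, h2, coeffFun_comp hQ]
  rw [Equiv.coe_mulRight, Equiv.Perm.sign_mul]
  push_cast
  ring

lemma frobChar_eq_zero_of_not_injective {Q : MvPolynomial (Fin N) ℤ} (hQ : Q.IsSymmetric)
    {β : Fin N → ℕ} (h : ¬ Function.Injective β) : frobChar β Q = 0 := by
  simp only [Function.Injective, not_forall] at h
  obtain ⟨i, j, hij, hne⟩ := h
  have e : β ∘ Equiv.swap i j = β := by
    ext l
    simp only [Function.comp_apply, Equiv.swap_apply_def]
    split_ifs with h1 h2
    · rw [h1, hij]
    · rw [h2, hij]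
    · rfl
  have := frobChar_comp hQ β (Equiv.swap i j)
  rw [e, Equiv.Perm.sign_swap hne] at this
  simp at this
  omega

lemma frobChar_val_one : frobChar (fun i : Fin N => (i : ℕ)) 1 = 1 := by
  rw [frobChar, mul_one, coeffFun_alternant, Finset.sum_eq_single 1]
  · simp
  · intro w _ hw
    rw [if_neg]
    intro h
    exact hw (Equiv.ext fun i => Fin.ext (congrFun h i))
  · simp

/-- The difference product of a vector of exponents. -/
def diffProd (β : Fin N → ℕ) : ℤ := ∏ i : Fin N, ∏ j ∈ Finset.Ioi i, ((β j : ℤ) - β i)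

/-- The degree formula of Frobenius. -/
lemma frobChar_psum_one_pow {β : Fin N → ℕ} {n : ℕ} (hβ : ∑ i, β i = n + ∑ i : Fin N, (i : ℕ)) :
    frobChar β (MvPolynomial.psum (Fin N) ℤ 1 ^ n) * ∏ i, ((β i).factorial : ℤ)
      = n.factorial * diffProd β := by
  have e1 : ∀ μ : Fin N → ℕ, ∑ i, μ i = n →
      coeffFun μ (MvPolynomial.psum (Fin N) ℤ 1 ^ n) * ∏ i, ((μ i).factorial : ℤ) =
        n.factorial := by
    intro μ hμ
    have h1 : coeffFun μ (MvPolynomial.psum (Fin N) ℤ 1 ^ n) = Nat.multinomial Finset.univ μ := by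
      rw [MvPolynomial.psum]
      simp only [pow_one]
      rw [Finset.sum_pow_eq_sum_piAntidiag, coeffFun_sum, Finset.sum_eq_single μ]
      · have h3 := coeffFun_intCast_mul μ (Nat.multinomial Finset.univ μ)
          (∏ i, (MvPolynomial.X i : MvPolynomial (Fin N) ℤ) ^ μ i)
        push_cast at h3
        rw [h3, coeffFun_prod_X_pow, if_pos rfl, mul_one]
      · intro B _ hB
        have h3 := coeffFun_intCast_mul μ (Nat.multinomial Finset.univ B)
          (∏ i, (MvPolynomial.X i : MvPolynomial (Fin N) ℤ) ^ B i)
        push_cast at h3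
        rw [h3, coeffFun_prod_X_pow, if_neg hB, mul_zero]
      · intro h
        exact absurd (by simp [Finset.mem_piAntidiag, hμ]) h
    have h2 := Nat.multinomial_spec Finset.univ μ
    rw [hμ] at h2
    rw [h1, ← h2]
    push_cast
    ring
  have e2 : diffProd β = (Matrix.of fun i j : Fin N => ((β i).descFactorial j : ℤ)).det := by
    rw [diffProd, ← Matrix.det_vandermonde (fun i => (β i : ℤ)),
      Matrix.det_eval_matrixOfPolynomials_eq_det_vandermonde (fun i => (β i : ℤ))
        (fun i => descPochhammer ℤ i) (fun i => descPochhammer_natDegree ℤ i)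
        (fun i => monic_descPochhammer ℤ i)]
    simp only [descPochhammer_eval_eq_descFactorial]
  rw [e2, ← Matrix.det_transpose, Matrix.det_apply', frobChar_eq_sum, Finset.sum_mul,
    Finset.mul_sum]
  refine Finset.sum_congr rfl fun w _ => ?_
  suffices h : (if ∀ i, (w i : ℕ) ≤ β i then coeffFun (β - fun i => (w i : ℕ))
      (MvPolynomial.psum (Fin N) ℤ 1 ^ n) else 0) * ∏ i, ((β i).factorial : ℤ)
      = n.factorial * ∏ i, ((β i).descFactorial (w i) : ℤ) by
    simp only [Matrix.transpose_apply, Matrix.of_apply]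
    rw [mul_assoc, h, mul_left_comm]
    rfl
  split_ifs with hw
  · rw [← e1 (β - fun i => (w i : ℕ)), mul_assoc, ← Finset.prod_mul_distrib]
    · congr 1
      refine Finset.prod_congr rfl fun i _ => ?_
      rw [← Nat.factorial_mul_descFactorial (hw i)]
      push_cast
      rfl
    · have h1 : ∑ i, (β - fun i => (w i : ℕ)) i + ∑ i, (w i : ℕ) = ∑ i, β i := by
        rw [← Finset.sum_add_distrib]
        exact Finset.sum_congr rfl fun i _ => Nat.sub_add_cancel (hw i)
      rw [Equiv.sum_comp w (fun i => (i : ℕ)), hβ] at h1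
      omega
  · push Not at hw
    obtain ⟨i, hi⟩ := hw
    rw [zero_mul, Finset.prod_eq_zero (Finset.mem_univ i), mul_zero]
    rw [Nat.descFactorial_of_lt hi]; rfl

lemma exists_sq_sum {R ι : Type*} [CommRing R] (s : Finset ι) (a : ι → R) :
    ∃ r, (∑ i ∈ s, a i) ^ 2 = ∑ i ∈ s, a i ^ 2 + 2 * r := by
  classical
  induction s using Finset.induction_on with
  | empty => exact ⟨0, by simp⟩
  | insert i s hi ih =>
    obtain ⟨r, hr⟩ := ih
    refine ⟨r + a i * ∑ j ∈ s, a j, ?_⟩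
    rw [Finset.sum_insert hi, Finset.sum_insert hi]
    linear_combination hr

lemma exists_psum_one_pow (k : ℕ) :
    ∃ R, MvPolynomial.psum (Fin N) ℤ 1 ^ 2 ^ k = MvPolynomial.psum (Fin N) ℤ (2 ^ k) + 2 * R := by
  induction k with
  | zero => exact ⟨0, by simp⟩
  | succ k ih =>
    obtain ⟨R, hR⟩ := ih
    obtain ⟨S, hS⟩ := exists_sq_sum Finset.univ fun i : Fin N =>
      (MvPolynomial.X i : MvPolynomial (Fin N) ℤ) ^ 2 ^ k
    refine ⟨S + 2 * R * MvPolynomial.psum (Fin N) ℤ (2 ^ k) + 2 * R ^ 2, ?_⟩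
    rw [pow_succ, pow_mul, hR]
    simp only [← pow_mul] at hS
    simp only [MvPolynomial.psum] at hS ⊢
    linear_combination hS

lemma exists_psum_one_pow_succ (k : ℕ) :
    ∃ R, MvPolynomial.psum (Fin N) ℤ 1 ^ 2 ^ (k + 1)
      = MvPolynomial.psum (Fin N) ℤ (2 ^ k) * MvPolynomial.psum (Fin N) ℤ (2 ^ k) + 4 * R := by
  obtain ⟨R, hR⟩ := exists_psum_one_pow (N := N) k
  refine ⟨R * MvPolynomial.psum (Fin N) ℤ (2 ^ k) + R ^ 2, ?_⟩
  rw [pow_succ, pow_mul, hR]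
  ring

section
variable {α β : Type*} [Fintype α] [DecidableEq α] [Fintype β] [DecidableEq β]

lemma permPoly_one :
    permPoly N (1 : Equiv.Perm α) = MvPolynomial.psum (Fin N) ℤ 1 ^ Fintype.card α := by
  rw [← Finset.card_univ, ← Finset.prod_const, MvPolynomial.psum, Finset.prod_univ_sum,
    Fintype.piFinset_univ]
  simp [permPoly]

lemma permPoly_sumCongr (σ : Equiv.Perm α) (τ : Equiv.Perm β) :
    permPoly N (Equiv.sumCongr σ τ) = permPoly N σ * permPoly N τ := by
  unfold permPoly
  rw [Finset.sum_mul_sum, ← Finset.sum_product']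
  refine Finset.sum_bij' (fun f _ => (f ∘ Sum.inl, f ∘ Sum.inr)) (fun p _ => Sum.elim p.1 p.2)
    ?_ ?_ ?_ ?_ ?_
  · intro f hf
    simp only [Finset.mem_product, Finset.mem_filter, Finset.mem_univ, true_and] at hf ⊢
    exact ⟨funext fun a => congrFun hf (Sum.inl a), funext fun a => congrFun hf (Sum.inr a)⟩
  · rintro ⟨f, f'⟩ hf
    simp only [Finset.mem_product, Finset.mem_filter, Finset.mem_univ, true_and] at hf ⊢
    ext1 (a | a)
    · exact congrFun hf.1 a
    · exact congrFun hf.2 a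
  · intro f _
    exact Sum.elim_comp_inl_inr f
  · intros; rfl
  · intro f _
    rw [Fintype.prod_sum_type]
    rfl

lemma apply_eq_of_sameCycle {ι : Type*} {σ : Equiv.Perm α} {f : α → ι} (hf : f ∘ σ = f) {a b : α}
    (h : σ.SameCycle a b) : f b = f a := by
  have hz : ∀ (i : ℤ) a, f ((σ ^ i) a) = f a := by
    intro i
    induction i using Int.induction_on with
    | zero => simp
    | succ i ih =>
      intro a
      rw [zpow_add_one, Equiv.Perm.mul_apply, ih]
      exact congrFun hf a
    | pred i ih =>
      intro a
      rw [zpow_sub_one, Equiv.Perm.mul_apply, ih]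
      have := congrFun hf (σ⁻¹ a)
      simpa using this.symm
  obtain ⟨i, hi⟩ := h
  rw [← hi, hz]

lemma permPoly_of_sameCycle [Nonempty α] {σ : Equiv.Perm α} (h : ∀ a b, σ.SameCycle a b) :
    permPoly N σ = MvPolynomial.psum (Fin N) ℤ (Fintype.card α) := by
  unfold permPoly MvPolynomial.psum
  obtain ⟨a₀⟩ := (inferInstance : Nonempty α)
  refine Finset.sum_bij' (fun f _ => f a₀) (fun i _ _ => i) ?_ ?_ ?_ ?_ ?_
  · simp
  · intro i _
    simp only [Finset.mem_filter, Finset.mem_univ, true_and]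
    rfl
  · intro f hf
    simp only [Finset.mem_filter, Finset.mem_univ, true_and] at hf
    ext1 a
    rw [apply_eq_of_sameCycle hf (h a₀ a)]
  · intros; rfl
  · intro f hf
    simp only [Finset.mem_filter, Finset.mem_univ, true_and] at hf
    rw [Finset.prod_congr rfl (g := fun _ => MvPolynomial.X (f a₀)), Finset.prod_const,
      Finset.card_univ]
    intro a _
    rw [apply_eq_of_sameCycle hf (h a₀ a)]

end
end

lemma sum_range_card_le (s : Finset ℕ) : ∑ i ∈ Finset.range s.card, i ≤ ∑ i ∈ s, i := by
  induction s using Finset.induction_on_max with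
  | empty => simp
  | insert a s ha ih =>
    have hs : a ∉ s := fun h => lt_irrefl _ (ha a h)
    rw [Finset.card_insert_of_notMem hs, Finset.sum_range_succ, Finset.sum_insert hs, add_comm]
    have : s.card ≤ a := by
      simpa using Finset.card_le_card
        (fun x hx => Finset.mem_range.2 (ha x hx) : s ⊆ Finset.range a)
    omega

section
variable {N : ℕ}

/-- The vectors of distinct exponents which exceed `(0, 1, …, N - 1)` by `n` in total. -/
def IsBeta (n : ℕ) (β : Fin N → ℕ) : Prop :=
  Function.Injective β ∧ ∑ i, β i = n + ∑ i : Fin N, (i : ℕ)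

lemma IsBeta.exists_eq {n : ℕ} {β : Fin N → ℕ} (h : IsBeta n β) {r : ℕ} (hr : r + n < N) :
    ∃ i, β i = r := by
  by_contra hc
  have hn : r ∉ Finset.univ.image β := by simpa using hc
  have := sum_range_card_le (insert r (Finset.univ.image β))
  rw [Finset.card_insert_of_notMem hn, Finset.sum_insert hn, Finset.card_image_of_injective _ h.1,
    Finset.card_univ, Fintype.card_fin, Finset.sum_range_succ,
    Finset.sum_image (fun a _ b _ hab => h.1 hab), h.2,
    Fin.sum_univ_eq_sum_range (fun i => i)] at this
  omega

lemma IsBeta.zero_eq {β : Fin N → ℕ} (h : IsBeta 0 β) :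
    ∃ w : Equiv.Perm (Fin N), β = (fun i : Fin N => (i : ℕ)) ∘ w := by
  have h1 : ∀ r : Fin N, ∃ i, β i = r := fun r => h.exists_eq (by simp)
  choose f hf using h1
  have hinj : Function.Injective f := fun a b hab => by
    apply Fin.ext
    rw [← hf, ← hf, hab]
  let e : Equiv.Perm (Fin N) := Equiv.ofBijective f (Finite.injective_iff_bijective.1 hinj)
  refine ⟨e.symm, funext fun i => ?_⟩
  show β i = (e.symm i : ℕ)
  rw [← hf (e.symm i)]
  exact congrArg β (e.apply_symm_apply i).symm

lemma IsBeta.zero_val : IsBeta 0 (fun i : Fin N => (i : ℕ)) := ⟨Fin.val_injective, by simp⟩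

/-- Adding a hook of length `m`. -/
def addHook (β : Fin N → ℕ) (i : Fin N) (m : ℕ) : Fin N → ℕ := Function.update β i (β i + m)

/-- Removing a hook of length `m`. -/
def remHook (β : Fin N → ℕ) (i : Fin N) (m : ℕ) : Fin N → ℕ := Function.update β i (β i - m)

lemma addHook_self (β : Fin N → ℕ) (i : Fin N) (m : ℕ) : addHook β i m i = β i + m := by
  simp [addHook]

lemma addHook_of_ne (β : Fin N → ℕ) {i j : Fin N} (h : j ≠ i) (m : ℕ) : addHook β i m j = β j := by
  simp [addHook, h]

lemma remHook_self (β : Fin N → ℕ) (i : Fin N) (m : ℕ) : remHook β i m i = β i - m := by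
  simp [remHook]

lemma remHook_of_ne (β : Fin N → ℕ) {i j : Fin N} (h : j ≠ i) (m : ℕ) : remHook β i m j = β j := by
  simp [remHook, h]

lemma remHook_addHook (β : Fin N → ℕ) (i : Fin N) (m : ℕ) : remHook (addHook β i m) i m = β := by
  ext j
  by_cases h : j = i
  · subst h; simp [remHook_self, addHook_self]
  · rw [remHook_of_ne _ h, addHook_of_ne _ h]

lemma addHook_remHook {β : Fin N → ℕ} {i : Fin N} {m : ℕ} (h : m ≤ β i) :
    addHook (remHook β i m) i m = β := by
  ext j
  by_cases hj : j = i
  · subst hj; rw [addHook_self, remHook_self]; omega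
  · rw [addHook_of_ne _ hj, remHook_of_ne _ hj]

lemma remHook_comp (β : Fin N → ℕ) (i : Fin N) (m : ℕ) (w : Equiv.Perm (Fin N)) :
    remHook (β ∘ w) i m = remHook β (w i) m ∘ w := by
  ext j
  by_cases hj : j = i
  · subst hj; simp [remHook_self]
  · rw [remHook_of_ne _ hj, Function.comp_apply, Function.comp_apply, remHook_of_ne]
    exact fun h => hj (w.injective h)

lemma addHook_comp (β : Fin N → ℕ) (i : Fin N) (m : ℕ) (w : Equiv.Perm (Fin N)) :
    addHook (β ∘ w) i m = addHook β (w i) m ∘ w := by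
  ext j
  by_cases hj : j = i
  · subst hj; simp [addHook_self]
  · rw [addHook_of_ne _ hj, Function.comp_apply, Function.comp_apply, addHook_of_ne]
    exact fun h => hj (w.injective h)

lemma sum_addHook (β : Fin N → ℕ) (i : Fin N) (m : ℕ) :
    ∑ j, addHook β i m j = (∑ j, β j) + m := by
  rw [addHook, Finset.sum_update_of_mem (Finset.mem_univ i),
    ← Finset.add_sum_erase _ _ (Finset.mem_univ i), Finset.sdiff_singleton_eq_erase]
  ring

lemma injective_addHook_iff {β : Fin N → ℕ} (hβ : Function.Injective β) (i : Fin N) {m : ℕ}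
    (hm : m ≠ 0) :
    Function.Injective (addHook β i m) ↔ ∀ j, β j ≠ β i + m := by
  constructor
  · intro h j hj
    by_cases hji : j = i
    · subst hji; omega
    · exact hji (h (by rw [addHook_self, addHook_of_ne _ hji, hj]))
  · intro h a b hab
    by_cases ha : a = i <;> by_cases hb : b = i
    · rw [ha, hb]
    · rw [ha, addHook_self, addHook_of_ne _ hb] at hab
      exact absurd hab.symm (h b)
    · rw [hb, addHook_self, addHook_of_ne _ ha] at hab
      exact absurd hab (h a)
    · rw [addHook_of_ne _ hb, addHook_of_ne _ ha] at hab
      exact hβ hab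

lemma injective_remHook_iff {β : Fin N → ℕ} (hβ : Function.Injective β) (i : Fin N) {m : ℕ}
    (hm : m ≠ 0)
    (hi : m ≤ β i) : Function.Injective (remHook β i m) ↔ ∀ j, β j ≠ β i - m := by
  constructor
  · intro h j hj
    by_cases hji : j = i
    · subst hji; omega
    · exact hji (h (by rw [remHook_self, remHook_of_ne _ hji, hj]))
  · intro h a b hab
    by_cases ha : a = i <;> by_cases hb : b = i
    · rw [ha, hb]
    · rw [ha, remHook_self, remHook_of_ne _ hb] at hab
      exact absurd hab.symm (h b)
    · rw [hb, remHook_self, remHook_of_ne _ ha] at hab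
      exact absurd hab (h a)
    · rw [remHook_of_ne _ hb, remHook_of_ne _ ha] at hab
      exact hβ hab

lemma IsBeta.addHook {n m : ℕ} {β : Fin N → ℕ} (h : IsBeta n β) {i : Fin N}
    (hi : Function.Injective (addHook β i m)) : IsBeta (n + m) (addHook β i m) :=
  ⟨hi, by rw [sum_addHook, h.2]; ring⟩

lemma IsBeta.remHook {n m : ℕ} {β : Fin N → ℕ} (h : IsBeta (n + m) β) {i : Fin N} (hm : m ≤ β i)
    (hi : Function.Injective (remHook β i m)) : IsBeta n (remHook β i m) := by
  refine ⟨hi, ?_⟩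
  have h1 := sum_addHook (_root_.remHook β i m) i m
  rw [addHook_remHook hm, h.2] at h1
  omega

/-- The exponents of a hook partition of `m`, when `N ≤ i + m`. -/
def hookBeta (i : Fin N) (m : ℕ) : Fin N → ℕ := addHook (fun i => (i : ℕ)) i m

lemma injective_hookBeta_iff (i : Fin N) {m : ℕ} (hm : m ≠ 0) :
    Function.Injective (hookBeta i m) ↔ N ≤ i + m := by
  rw [hookBeta, injective_addHook_iff Fin.val_injective i hm]
  constructor
  · intro h
    by_contra hc
    exact h ⟨i + m, by omega⟩ rfl
  · intro h j
    have := j.2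
    omega

lemma IsBeta.hookBeta {i : Fin N} {m : ℕ} (hm : m ≠ 0) (hi : N ≤ i + m) :
    IsBeta m (hookBeta i m) := by
  have := IsBeta.zero_val.addHook ((injective_hookBeta_iff i hm).2 hi)
  rwa [zero_add] at this

lemma IsBeta.exists_hookBeta {m : ℕ} (hm : m ≠ 0) {β : Fin N → ℕ} (h : IsBeta m β) {i : Fin N}
    (hi : m ≤ β i) (hr : Function.Injective (_root_.remHook β i m)) :
    ∃ (j : Fin N) (w : Equiv.Perm (Fin N)), N ≤ j + m ∧ β = _root_.hookBeta j m ∘ w := by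
  have h0 : IsBeta 0 (_root_.remHook β i m) := IsBeta.remHook (by rwa [zero_add]) hi hr
  obtain ⟨w, hw⟩ := h0.zero_eq
  have e : β = _root_.hookBeta (w i) m ∘ w := by
    rw [← addHook_remHook hi, hw, addHook_comp]
    rfl
  refine ⟨w i, w, ?_, e⟩
  rw [← injective_hookBeta_iff _ hm]
  have := h.1
  rw [e] at this
  exact (Equiv.injective_comp w _).1 this

/-- The Murnaghan-Nakayama rule, keeping only the removable hooks. -/
lemma frobChar_psum_mul_eq_sum {β : Fin N → ℕ} (m : ℕ)
    {Q : MvPolynomial (Fin N) ℤ} (hQ : Q.IsSymmetric) (s : Finset (Fin N)) (hs : ∀ i ∈ s, m ≤ β i)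
    (hs' : ∀ i ∉ s, m ≤ β i → ¬ Function.Injective (remHook β i m)) :
    frobChar β (MvPolynomial.psum (Fin N) ℤ m * Q) = ∑ i ∈ s, frobChar (remHook β i m) Q := by
  rw [frobChar_psum_mul, ← Finset.sum_subset (Finset.subset_univ s)]
  · exact Finset.sum_congr rfl fun i hi => if_pos (hs i hi)
  · intro i _ hi
    split_ifs with h
    · exact frobChar_eq_zero_of_not_injective hQ (hs' i hi h)
    · rfl

lemma not_injective_of_eq {β : Fin N → ℕ} {i j : Fin N} {m : ℕ} (hij : i ≠ j) (h : β j = β i - m) :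
    ¬ Function.Injective (remHook β i m) := fun hc =>
  hij (hc (by rw [remHook_self, remHook_of_ne _ hij.symm, h]))

lemma frobChar_hookBeta_psum_mul {i : Fin N} {m : ℕ} (hi : N ≤ i + m)
    {Q : MvPolynomial (Fin N) ℤ} (hQ : Q.IsSymmetric) :
    frobChar (hookBeta i m) (MvPolynomial.psum (Fin N) ℤ m * Q) =
      frobChar (fun i => (i : ℕ)) Q := by
  rw [frobChar_psum_mul_eq_sum m hQ {i}, Finset.sum_singleton, hookBeta, remHook_addHook]
  · simp [hookBeta, addHook_self]
  · intro l hl hml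
    have hl' : l ≠ i := by simpa using hl
    rw [hookBeta, addHook_of_ne _ hl'] at hml
    have h2 := l.2
    refine not_injective_of_eq (j := ⟨l - m, by omega⟩) ?_ ?_
    · intro h
      have := congrArg Fin.val h
      dsimp at this
      omega
    · rw [hookBeta, addHook_of_ne _ hl', addHook_of_ne]
      intro h
      have := congrArg Fin.val h
      dsimp at this
      omega

lemma frobChar_hookBeta_psum {i : Fin N} {m : ℕ} (hi : N ≤ i + m) :
    frobChar (hookBeta i m) (MvPolynomial.psum (Fin N) ℤ m) = 1 := by
  rw [← mul_one (MvPolynomial.psum (Fin N) ℤ m),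
    frobChar_hookBeta_psum_mul hi MvPolynomial.IsSymmetric.one, frobChar_val_one]

lemma frobChar_hookBeta_two_mul {i : Fin N} {m : ℕ} (hm : m ≠ 0)
    {Q : MvPolynomial (Fin N) ℤ} (hQ : Q.IsSymmetric) :
    frobChar (hookBeta i (2 * m)) (MvPolynomial.psum (Fin N) ℤ m * Q) =
      if h : i + m < N then - frobChar (hookBeta ⟨i + m, h⟩ m) Q
      else frobChar (hookBeta i m) Q := by
  have key : ∀ l : Fin N, l ≠ i → (l : ℕ) ≠ i + m → m ≤ hookBeta i (2 * m) l →
      ¬ Function.Injective (remHook (hookBeta i (2 * m)) l m) := by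
    intro l hl hl2 hml
    rw [hookBeta, addHook_of_ne _ hl] at hml
    have h2 := l.2
    refine not_injective_of_eq (j := ⟨l - m, by omega⟩) ?_ ?_
    · intro h
      have := congrArg Fin.val h
      dsimp at this
      omega
    · rw [hookBeta, addHook_of_ne _ hl, addHook_of_ne]
      intro h
      have := congrArg Fin.val h
      dsimp at this
      omega
  have hsub : remHook (hookBeta i (2 * m)) i m = hookBeta i m := by
    ext l
    by_cases hl : l = i
    · subst hl
      rw [remHook_self, hookBeta, addHook_self, hookBeta, addHook_self]
      omega
    · rw [remHook_of_ne _ hl, hookBeta, addHook_of_ne _ hl, hookBeta, addHook_of_ne _ hl]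
  split_ifs with h
  · have hne : (⟨i + m, h⟩ : Fin N) ≠ i := by
      intro h
      have := congrArg Fin.val h
      dsimp at this
      omega
    rw [frobChar_psum_mul_eq_sum m hQ {⟨i + m, h⟩}, Finset.sum_singleton]
    · have e : remHook (hookBeta i (2 * m)) ⟨i + m, h⟩ m
          = hookBeta ⟨i + m, h⟩ m ∘ Equiv.swap i ⟨i + m, h⟩ := by
        ext l
        rw [Function.comp_apply]
        by_cases h1 : l = i
        · subst h1
          rw [Equiv.swap_apply_left, remHook_of_ne _ hne.symm, hookBeta, addHook_self, hookBeta,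
            addHook_self]
          dsimp only
          ring
        · by_cases h2 : l = ⟨i + m, h⟩
          · subst h2
            rw [Equiv.swap_apply_right, remHook_self, hookBeta, addHook_of_ne _ h1, hookBeta,
              addHook_of_ne _ hne.symm]
            simp
          · rw [Equiv.swap_apply_of_ne_of_ne h1 h2, remHook_of_ne _ h2, hookBeta,
              addHook_of_ne _ h1, hookBeta, addHook_of_ne _ h2]
      rw [e, frobChar_comp hQ, Equiv.Perm.sign_swap hne.symm]
      simp
    · simp only [Finset.mem_singleton]
      rintro _ rfl
      rw [hookBeta, addHook_of_ne _ hne]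
      simp
    · intro l hl hml
      by_cases h1 : l = i
      · subst h1
        rw [hsub, injective_hookBeta_iff _ hm]
        omega
      · refine key l h1 (fun h2 => hl ?_) hml
        simp [Fin.ext_iff, h2]
  · rw [frobChar_psum_mul_eq_sum m hQ {i}, Finset.sum_singleton, hsub]
    · simp only [Finset.mem_singleton]
      rintro _ rfl
      rw [hookBeta, addHook_self]
      omega
    · intro l hl hml
      have := l.2
      exact key l (by simpa using hl) (by omega) hml

end

section
variable {N : ℕ}

/-- The symmetric polynomial attached to a permutation of `2 ^ k` points with cycles of lengths
`2 ^ (k - 1), …, 2, 1, 1`. -/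
def pickyPoly (N : ℕ) : ℕ → MvPolynomial (Fin N) ℤ
  | 0 => MvPolynomial.psum (Fin N) ℤ 1
  | k + 1 => MvPolynomial.psum (Fin N) ℤ (2 ^ k) * pickyPoly N k

lemma pickyPoly_isSymmetric : ∀ k, (pickyPoly N k).IsSymmetric
  | 0 => MvPolynomial.psum_isSymmetric _ _ _
  | k + 1 => (MvPolynomial.psum_isSymmetric _ _ _).mul (pickyPoly_isSymmetric k)

lemma card_hooks {m : ℕ} (hm : m ≤ N) :
    (Finset.univ.filter fun i : Fin N => N ≤ i + m).card = m := by
  have h : (Finset.univ.filter fun i : Fin N => ¬ N ≤ i + m).card = N - m := by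
    rw [← Fintype.card_subtype, Fintype.card_congr (β := Fin (N - m)), Fintype.card_fin]
    exact ⟨fun i => ⟨i.1, by have := i.2; omega⟩, fun i => ⟨⟨i, by omega⟩, by simp; omega⟩,
      fun i => rfl, fun i => rfl⟩
  have := Finset.card_filter_add_card_filter_not (s := Finset.univ) (fun i : Fin N => N ≤ i + m)
  rw [h, Finset.card_univ, Fintype.card_fin] at this
  omega

lemma frobChar_hookBeta_pickyPoly_zero (i : Fin N) (hi : N ≤ i + 1) :
    frobChar (hookBeta i 1) (pickyPoly N 0) = 1 := frobChar_hookBeta_psum hi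

lemma frobChar_hookBeta_pickyPoly_succ (k : ℕ) (i : Fin N) :
    frobChar (hookBeta i (2 ^ (k + 1))) (pickyPoly N (k + 1)) =
      if h : i + 2 ^ k < N then - frobChar (hookBeta ⟨i + 2 ^ k, h⟩ (2 ^ k)) (pickyPoly N k)
        else frobChar (hookBeta i (2 ^ k)) (pickyPoly N k) := by
  rw [pow_succ', pickyPoly]
  exact frobChar_hookBeta_two_mul (by positivity) (pickyPoly_isSymmetric k)

lemma frobChar_hookBeta_pickyPoly (k : ℕ) (i : Fin N) (hi : N ≤ i + 2 ^ k) :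
    frobChar (hookBeta i (2 ^ k)) (pickyPoly N k) = 1 ∨
      frobChar (hookBeta i (2 ^ k)) (pickyPoly N k) = -1 := by
  induction k generalizing i with
  | zero => exact Or.inl (frobChar_hookBeta_pickyPoly_zero i (by simpa using hi))
  | succ k ih =>
    rw [frobChar_hookBeta_pickyPoly_succ]
    split_ifs with h
    · rcases ih ⟨i + 2 ^ k, h⟩ (by rw [pow_succ'] at hi; simp only; omega) with h1 | h1
      · right; rw [h1]
      · left; rw [h1]; rfl
    · exact ih i (by omega)

lemma sum_frobChar_hookBeta_pickyPoly {k : ℕ} (hk : 2 ^ (k + 1) ≤ N) :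
    ∑ i : Fin N, frobChar (hookBeta i (2 ^ (k + 1))) (pickyPoly N (k + 1)) = 0 := by
  let U : ℕ → ℤ := fun j => if h : j < N then
    frobChar (hookBeta ⟨j, h⟩ (2 ^ k)) (pickyPoly N k) else 0
  have hU : ∀ j, j + 2 ^ k < N → U j = 0 := by
    intro j hj
    simp only [U]
    rw [dif_pos ((Nat.le_add_right _ _).trans_lt hj)]
    refine frobChar_eq_zero_of_not_injective (pickyPoly_isSymmetric k) ?_
    rw [injective_hookBeta_iff _ (by positivity)]
    exact not_le.2 hj
  have hN : ∀ j, N ≤ j → U j = 0 := fun j hj => dif_neg (by omega)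
  have e : ∀ i : Fin N, frobChar (hookBeta i (2 ^ (k + 1))) (pickyPoly N (k + 1))
      = U i - U (i + 2 ^ k) := by
    intro i
    rw [frobChar_hookBeta_pickyPoly_succ]
    split_ifs with h
    · rw [hU i h]
      simp [U, h]
    · rw [hN (i + 2 ^ k) (by omega)]
      simp [U]
  rw [Finset.sum_congr rfl fun i _ => e i, Fin.sum_univ_eq_sum_range (fun i => U i - U (i + 2 ^ k)),
    Finset.sum_sub_distrib, sub_eq_zero]
  rw [pow_succ'] at hk
  obtain ⟨n, hn⟩ : ∃ n, N = 2 ^ k + n := ⟨N - 2 ^ k, by omega⟩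
  conv_rhs => rw [hn, add_comm (2 ^ k) n]
  conv_lhs => rw [hn]
  rw [Finset.sum_range_add, Finset.sum_range_add]
  rw [Finset.sum_eq_zero (s := Finset.range (2 ^ k)) (f := U),
    Finset.sum_eq_zero (s := Finset.range (2 ^ k)), zero_add, add_zero]
  · exact Finset.sum_congr rfl fun i _ => by rw [add_comm]
  · intro j hj
    exact hN _ (by omega)
  · intro j hj
    have := Finset.mem_range.1 hj
    exact hU _ (by omega)

/-- The exponents of the partitions with two disjoint hooks of length `m`. -/
def pairBeta (i j : Fin N) (m : ℕ) : Fin N → ℕ := addHook (hookBeta i m) j m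

lemma pairBeta_left {i j : Fin N} (hij : i ≠ j) (m : ℕ) : pairBeta i j m i = i + m := by
  rw [pairBeta, addHook_of_ne _ hij, hookBeta, addHook_self]

lemma pairBeta_right {i j : Fin N} (hij : i ≠ j) (m : ℕ) : pairBeta i j m j = j + m := by
  rw [pairBeta, addHook_self, hookBeta, addHook_of_ne _ hij.symm]

lemma pairBeta_of_ne {i j l : Fin N} (hi : l ≠ i) (hj : l ≠ j) (m : ℕ) : pairBeta i j m l = l := by
  rw [pairBeta, addHook_of_ne _ hj, hookBeta, addHook_of_ne _ hi]

lemma pairBeta_comm {i j : Fin N} (hij : i ≠ j) (m : ℕ) : pairBeta i j m = pairBeta j i m := by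
  ext l
  by_cases hi : l = i
  · subst hi; rw [pairBeta_left hij, pairBeta_right hij.symm]
  · by_cases hj : l = j
    · subst hj; rw [pairBeta_left hij.symm, pairBeta_right hij]
    · rw [pairBeta_of_ne hi hj, pairBeta_of_ne hj hi]

lemma pairBeta_apply_ne_left {i j : Fin N} (hij : i ≠ j) {m : ℕ} (hj : N ≤ j + m)
    (l : Fin N) : pairBeta i j m l ≠ i := by
  have := i.2
  by_cases h : l = i
  · subst h; rw [pairBeta_left hij]; omega
  · by_cases h' : l = j
    · subst h'; rw [pairBeta_right hij]; omega
    · rw [pairBeta_of_ne h h']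
      exact fun h2 => h (Fin.ext h2)

lemma IsBeta.pairBeta {i j : Fin N} (hij : i ≠ j) {m : ℕ} (hm : m ≠ 0) (hi : N ≤ i + m)
    (hj : N ≤ j + m) :
    IsBeta (2 * m) (pairBeta i j m) := by
  rw [two_mul]
  refine (IsBeta.hookBeta hm hi).addHook ?_
  rw [injective_addHook_iff ((injective_hookBeta_iff i hm).2 hi) j hm]
  intro l
  have hl := l.2
  rw [_root_.hookBeta, addHook_of_ne _ hij.symm]
  by_cases h : l = i
  · subst h
    rw [addHook_self]
    have : (l : ℕ) ≠ j := fun h => hij (Fin.ext h)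
    omega
  · rw [addHook_of_ne _ h]; omega

lemma frobChar_pairBeta_psum_mul {i j : Fin N} (hij : i ≠ j) {m : ℕ} (hi : N ≤ i + m)
    (hj : N ≤ j + m) {Q : MvPolynomial (Fin N) ℤ} (hQ : Q.IsSymmetric) :
    frobChar (pairBeta i j m) (MvPolynomial.psum (Fin N) ℤ m * Q)
      = frobChar (hookBeta i m) Q + frobChar (hookBeta j m) Q := by
  rw [frobChar_psum_mul_eq_sum m hQ {i, j}, Finset.sum_pair hij]
  · rw [add_comm]
    congr 1
    · rw [pairBeta, remHook_addHook]
    · rw [pairBeta_comm hij, pairBeta, remHook_addHook]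
  · intro l hl
    rcases Finset.mem_insert.1 hl with rfl | hl
    · rw [pairBeta_left hij]; omega
    · rw [Finset.mem_singleton.1 hl, pairBeta_right hij]; omega
  · intro l hl hml
    have hli : l ≠ i := fun h => hl (by simp [h])
    have hlj : l ≠ j := fun h => hl (by simp [h])
    rw [pairBeta_of_ne hli hlj] at hml
    have h2 := l.2
    refine not_injective_of_eq (j := ⟨l - m, by omega⟩) ?_ ?_
    · intro h
      have := congrArg Fin.val h
      dsimp at this
      omega
    · rw [pairBeta_of_ne hli hlj, pairBeta_of_ne]
      · intro h
        have := congrArg Fin.val h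
        dsimp at this
        omega
      · intro h
        have := congrArg Fin.val h
        dsimp at this
        omega

end

lemma card_image_pairs {ι β : Type*} [DecidableEq ι] [DecidableEq β] (s : Finset ι) (P : ι → Prop)
    [DecidablePred P] {p : ℕ} (h1 : (s.filter P).card = p) (h2 : (s.filter fun i => ¬ P i).card = p)
    (F : ι × ι → β) (hF : ∀ a ∈ s.offDiag, ∀ b ∈ s.offDiag, F a = F b ↔ a = b ∨ a = b.swap) :
    ((s.offDiag.filter fun a => P a.1 ↔ P a.2).image F).card = p * (p - 1) := by
  set T := s.offDiag.filter fun a => P a.1 ↔ P a.2 with hT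
  have hcard : T.card = 2 * (p * (p - 1)) := by
    have e : T = (s.filter P).offDiag ∪ (s.filter fun i => ¬ P i).offDiag := by
      ext ⟨a, b⟩
      simp only [hT, Finset.mem_filter, Finset.mem_offDiag, Finset.mem_union]
      tauto
    rw [e, Finset.card_union_of_disjoint, Finset.offDiag_card, Finset.offDiag_card, h1, h2,
      Nat.mul_sub, mul_one]
    · ring
    · rw [Finset.disjoint_left]
      rintro ⟨a, b⟩ h h'
      simp only [Finset.mem_filter, Finset.mem_offDiag] at h h'
      tauto
  have h3 : T.card = ∑ b ∈ T.image F, 2 := by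
    rw [Finset.card_eq_sum_card_image F T]
    refine Finset.sum_congr rfl fun b hb => ?_
    obtain ⟨a, ha, rfl⟩ := Finset.mem_image.1 hb
    have e : T.filter (fun c => F c = F a) = {a, a.swap} := by
      ext c
      simp only [Finset.mem_filter, Finset.mem_insert, Finset.mem_singleton]
      have ha' := Finset.mem_filter.1 ha
      constructor
      · rintro ⟨hc, hc'⟩
        exact (hF c (Finset.mem_filter.1 hc).1 a ha'.1).1 hc'
      · have hsw : a.swap ∈ T := by
          have := Finset.mem_offDiag.1 ha'.1
          exact Finset.mem_filter.2 ⟨Finset.mem_offDiag.2 ⟨this.2.1, this.1, this.2.2.symm⟩,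
            ha'.2.symm⟩
        rintro (rfl | rfl)
        · exact ⟨ha, rfl⟩
        · exact ⟨hsw, (hF _ (Finset.mem_filter.1 hsw).1 a ha'.1).2 (Or.inr rfl)⟩
    rw [e, Finset.card_pair]
    intro h
    exact (Finset.mem_offDiag.1 (Finset.mem_filter.1 ha).1).2.2 (congrArg Prod.fst h)
  rw [Finset.sum_const, smul_eq_mul] at h3
  omega

lemma padicValNat_factorial_add_two_pow_mul (k n r : ℕ) (hr : r < 2 ^ k) :
    padicValNat 2 (r + 2 ^ k * n).factorial + n
      = padicValNat 2 n.factorial + padicValNat 2 r.factorial + n * 2 ^ k := by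
  induction k generalizing r with
  | zero =>
    obtain rfl : r = 0 := by simpa using hr
    simp
  | succ k ih =>
    have h1 := ih (r / 2) (by rw [pow_succ] at hr; omega)
    have e1 : r + 2 ^ (k + 1) * n = 2 * (r / 2 + 2 ^ k * n) + r % 2 := by
      rw [pow_succ]
      have := Nat.div_add_mod r 2
      linarith
    have e2 : r = 2 * (r / 2) + r % 2 := by omega
    have h2 := padicValNat_factorial_mul_add (p := 2) (r / 2 + 2 ^ k * n) (Nat.mod_lt r two_pos)
    have h3 := padicValNat_factorial_mul_add (p := 2) (r / 2) (Nat.mod_lt r two_pos)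
    rw [padicValNat_factorial_mul] at h2 h3
    rw [e1, h2]
    rw [← e2] at h3
    rw [h3, pow_succ]
    linarith

lemma padicValNat_factorial_two_pow (k : ℕ) : padicValNat 2 (2 ^ k).factorial + 1 = 2 ^ k := by
  have := padicValNat_factorial_add_two_pow_mul k 1 0 (by positivity)
  simpa using this

section
variable {N : ℕ}

lemma exists_diffProd_eq (i : Fin N) {β γ : Fin N → ℕ} (h : ∀ j, j ≠ i → β j = γ j) :
    ∃ D : ℕ, (diffProd β).natAbs = D * ∏ j ∈ Finset.univ.erase i, ((β i : ℤ) - β j).natAbs ∧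
      (diffProd γ).natAbs = D * ∏ j ∈ Finset.univ.erase i, ((γ i : ℤ) - γ j).natAbs := by
  let T := (Finset.univ.filter fun p : Fin N × Fin N => p.1 < p.2)
  have key : ∀ δ : Fin N → ℕ, (diffProd δ).natAbs =
      (∏ p ∈ T.filter (fun p => ¬ (p.1 = i ∨ p.2 = i)), ((δ p.2 : ℤ) - δ p.1).natAbs) *
        ∏ j ∈ Finset.univ.erase i, ((δ i : ℤ) - δ j).natAbs := by
    intro δ
    have e1 : (diffProd δ).natAbs = ∏ p ∈ T, ((δ p.2 : ℤ) - δ p.1).natAbs := by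
      rw [diffProd, ← Finset.prod_subset (Finset.subset_univ _)
        (fun x _ hx => absurd (Finset.mem_univ x) hx)]
      rw [← Int.natAbsHom_apply, map_prod]
      simp only [map_prod, Int.natAbsHom_apply]
      rw [Finset.prod_sigma']
      refine Finset.prod_bij' (fun p _ => (p.1, p.2)) (fun p _ => ⟨p.1, p.2⟩) ?_ ?_ ?_ ?_ ?_ <;>
        simp [T]
    rw [e1, ← Finset.prod_filter_mul_prod_filter_not T (fun p => p.1 = i ∨ p.2 = i), mul_comm]
    congr 1
    refine Finset.prod_bij' (fun p _ => if p.1 = i then p.2 else p.1)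
      (fun j _ => (min i j, max i j)) ?_ ?_ ?_ ?_ ?_
    · rintro ⟨a, b⟩ hp
      simp only [T, Finset.mem_filter, Finset.mem_univ, true_and] at hp
      simp only [Finset.mem_erase, Finset.mem_univ, and_true]
      split_ifs with h1
      · rw [← h1]; exact hp.1.ne'
      · exact h1
    · intro j hj
      have hj' := Finset.ne_of_mem_erase hj
      simp only [T, Finset.mem_filter, Finset.mem_univ, true_and]
      rcases lt_or_gt_of_ne hj' with h | h
      · simp [h, h.le]
      · simp [h, h.le]
    · rintro ⟨a, b⟩ hp
      simp only [T, Finset.mem_filter, Finset.mem_univ, true_and] at hp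
      obtain ⟨hab, hp⟩ := hp
      dsimp only
      split_ifs with h1
      · subst h1; simp [hab.le]
      · have : b = i := hp.resolve_left h1
        subst this; simp [hab.le]
    · intro j hj
      have hj' := Finset.ne_of_mem_erase hj
      rcases lt_or_gt_of_ne hj' with h | h
      · simp [h.le, h.ne]
      · simp [h.le]
    · rintro ⟨a, b⟩ hp
      simp only [T, Finset.mem_filter, Finset.mem_univ, true_and] at hp
      obtain ⟨hab, hp⟩ := hp
      dsimp only
      split_ifs with h1
      · subst h1; rw [← Int.natAbs_neg]; congr 1; ring
      · have : b = i := hp.resolve_left h1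
        rw [this]
  refine ⟨_, key β, ?_⟩
  rw [key γ]
  congr 1
  refine Finset.prod_congr rfl ?_
  rintro ⟨a, b⟩ hp
  simp only [Finset.mem_filter, not_or] at hp
  rw [h a hp.2.1, h b hp.2.2]

/-- The degree of the character attached to a vector of exponents with excess `n`. -/
def betaDeg (n : ℕ) (β : Fin N → ℕ) : ℕ := (frobChar β (MvPolynomial.psum (Fin N) ℤ 1 ^ n)).natAbs

lemma IsBeta.betaDeg_mul {n : ℕ} {β : Fin N → ℕ} (h : IsBeta n β) :
    betaDeg n β * ∏ i, (β i).factorial = n.factorial * (diffProd β).natAbs := by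
  have := congrArg Int.natAbs (frobChar_psum_one_pow h.2)
  rw [Int.natAbs_mul, Int.natAbs_mul] at this
  rwa [← Nat.cast_prod, Int.natAbs_natCast, Int.natAbs_natCast] at this

lemma betaDeg_addHook_mul {n m : ℕ} {γ : Fin N → ℕ} (hγ : IsBeta n γ) {i : Fin N}
    (hi : Function.Injective (addHook γ i m)) :
    betaDeg (n + m) (addHook γ i m) * (γ i + m).factorial * n.factorial *
        ∏ j ∈ Finset.univ.erase i, ((γ i : ℤ) - γ j).natAbs
      = betaDeg n γ * (γ i).factorial * (n + m).factorial *
        ∏ j ∈ Finset.univ.erase i, ((γ i : ℤ) + m - γ j).natAbs := by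
  obtain ⟨D, h1, h2⟩ := exists_diffProd_eq i (β := addHook γ i m) (γ := γ)
    (fun j hj => addHook_of_ne _ hj _)
  have e1 : ∏ j ∈ Finset.univ.erase i, (((addHook γ i m) i : ℤ) - (addHook γ i m) j).natAbs
      = ∏ j ∈ Finset.univ.erase i, ((γ i : ℤ) + m - γ j).natAbs := by
    refine Finset.prod_congr rfl fun j hj => ?_
    rw [addHook_self, addHook_of_ne _ (Finset.ne_of_mem_erase hj)]
    push_cast
    rfl
  rw [e1] at h1
  have h3 := (hγ.addHook hi).betaDeg_mul
  have h4 := hγ.betaDeg_mul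
  rw [← Finset.mul_prod_erase _ _ (Finset.mem_univ i)] at h3 h4
  have e2 : ∏ j ∈ Finset.univ.erase i, (addHook γ i m j).factorial
      = ∏ j ∈ Finset.univ.erase i, (γ j).factorial :=
    Finset.prod_congr rfl fun j hj => by rw [addHook_of_ne _ (Finset.ne_of_mem_erase hj)]
  rw [e2, addHook_self, h1] at h3
  rw [h2] at h4
  have hD : D ≠ 0 := by
    rintro rfl
    rw [zero_mul] at h2
    have h0 := Int.natAbs_eq_zero.1 h2
    rw [diffProd, Finset.prod_eq_zero_iff] at h0
    obtain ⟨a, -, h0⟩ := h0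
    obtain ⟨b, hb, h0⟩ := Finset.prod_eq_zero_iff.1 h0
    have := hγ.1 (show γ b = γ a by omega)
    exact (Finset.mem_Ioi.1 hb).ne' this
  have hP : ∏ j ∈ Finset.univ.erase i, (γ j).factorial ≠ 0 :=
    Finset.prod_ne_zero_iff.2 fun j _ => Nat.factorial_ne_zero _
  set P := ∏ j ∈ Finset.univ.erase i, (γ j).factorial
  set A := ∏ j ∈ Finset.univ.erase i, ((γ i : ℤ) - γ j).natAbs
  set B := ∏ j ∈ Finset.univ.erase i, ((γ i : ℤ) + m - γ j).natAbs
  refine Nat.eq_of_mul_eq_mul_right (Nat.pos_of_ne_zero (mul_ne_zero hD hP)) ?_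
  calc _ = (betaDeg (n + m) (addHook γ i m) * ((γ i + m).factorial * P)) *
        (n.factorial * (D * A)) := by ring
    _ = (n + m).factorial * (D * B) * (betaDeg n γ * ((γ i).factorial * P)) := by rw [h3, h4]
    _ = _ := by ring

end

lemma padicValNat_add_two_pow {k : ℕ} {c : ℤ} (hc : ¬ (2 ^ k : ℤ) ∣ c) :
    padicValNat 2 (c + 2 ^ k).natAbs = padicValNat 2 c.natAbs := by
  have h0 : c.natAbs ≠ 0 := fun h => hc (by rw [Int.natAbs_eq_zero.1 h]; exact dvd_zero _)
  have hc' : ¬ (2 ^ k : ℤ) ∣ c + 2 ^ k := by rwa [dvd_add_left (dvd_refl _)]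
  have h1 : (c + 2 ^ k).natAbs ≠ 0 :=
    fun h => hc' (by rw [Int.natAbs_eq_zero.1 h]; exact dvd_zero _)
  refine eq_of_forall_le_iff fun t => ?_
  rw [← padicValNat_dvd_iff_le h0, ← padicValNat_dvd_iff_le h1, ← Int.natCast_dvd,
    ← Int.natCast_dvd]
  push_cast
  rcases le_or_gt t k with h | h
  · exact dvd_add_left (pow_dvd_pow 2 h)
  · exact ⟨fun h2 => absurd ((pow_dvd_pow 2 h.le).trans h2) hc',
      fun h2 => absurd ((pow_dvd_pow 2 h.le).trans h2) hc⟩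

lemma padicValNat_prod_congr {ι : Type*} (s : Finset ι) {f g : ι → ℕ}
    (hf : ∀ i ∈ s, f i ≠ 0) (hg : ∀ i ∈ s, g i ≠ 0)
    (h : ∀ i ∈ s, padicValNat 2 (f i) = padicValNat 2 (g i)) :
    padicValNat 2 (∏ i ∈ s, f i) = padicValNat 2 (∏ i ∈ s, g i) := by
  classical
  induction s using Finset.induction_on with
  | empty => rfl
  | insert a s ha ih =>
    simp only [Finset.forall_mem_insert] at hf hg h
    rw [Finset.prod_insert ha, Finset.prod_insert ha,
      padicValNat.mul hf.1 (Finset.prod_ne_zero_iff.2 hf.2),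
      padicValNat.mul hg.1 (Finset.prod_ne_zero_iff.2 hg.2), h.1, ih hf.2 hg.2 h.2]

section
variable {N : ℕ}

lemma exists_eq_sub_mul {γ : Fin N → ℕ} {m : ℕ} (hn : ∀ j, m ≤ γ j → ∃ l, γ l = γ j - m)
    {i : Fin N} (t : ℕ)
    {c : ℕ} (h : γ i = c + t * m) : ∃ j, γ j = c := by
  induction t generalizing i with
  | zero => exact ⟨i, by simpa using h⟩
  | succ t ih =>
    rw [add_mul, one_mul, ← add_assoc] at h
    obtain ⟨l, hl⟩ := hn i (by omega)
    exact ih (i := l) (by omega)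

lemma padicValNat_betaDeg_addHook {n k : ℕ} {γ : Fin N → ℕ} (hγ : IsBeta n γ)
    (hn : ∀ j, 2 ^ k ≤ γ j → ∃ l, γ l = γ j - 2 ^ k) {i : Fin N}
    (hi : Function.Injective (addHook γ i (2 ^ k))) (hdeg : betaDeg n γ ≠ 0) :
    padicValNat 2 (betaDeg (n + 2 ^ k) (addHook γ i (2 ^ k))) + padicValNat 2 n.factorial + 2 ^ k
      = padicValNat 2 (betaDeg n γ) + padicValNat 2 (n + 2 ^ k).factorial + 1 := by
  classical
  set m := 2 ^ k with hm
  have hm0 : 0 < m := by positivity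
  have hadd := (injective_addHook_iff hγ.1 i hm0.ne').1 hi
  obtain ⟨q, r, hr, hb⟩ : ∃ q r, r < m ∧ γ i = r + m * q :=
    ⟨γ i / m, γ i % m, Nat.mod_lt _ hm0, by rw [add_comm, Nat.div_add_mod]⟩
  set s := Finset.univ.erase i
  set s0 := s.filter fun j => γ j % m = r with hs0
  have hs0' : ∀ j ∈ s0, ∃ t < q, γ j + (t + 1) * m = γ i := by
    intro j hj
    obtain ⟨hj1, hj2⟩ := Finset.mem_filter.1 hj
    have hji := Finset.ne_of_mem_erase hj1
    have e := Nat.div_add_mod (γ j) m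
    rw [hj2] at e
    generalize γ j / m = a at e
    rcases lt_trichotomy a q with h | h | h
    · obtain ⟨d, rfl⟩ := Nat.exists_eq_add_of_lt h
      refine ⟨d, by omega, ?_⟩
      rw [hb, ← e]
      ring
    · exact absurd (hγ.1 (by rw [hb, ← e, h, add_comm])) hji
    · obtain ⟨d, hd⟩ := Nat.exists_eq_add_of_lt h
      obtain ⟨l, hl⟩ := exists_eq_sub_mul hn (i := j) d (c := γ i + m) (by
        rw [hb, ← e, hd]; ring)
      exact absurd hl (hadd l)
  have hprod : ∀ f : ℕ → ℕ, ∏ j ∈ s0, f ((γ i - γ j) / m - 1) = ∏ t ∈ Finset.range q, f t := by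
    intro f
    have hval : ∀ j t, γ j + (t + 1) * m = γ i → (γ i - γ j) / m - 1 = t := by
      intro j t h
      rw [← h, Nat.add_sub_cancel_left, Nat.mul_div_cancel _ hm0, Nat.add_sub_cancel]
    refine Finset.prod_nbij (fun j => (γ i - γ j) / m - 1) ?_ ?_ ?_ (fun _ _ => rfl)
    · intro j hj
      obtain ⟨t, ht, h⟩ := hs0' j hj
      rw [hval j t h]
      exact Finset.mem_range.2 ht
    · intro j hj j' hj' hjj
      obtain ⟨t, ht, h⟩ := hs0' j hj
      obtain ⟨t', ht', h'⟩ := hs0' j' hj'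
      dsimp only at hjj
      rw [hval j t h, hval j' t' h'] at hjj
      subst hjj
      exact hγ.1 (by omega)
    · intro t ht
      have ht' : t < q := by simpa using ht
      obtain ⟨d, rfl⟩ := Nat.exists_eq_add_of_lt ht'
      obtain ⟨j, hj⟩ := exists_eq_sub_mul hn (i := i) (t + 1) (c := r + m * d) (by rw [hb]; ring)
      have e : γ j + (t + 1) * m = γ i := by rw [hj, hb]; ring
      refine ⟨j, ?_, hval j t e⟩
      simp only [hs0, Finset.coe_filter, Set.mem_ofPred_eq]
      refine ⟨Finset.mem_erase.2 ⟨?_, Finset.mem_univ _⟩, ?_⟩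
      · rintro rfl
        have : 0 < (t + 1) * m := by positivity
        omega
      · rw [hj, Nat.add_mul_mod_self_left, Nat.mod_eq_of_lt hr]
  have hA0 : ∏ j ∈ s0, ((γ i : ℤ) - γ j).natAbs = m ^ q * q.factorial := by
    rw [Finset.prod_congr rfl (g := fun j => (fun t => m * (t + 1)) ((γ i - γ j) / m - 1)),
      hprod fun t => m * (t + 1), Finset.prod_mul_distrib, Finset.prod_const, Finset.card_range,
      Finset.prod_range_add_one_eq_factorial]
    intro j hj
    obtain ⟨t, ht, h⟩ := hs0' j hj
    dsimp only
    rw [← h, Nat.add_sub_cancel_left, Nat.mul_div_cancel _ hm0, Nat.add_sub_cancel, mul_comm]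
    rw [Nat.cast_add, add_sub_cancel_left, Int.natAbs_natCast]
  have hB0 : ∏ j ∈ s0, ((γ i : ℤ) + m - γ j).natAbs = m ^ q * (q + 1).factorial := by
    rw [Finset.prod_congr rfl (g := fun j => (fun t => m * (t + 1 + 1)) ((γ i - γ j) / m - 1)),
      hprod fun t => m * (t + 1 + 1), Finset.prod_mul_distrib, Finset.prod_const, Finset.card_range,
      ← Finset.prod_range_add_one_eq_factorial (q + 1), Finset.prod_range_succ']
    · simp
    intro j hj
    obtain ⟨t, ht, h⟩ := hs0' j hj
    dsimp only
    rw [← h, Nat.add_sub_cancel_left, Nat.mul_div_cancel _ hm0, Nat.add_sub_cancel, mul_comm]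
    have : ((γ j + m * (t + 1) : ℕ) : ℤ) + m - γ j = (m * (t + 1 + 1) : ℕ) := by push_cast; ring
    rw [this, Int.natAbs_natCast]
  have hane : ∀ j ∈ s, ((γ i : ℤ) - γ j).natAbs ≠ 0 := by
    intro j hj h
    exact Finset.ne_of_mem_erase hj (hγ.1 (by omega))
  have hbne : ∀ j ∈ s, ((γ i : ℤ) + m - γ j).natAbs ≠ 0 := by
    intro j hj h
    exact hadd j (by omega)
  have hR : padicValNat 2 (∏ j ∈ s.filter (fun j => ¬ γ j % m = r), ((γ i : ℤ) - γ j).natAbs)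
      = padicValNat 2 (∏ j ∈ s.filter (fun j => ¬ γ j % m = r), ((γ i : ℤ) + m - γ j).natAbs) := by
    refine padicValNat_prod_congr _ (fun j hj => hane j (Finset.mem_filter.1 hj).1)
      (fun j hj => hbne j (Finset.mem_filter.1 hj).1) fun j hj => ?_
    have e : (γ i : ℤ) + m - γ j = (γ i : ℤ) - γ j + 2 ^ k := by rw [hm]; push_cast; ring
    rw [e, padicValNat_add_two_pow]
    intro hd
    refine (Finset.mem_filter.1 hj).2 ?_
    have h3 : ((m : ℕ) : ℤ) ∣ (γ i : ℤ) - γ j := by rw [hm]; push_cast; exact hd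
    rw [← Nat.modEq_iff_dvd] at h3
    rw [h3, hb, Nat.add_mul_mod_self_left, Nat.mod_eq_of_lt hr]
  have hmain := congrArg (padicValNat 2) (betaDeg_addHook_mul hγ hi)
  have hA := Finset.prod_filter_mul_prod_filter_not s (fun j => γ j % m = r)
    fun j => ((γ i : ℤ) - γ j).natAbs
  have hB := Finset.prod_filter_mul_prod_filter_not s (fun j => γ j % m = r)
    fun j => ((γ i : ℤ) + m - γ j).natAbs
  rw [hA0] at hA
  rw [hB0] at hB
  have hRA0 : ∏ j ∈ s.filter (fun j => ¬ γ j % m = r), ((γ i : ℤ) - γ j).natAbs ≠ 0 :=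
    Finset.prod_ne_zero_iff.2 fun j hj => hane j (Finset.mem_filter.1 hj).1
  have hRB0 : ∏ j ∈ s.filter (fun j => ¬ γ j % m = r), ((γ i : ℤ) + m - γ j).natAbs ≠ 0 :=
    Finset.prod_ne_zero_iff.2 fun j hj => hbne j (Finset.mem_filter.1 hj).1
  have hdeg' : betaDeg (n + m) (addHook γ i m) ≠ 0 := by
    intro h
    have h5 := betaDeg_addHook_mul hγ hi
    rw [h, zero_mul, zero_mul, zero_mul] at h5
    refine absurd h5.symm ?_
    exact mul_ne_zero (mul_ne_zero (mul_ne_zero hdeg (Nat.factorial_ne_zero _))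
      (Nat.factorial_ne_zero _))
      (Finset.prod_ne_zero_iff.2 hbne)
  rw [← hA, ← hB] at hmain
  have hf := Nat.factorial_ne_zero
  have hmq : m ^ q ≠ 0 := by positivity
  rw [padicValNat.mul (mul_ne_zero (mul_ne_zero hdeg' (hf _)) (hf _))
      (mul_ne_zero (mul_ne_zero hmq (hf _)) hRA0),
    padicValNat.mul (mul_ne_zero (mul_ne_zero hdeg (hf _)) (hf _))
      (mul_ne_zero (mul_ne_zero hmq (hf _)) hRB0),
    padicValNat.mul (mul_ne_zero hdeg' (hf _)) (hf _), padicValNat.mul hdeg' (hf _),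
    padicValNat.mul (mul_ne_zero hdeg (hf _)) (hf _), padicValNat.mul hdeg (hf _),
    padicValNat.mul (mul_ne_zero hmq (hf _)) hRA0, padicValNat.mul hmq (hf _),
    padicValNat.mul (mul_ne_zero hmq (hf _)) hRB0, padicValNat.mul hmq (hf _), hR] at hmain
  have v1 := padicValNat_factorial_add_two_pow_mul k q r hr
  have v2 := padicValNat_factorial_add_two_pow_mul k (q + 1) r hr
  rw [← hm] at v1 v2
  have e2 : r + m * (q + 1) = γ i + m := by rw [hb]; ring
  rw [e2, add_mul, one_mul] at v2
  rw [← hb] at v1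
  omega

end

section
variable {N : ℕ}

/-- Pairwise inequivalent vectors of exponents whose characters have degree exactly divisible by
`2 ^ a` and value `±2` at the picky element. -/
def IsPickyFamily (k a : ℕ) (M : Finset (Fin N → ℕ)) : Prop :=
  (∀ β ∈ M, IsBeta (2 ^ k) β ∧ betaDeg (2 ^ k) β ≠ 0 ∧ padicValNat 2 (betaDeg (2 ^ k) β) = a ∧
    (frobChar β (pickyPoly N k) = 2 ∨ frobChar β (pickyPoly N k) = -2)) ∧
  (∀ β ∈ M, ∀ γ ∈ M, ∀ w : Equiv.Perm (Fin N), β ∘ w = γ → β = γ) ∧ M.card = pickyCount k a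

lemma betaDeg_hookBeta_odd (k : ℕ) (i : Fin N) (hi : N ≤ i + 2 ^ k) :
    ¬ 2 ∣ betaDeg (2 ^ k) (hookBeta i (2 ^ k)) := by
  obtain ⟨R, hR⟩ := exists_psum_one_pow (N := N) k
  have h2 := frobChar_intCast_mul (hookBeta i (2 ^ k)) 2 R
  push_cast at h2
  rw [betaDeg, hR, frobChar_add, frobChar_hookBeta_psum hi, h2]
  omega

lemma psum_pow_isSymmetric (n : ℕ) : (MvPolynomial.psum (Fin N) ℤ 1 ^ n).IsSymmetric := fun e => by
  rw [map_pow, MvPolynomial.psum_isSymmetric (Fin N) ℤ 1 e]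

lemma exists_eq_sub_of_even {k : ℕ} {γ : Fin N → ℕ} (hγ : IsBeta (2 ^ k) γ)
    (h : 2 ∣ betaDeg (2 ^ k) γ) (j : Fin N) (hj : 2 ^ k ≤ γ j) : ∃ l, γ l = γ j - 2 ^ k := by
  by_contra hc
  push Not at hc
  have hm : 2 ^ k ≠ 0 := by positivity
  obtain ⟨i, w, hi, rfl⟩ := hγ.exists_hookBeta hm hj
    ((injective_remHook_iff hγ.1 j hm hj).2 hc)
  have h1 := frobChar_comp (psum_pow_isSymmetric (N := N) (2 ^ k))
    (hookBeta i (2 ^ k)) w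
  have h2 := betaDeg_hookBeta_odd k i hi
  rw [betaDeg, h1, Int.natAbs_mul, Int.natAbs_of_isUnit (Units.isUnit _), one_mul] at h
  exact h2 h

lemma frobChar_addHook_pickyPoly {k : ℕ} {γ : Fin N → ℕ} (hγ : Function.Injective γ)
    (hn : ∀ j, 2 ^ k ≤ γ j → ∃ l, γ l = γ j - 2 ^ k) {i : Fin N}
    (hi : Function.Injective (addHook γ i (2 ^ k))) (l : Fin N) (hl : l ≠ i)
    (hml : 2 ^ k ≤ addHook γ i (2 ^ k) l) :
    ¬ Function.Injective (remHook (addHook γ i (2 ^ k)) l (2 ^ k)) := by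
  have hm : 2 ^ k ≠ 0 := by positivity
  rw [addHook_of_ne _ hl] at hml
  obtain ⟨j, hj⟩ := hn l hml
  have hji : j ≠ i := by
    rintro rfl
    exact (injective_addHook_iff hγ j hm).1 hi l (by omega)
  refine not_injective_of_eq (j := j) ?_ ?_
  · rintro rfl
    omega
  · rw [addHook_of_ne _ hl, addHook_of_ne _ hji, hj]

lemma card_addable {n k : ℕ} {γ : Fin N → ℕ} (hγ : IsBeta n γ) (hN : n + 2 ^ k ≤ N)
    (hn : ∀ j, 2 ^ k ≤ γ j → ∃ l, γ l = γ j - 2 ^ k) :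
    (Finset.univ.filter fun i => Function.Injective (addHook γ i (2 ^ k))).card = 2 ^ k := by
  have hm : 2 ^ k ≠ 0 := by positivity
  have h1 : (Finset.univ.filter fun i => ¬ Function.Injective (addHook γ i (2 ^ k))).card
      = (Finset.univ.filter fun i => ¬ γ i < 2 ^ k).card := by
    choose! f hf using hn
    symm
    refine Finset.card_nbij f ?_ ?_ ?_
    · intro i hi
      simp only [Finset.coe_filter, Finset.mem_univ, true_and, not_lt, Set.mem_ofPred_eq] at hi ⊢
      rw [injective_addHook_iff hγ.1 _ hm]
      push Not
      exact ⟨i, by rw [hf i hi]; omega⟩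
    · intro i hi j hj hij
      simp only [Finset.coe_filter, Finset.mem_univ, true_and, not_lt, Set.mem_ofPred_eq] at hi hj
      have h1 := hf i hi
      rw [hij, hf j hj] at h1
      exact hγ.1 (by omega)
    · intro i hi
      simp only [Finset.coe_filter, Finset.mem_univ, true_and, Set.mem_ofPred_eq,
        injective_addHook_iff hγ.1 _ hm] at hi
      push Not at hi
      obtain ⟨j, hj⟩ := hi
      have hj' : 2 ^ k ≤ γ j := by omega
      refine ⟨j, by simpa using hj', hγ.1 ?_⟩
      rw [hf j hj', hj]
      omega
  have h2 : (Finset.univ.filter fun i => γ i < 2 ^ k).card = 2 ^ k := by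
    rw [← Finset.card_range (2 ^ k)]
    refine Finset.card_nbij γ ?_ (hγ.1.injOn) ?_
    · intro i hi
      simpa using hi
    · intro r hr
      have hr' : r < 2 ^ k := by simpa using hr
      obtain ⟨j, hj⟩ := hγ.exists_eq (r := r) (by omega)
      exact ⟨j, by simpa [hj] using hr', hj⟩
  have h3 := Finset.card_filter_add_card_filter_not (s := Finset.univ)
    (fun i => Function.Injective (addHook γ i (2 ^ k)))
  have h4 := Finset.card_filter_add_card_filter_not (s := Finset.univ) (fun i => γ i < 2 ^ k)
  omega

lemma exists_pickyFamily_one {k : ℕ} (hN : 2 ^ (k + 1) ≤ N) :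
    ∃ M : Finset (Fin N → ℕ), IsPickyFamily (k + 1) 1 M := by
  classical
  rcases k with _ | k
  · exact ⟨∅, by simp, by simp, by simp [pickyCount]⟩
  set m := 2 ^ (k + 1) with hm
  have hm0 : m ≠ 0 := by positivity
  rw [pow_succ', ← hm] at hN
  set s := Finset.univ.filter fun i : Fin N => N ≤ i + m with hs
  let u : Fin N → ℤ := fun i => frobChar (hookBeta i m) (pickyPoly N (k + 1))
  have hu : ∀ i ∈ s, u i = 1 ∨ u i = -1 := fun i hi =>
    frobChar_hookBeta_pickyPoly (k + 1) i (Finset.mem_filter.1 hi).2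
  have hcard : s.card = m := card_hooks (by omega)
  have h4 := Finset.card_filter_add_card_filter_not (s := s) (fun i => u i = 1)
  have hsum : ∑ i ∈ s, u i = 0 := by
    rw [← sum_frobChar_hookBeta_pickyPoly (N := N) (k := k) (by omega)]
    refine Finset.sum_subset (Finset.subset_univ s) fun i _ hi => ?_
    refine frobChar_eq_zero_of_not_injective (pickyPoly_isSymmetric _) ?_
    rw [injective_hookBeta_iff _ hm0]
    simpa [hs] using hi
  have hsum' : ((s.filter fun i => u i = 1).card : ℤ) = (s.filter fun i => ¬ u i = 1).card := by
    rw [← Finset.sum_filter_add_sum_filter_not s (fun i => u i = 1),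
      Finset.sum_congr rfl (g := fun _ => (1 : ℤ)) (fun i hi => (Finset.mem_filter.1 hi).2),
      Finset.sum_congr (s₁ := s.filter fun i => ¬ u i = 1) rfl (g := fun _ => (-1 : ℤ))
        (fun i hi => (hu i (Finset.mem_filter.1 hi).1).resolve_left
          (Finset.mem_filter.1 hi).2)] at hsum
    simp at hsum
    omega
  have hp1 : (s.filter fun i => u i = 1).card = 2 ^ k := by
    rw [pow_succ] at hm; omega
  have hp2 : (s.filter fun i => ¬ u i = 1).card = 2 ^ k := by
    rw [pow_succ] at hm; omega
  let F : Fin N × Fin N → (Fin N → ℕ) := fun a => pairBeta a.1 a.2 m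
  have hmem : ∀ {a : Fin N × Fin N}, a ∈ s.offDiag → a.1 ≠ a.2 ∧ N ≤ a.1 + m ∧ N ≤ a.2 + m := by
    intro a ha
    obtain ⟨h1, h2, h3⟩ := Finset.mem_offDiag.1 ha
    exact ⟨h3, (Finset.mem_filter.1 h1).2, (Finset.mem_filter.1 h2).2⟩
  have hF : ∀ a ∈ s.offDiag, ∀ b ∈ s.offDiag, ∀ w : Equiv.Perm (Fin N), F a ∘ w = F b →
      a = b ∨ a = b.swap := by
    rintro ⟨i, j⟩ ha ⟨i', j'⟩ hb w h
    obtain ⟨hij, hi, hj⟩ := hmem ha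
    obtain ⟨hij', hi', hj'⟩ := hmem hb
    have key : ∀ l, l ≠ i → l ≠ j → l ≠ i' ∧ l ≠ j' := by
      intro l hl1 hl2
      have h1 : F (i', j') (w.symm l) = l := by
        rw [← h, Function.comp_apply, Equiv.apply_symm_apply]
        exact pairBeta_of_ne hl1 hl2 m
      constructor
      · rintro rfl
        exact pairBeta_apply_ne_left hij' hj' _ h1
      · rintro rfl
        refine pairBeta_apply_ne_left hij'.symm hi' (w.symm l) ?_
        rw [pairBeta_comm hij'.symm]
        exact h1
    simp only [Prod.swap_prod_mk, Prod.mk.injEq]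
    dsimp only at hij hij'
    have k1 := key i'
    have k2 := key j'
    simp only [ne_eq, not_true_eq_false, false_and, and_false] at k1 k2
    by_cases e1 : i' = i
    · subst e1
      by_cases e2 : j' = j
      · exact Or.inl ⟨rfl, e2.symm⟩
      · exact absurd e2 (k2 (Ne.symm hij'))
    · by_cases e2 : i' = j
      · subst e2
        by_cases e3 : j' = i
        · exact Or.inr ⟨e3.symm, rfl⟩
        · exact absurd (Ne.symm hij') (k2 e3)
      · exact absurd e2 (k1 e1)
  have hF' : ∀ a ∈ s.offDiag, ∀ b ∈ s.offDiag, F a = F b ↔ a = b ∨ a = b.swap := by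
    intro a ha b hb
    constructor
    · intro h
      exact hF a ha b hb 1 h
    · rintro (rfl | rfl)
      · rfl
      · exact pairBeta_comm (hmem ha).1 m
  refine ⟨_, ?_, ?_, (card_image_pairs s (fun i => u i = 1) hp1 hp2 F hF').trans rfl⟩
  · intro β hβ
    obtain ⟨⟨i, j⟩, ha, rfl⟩ := Finset.mem_image.1 hβ
    obtain ⟨ha, huij⟩ := Finset.mem_filter.1 ha
    obtain ⟨hij, hi, hj⟩ := hmem ha
    obtain ⟨his, hjs, -⟩ := Finset.mem_offDiag.1 ha
    dsimp only at hij hi hj huij his hjs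
    have hB := IsBeta.pairBeta hij hm0 hi hj
    have hdeg : betaDeg (2 * m) (pairBeta i j m) % 4 = 2 := by
      obtain ⟨R, hR⟩ := exists_psum_one_pow_succ (N := N) (k + 1)
      have h2 := frobChar_intCast_mul (pairBeta i j m) 4 R
      push_cast at h2
      rw [betaDeg, hm, ← pow_succ', hR, frobChar_add, ← hm, frobChar_pairBeta_psum_mul hij hi hj
        (MvPolynomial.psum_isSymmetric _ _ _), frobChar_hookBeta_psum hi,
        frobChar_hookBeta_psum hj, h2]
      omega
    rw [pow_succ', ← hm]
    refine ⟨hB, by intro h; rw [show F (i, j) = pairBeta i j m from rfl] at h; omega, ?_, ?_⟩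
    · show padicValNat 2 (betaDeg (2 * m) (pairBeta i j m)) = 1
      obtain ⟨c, hc⟩ : ∃ c, betaDeg (2 * m) (pairBeta i j m) = 2 * (2 * c + 1) :=
        ⟨betaDeg (2 * m) (pairBeta i j m) / 4, by omega⟩
      rw [hc, padicValNat.mul two_ne_zero (by omega), padicValNat_self,
        padicValNat.eq_zero_of_not_dvd (by omega)]
    · rw [pickyPoly, ← hm]
      have hv := frobChar_pairBeta_psum_mul hij hi hj (pickyPoly_isSymmetric (N := N) (k + 1))
      have hui : frobChar (hookBeta i m) (pickyPoly N (k + 1)) = u i := rfl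
      have huj : frobChar (hookBeta j m) (pickyPoly N (k + 1)) = u j := rfl
      rw [hui, huj] at hv
      rw [show F (i, j) = pairBeta i j m from rfl, hv]
      rcases hu i his with h | h
      · rw [h, huij.1 h]; norm_num
      · rw [h, (hu j hjs).resolve_left fun h' => by
          have := huij.2 h'
          omega]
        norm_num
  · intro β hβ γ hγ w h
    obtain ⟨a, ha, rfl⟩ := Finset.mem_image.1 hβ
    obtain ⟨b, hb, rfl⟩ := Finset.mem_image.1 hγ
    have ha' := (Finset.mem_filter.1 ha).1
    have hb' := (Finset.mem_filter.1 hb).1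
    exact (hF' a ha' b hb').2 (hF a ha' b hb' w h)

lemma exists_pickyFamily_succ {k a : ℕ} (hN : 2 ^ (k + 1) ≤ N) (ha : 1 ≤ a)
    {M : Finset (Fin N → ℕ)} (hM : IsPickyFamily k a M) :
    ∃ M' : Finset (Fin N → ℕ), IsPickyFamily (k + 1) (a + 1) M' := by
  classical
  obtain ⟨hM1, hM2, hM3⟩ := hM
  have hm : 2 ^ k ≠ 0 := by positivity
  have hn : ∀ γ ∈ M, ∀ j, 2 ^ k ≤ γ j → ∃ l, γ l = γ j - 2 ^ k := fun γ hγ =>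
    exists_eq_sub_of_even (hM1 γ hγ).1
      (dvd_of_one_le_padicValNat (by rw [(hM1 γ hγ).2.2.1]; exact ha))
  have hN' : 2 ^ k + 2 ^ k ≤ N := by rw [pow_succ] at hN; omega
  let A : (Fin N → ℕ) → Finset (Fin N) := fun γ =>
    Finset.univ.filter fun i => Function.Injective (addHook γ i (2 ^ k))
  have hA : ∀ {γ i}, i ∈ A γ → Function.Injective (addHook γ i (2 ^ k)) := fun h =>
    (Finset.mem_filter.1 h).2
  have key : ∀ γ ∈ M, ∀ i ∈ A γ, ∀ γ' ∈ M, ∀ i' ∈ A γ', ∀ w : Equiv.Perm (Fin N),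
      addHook γ i (2 ^ k) ∘ w = addHook γ' i' (2 ^ k) → γ = γ' ∧ i = i' := by
    intro γ hγ i hi γ' hγ' i' hi' w hw
    have h1 : remHook (addHook γ i (2 ^ k)) (w i') (2 ^ k) ∘ w = γ' := by
      rw [← remHook_comp, hw, remHook_addHook]
    have hwi : w i' = i := by
      by_contra hc
      have h2 : (addHook γ i (2 ^ k) ∘ w) i' = addHook γ i (2 ^ k) (w i') := rfl
      rw [hw, addHook_self] at h2
      refine frobChar_addHook_pickyPoly (hM1 γ hγ).1.1 (hn γ hγ) (hA hi) (w i') hc (by omega) ?_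
      rw [← Equiv.injective_comp w, h1]
      exact (hM1 γ' hγ').1.1
    rw [hwi, remHook_addHook] at h1
    have h3 := hM2 γ hγ γ' hγ' w h1
    refine ⟨h3, ?_⟩
    rw [← h3] at h1
    have h4 : w i' = i' := (hM1 γ hγ).1.1 (congrFun h1 i')
    rw [← hwi, h4]
  refine ⟨(M.sigma A).image fun p => addHook p.1 p.2 (2 ^ k), ?_, ?_, ?_⟩
  · intro β hβ
    obtain ⟨⟨γ, i⟩, hp, rfl⟩ := Finset.mem_image.1 hβ
    obtain ⟨hγ, hi⟩ := Finset.mem_sigma.1 hp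
    dsimp only at hγ hi ⊢
    obtain ⟨h1, h2, h3, h4⟩ := hM1 γ hγ
    have hb := h1.addHook (hA hi)
    have hv := padicValNat_betaDeg_addHook h1 (hn γ hγ) (hA hi) h2
    have hv1 := padicValNat_factorial_two_pow k
    have hv2 := padicValNat_factorial_two_pow (k + 1)
    have e : 2 ^ (k + 1) = 2 ^ k + 2 ^ k := by ring
    rw [e] at hv2 ⊢
    have hval : padicValNat 2 (betaDeg (2 ^ k + 2 ^ k) (addHook γ i (2 ^ k))) = a + 1 := by omega
    refine ⟨hb, ?_, hval, ?_⟩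
    · intro h0
      rw [h0, padicValNat_zero_right] at hval
      omega
    · rw [pickyPoly, frobChar_psum_mul_eq_sum _ (pickyPoly_isSymmetric k) {i}, Finset.sum_singleton,
        remHook_addHook]
      · exact h4
      · simp only [Finset.mem_singleton]
        rintro _ rfl
        rw [addHook_self]; omega
      · intro l hl hml
        exact frobChar_addHook_pickyPoly h1.1 (hn γ hγ) (hA hi) l (by simpa using hl) hml
  · intro β hβ γ hγ w h
    obtain ⟨⟨γ₁, i₁⟩, hp₁, rfl⟩ := Finset.mem_image.1 hβ
    obtain ⟨⟨γ₂, i₂⟩, hp₂, rfl⟩ := Finset.mem_image.1 hγ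
    rw [Finset.mem_sigma] at hp₁ hp₂
    obtain ⟨h1, h2⟩ := key γ₁ hp₁.1 i₁ hp₁.2 γ₂ hp₂.1 i₂ hp₂.2 w h
    dsimp only
    rw [h1, h2]
  · rw [Finset.card_image_of_injOn, Finset.card_sigma,
      Finset.sum_congr rfl (g := fun _ => 2 ^ k), Finset.sum_const, hM3, smul_eq_mul]
    · obtain ⟨b, rfl⟩ : ∃ b, a = b + 1 := ⟨a - 1, by omega⟩
      rw [mul_comm]
      rfl
    · intro γ hγ
      exact card_addable (hM1 γ hγ).1 hN' (hn γ hγ)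
    · rintro ⟨γ₁, i₁⟩ hp₁ ⟨γ₂, i₂⟩ hp₂ h
      have hp₁' := Finset.mem_sigma.1 hp₁
      have hp₂' := Finset.mem_sigma.1 hp₂
      obtain ⟨h1, h2⟩ := key γ₁ hp₁'.1 i₁ hp₁'.2 γ₂ hp₂'.1 i₂ hp₂'.2 1 h
      rw [h1, h2]

lemma exists_pickyFamily {k : ℕ} (hN : 2 ^ k ≤ N) (a : ℕ) :
    ∃ M : Finset (Fin N → ℕ), IsPickyFamily k (a + 1) M := by
  induction k generalizing a with
  | zero => exact ⟨∅, by simp, by simp, by simp [pickyCount]⟩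
  | succ k ih =>
    rcases a with _ | a
    · exact exists_pickyFamily_one hN
    · obtain ⟨M, hM⟩ := ih (by rw [pow_succ] at hN; omega) a
      exact exists_pickyFamily_succ hN (by omega) hM

end

open Equiv.Perm in
lemma cycleType_of_extends {α β : Type*} [Fintype α] [DecidableEq α] [Fintype β] [DecidableEq β]
    {j : α → β} (hj : Function.Injective j) {σ : Equiv.Perm α} {τ : Equiv.Perm β}
    (h1 : ∀ a, τ (j a) = j (σ a)) (h2 : ∀ b, b ∉ Set.range j → τ b = b) :
    τ.cycleType = σ.cycleType := by
  classical
  have h : τ = σ.extendDomain (Equiv.ofInjective j hj) := by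
    ext b
    by_cases hb : b ∈ Set.range j
    · obtain ⟨a, rfl⟩ := hb
      have := extendDomain_apply_image σ (Equiv.ofInjective j hj) a
      rw [Equiv.ofInjective_apply, Equiv.ofInjective_apply] at this
      rw [this, h1]
    · rw [h2 b hb, extendDomain_apply_not_subtype _ _ hb]
  rw [h]
  convert cycleType_extendDomain (Equiv.ofInjective j hj)

section

variable {α β : Type*} [Fintype α] [DecidableEq α] [Fintype β] [DecidableEq β]

/-- The lengths of all cycles of a permutation, fixed points included. -/
def cycleParts (σ : Equiv.Perm α) : Multiset ℕ :=
  σ.cycleType + Multiset.replicate (Fintype.card α - σ.cycleType.sum) 1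

lemma cycleParts_eq_iff {σ τ : Equiv.Perm α} : cycleParts σ = cycleParts τ ↔ IsConj σ τ := by
  rw [Equiv.Perm.partition_eq_of_isConj, Nat.Partition.ext_iff, Equiv.Perm.parts_partition,
    Equiv.Perm.parts_partition, ← Equiv.Perm.sum_cycleType, ← Equiv.Perm.sum_cycleType]
  rfl

lemma filter_cycleParts (σ : Equiv.Perm α) :
    (cycleParts σ).filter (fun n => 2 ≤ n) = σ.cycleType := by
  rw [← Equiv.Perm.filter_parts_partition_eq_cycleType, Equiv.Perm.parts_partition,
    ← Equiv.Perm.sum_cycleType]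
  rfl

lemma cycleType_sum_le (σ : Equiv.Perm α) : σ.cycleType.sum ≤ Fintype.card α := by
  rw [Equiv.Perm.sum_cycleType]
  exact Finset.card_le_univ _

lemma cycleParts_sum (σ : Equiv.Perm α) : (cycleParts σ).sum = Fintype.card α := by
  have := cycleType_sum_le σ
  rw [cycleParts, Multiset.sum_add, Multiset.sum_replicate, smul_eq_mul, mul_one]
  omega

lemma cycleParts_permCongr (e : α ≃ β) (σ : Equiv.Perm α) :
    cycleParts (e.permCongr σ) = cycleParts σ := by
  have : (e.permCongr σ).cycleType = σ.cycleType :=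
    cycleType_of_extends e.injective (fun a => by simp) fun b hb => (hb (e.surjective b)).elim
  rw [cycleParts, cycleParts, this, Fintype.card_congr e]

lemma cycleParts_sumCongr (σ : Equiv.Perm α) (τ : Equiv.Perm β) :
    cycleParts (Equiv.Perm.sumCongr σ τ) = cycleParts σ + cycleParts τ := by
  have h1 : (Equiv.Perm.sumCongr σ (1 : Equiv.Perm β)).cycleType = σ.cycleType :=
    cycleType_of_extends Sum.inl_injective (fun a => rfl) fun b hb => by
      rcases b with b | b
      · exact (hb ⟨b, rfl⟩).elim
      · rfl
  have h2 : (Equiv.Perm.sumCongr (1 : Equiv.Perm α) τ).cycleType = τ.cycleType :=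
    cycleType_of_extends Sum.inr_injective (fun a => rfl) fun b hb => by
      rcases b with b | b
      · rfl
      · exact (hb ⟨b, rfl⟩).elim
  have h3 : (Equiv.Perm.sumCongr σ τ).cycleType = σ.cycleType + τ.cycleType := by
    rw [← h1, ← h2, ← Equiv.Perm.Disjoint.cycleType_mul, Equiv.Perm.sumCongr_mul, one_mul, mul_one]
    rintro (a | b)
    · exact Or.inr rfl
    · exact Or.inl rfl
  have h4 := cycleType_sum_le σ
  have h5 := cycleType_sum_le τ
  rw [cycleParts, cycleParts, cycleParts, h3, Fintype.card_sum, Multiset.sum_add,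
    show Fintype.card α + Fintype.card β - (σ.cycleType.sum + τ.cycleType.sum) =
      (Fintype.card α - σ.cycleType.sum) + (Fintype.card β - τ.cycleType.sum) by omega,
    Multiset.replicate_add]
  abel

lemma sameCycle_of_cycleParts {σ : Equiv.Perm α} (h : cycleParts σ = {Fintype.card α}) (a b : α) :
    σ.SameCycle a b := by
  rcases le_or_gt 2 (Fintype.card α) with h2 | h2
  · have h1 : σ.cycleType = {Fintype.card α} := by
      rw [← filter_cycleParts, h, Multiset.filter_singleton, if_pos h2]
    have hc : σ.IsCycle := Equiv.Perm.card_cycleType_eq_one.1 (by rw [h1]; simp)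
    have hs : σ.support = Finset.univ := by
      rw [← Finset.card_eq_iff_eq_univ, ← Equiv.Perm.sum_cycleType, h1, Multiset.sum_singleton]
    exact hc.sameCycle (Equiv.Perm.mem_support.1 (hs ▸ Finset.mem_univ a))
      (Equiv.Perm.mem_support.1 (hs ▸ Finset.mem_univ b))
  · have := Fintype.card_le_one_iff_subsingleton.1 (Nat.lt_succ_iff.1 h2)
    rw [Subsingleton.elim a b]

lemma cycleParts_of_cycleType {σ : Equiv.Perm α} {n : ℕ} (hn : Fintype.card α = n)
    (h : σ.cycleType = {n}) : cycleParts σ = {n} := by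
  rw [cycleParts, h, Multiset.sum_singleton, hn]
  simp

end

lemma exists_cycleParts_eq_singleton (n : ℕ) (hn : n ≠ 0) :
    ∃ σ : Equiv.Perm (Fin n), cycleParts σ = {n} := by
  obtain ⟨n, rfl⟩ := Nat.exists_eq_succ_of_ne_zero hn
  rcases n with _ | n
  · exact ⟨1, by simp [cycleParts]⟩
  · exact ⟨finRotate (n + 2), cycleParts_of_cycleType (by simp) cycleType_finRotate⟩

/-- The cycle lengths of the elements under consideration: one fixed point and one cycle of length
`2 ^ i` for each `i < k`. -/
def pickyParts : ℕ → Multiset ℕ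
  | 0 => {1}
  | k + 1 => 2 ^ k ::ₘ pickyParts k

lemma pickyParts_sum (k : ℕ) : (pickyParts k).sum = 2 ^ k := by
  induction k with
  | zero => rfl
  | succ k ih => rw [pickyParts, Multiset.sum_cons, ih]; ring

lemma exists_cycleParts_eq_pickyParts (N k : ℕ) :
    ∃ σ : Equiv.Perm (Fin (2 ^ k)), cycleParts σ = pickyParts k ∧ permPoly N σ = pickyPoly N k := by
  induction k with
  | zero =>
    refine ⟨1, by simp [cycleParts, pickyParts], ?_⟩
    rw [permPoly_one, pickyPoly, Fintype.card_fin, pow_zero, pow_one]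
  | succ k ih =>
    obtain ⟨σ, h1, h2⟩ := ih
    obtain ⟨τ, h3⟩ := exists_cycleParts_eq_singleton (2 ^ k) (by positivity)
    let e : Fin (2 ^ k) ⊕ Fin (2 ^ k) ≃ Fin (2 ^ (k + 1)) :=
      Fintype.equivFinOfCardEq (by simp; ring)
    have : Nonempty (Fin (2 ^ k)) := ⟨⟨0, by positivity⟩⟩
    refine ⟨e.permCongr (Equiv.Perm.sumCongr τ σ), ?_, ?_⟩
    · rw [cycleParts_permCongr, cycleParts_sumCongr, h1, h3, pickyParts, Multiset.singleton_add]
    · rw [permPoly_conj]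
      refine (permPoly_sumCongr τ σ).trans ?_
      rw [h2, permPoly_of_sameCycle (sameCycle_of_cycleParts (by rw [h3, Fintype.card_fin])),
        pickyPoly, Fintype.card_fin]

lemma permPoly_of_cycleParts_eq (N : ℕ) {k : ℕ} {α : Type*} [Fintype α] [DecidableEq α]
    {x : Equiv.Perm α} (hx : cycleParts x = pickyParts k) : permPoly N x = pickyPoly N k := by
  obtain ⟨σ, h1, h2⟩ := exists_cycleParts_eq_pickyParts N k
  have hα : Fintype.card α = 2 ^ k := by rw [← cycleParts_sum x, hx, pickyParts_sum]
  let e : α ≃ Fin (2 ^ k) := Fintype.equivFinOfCardEq hα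
  obtain ⟨c, hc⟩ := isConj_iff.1 (cycleParts_eq_iff.1 ((cycleParts_permCongr e x).trans
    (hx.trans h1.symm)))
  rw [← h2, ← hc, ← permPoly_conj e x]
  exact (permPoly_conj c (e.permCongr x)).symm

lemma pickyParts_filter (k : ℕ) :
    let m := (pickyParts k).filter (fun n => 2 ≤ n)
    m.Nodup ∧ (∀ n ∈ m, n < 2 ^ k) ∧ (2 ^ k - m.sum).factorial * m.prod ≤ pickyCentralizer k ∧
      m.sum ≤ 2 ^ k := by
  intro m
  have key : ∀ k, let m := (pickyParts (k + 1)).filter (fun n => 2 ≤ n)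
      m.Nodup ∧ (∀ n ∈ m, n < 2 ^ (k + 1)) ∧ m.prod * 2 = pickyCentralizer (k + 1) ∧
        m.sum + 2 = 2 ^ (k + 1) := by
    intro k
    induction k with
    | zero =>
      have hm : (pickyParts 1).filter (fun n => 2 ≤ n) = 0 := by
        simp [pickyParts, Multiset.filter_eq_nil]
      intro m
      simp [m, hm, pickyCentralizer]
    | succ k ih =>
      intro m
      obtain ⟨h1, h2, h3, h4⟩ := ih
      have h5 : 2 ≤ 2 ^ (k + 1) := by rw [pow_succ]; have := Nat.one_le_two_pow (n := k); omega
      have hm : m = 2 ^ (k + 1) ::ₘ (pickyParts (k + 1)).filter (fun n => 2 ≤ n) := by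
        rw [← Multiset.filter_cons_of_pos _ h5]; rfl
      rw [hm]
      refine ⟨Multiset.nodup_cons.2 ⟨fun h => (h2 _ h).false, h1⟩, fun n hn => ?_, ?_, ?_⟩
      · rcases Multiset.mem_cons.1 hn with rfl | hn
        · exact Nat.pow_lt_pow_right one_lt_two (by omega)
        · exact (h2 n hn).trans (Nat.pow_lt_pow_right one_lt_two (by omega))
      · rw [Multiset.prod_cons, mul_assoc, h3]; rfl
      · rw [Multiset.sum_cons, add_assoc, h4, pow_succ 2 (k + 1)]; omega
  rcases k with _ | k
  · have hm : m = 0 := by simp only [m, pickyParts, Multiset.filter_singleton]; rfl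
    rw [hm]
    simp [pickyCentralizer]
  · obtain ⟨h1, h2, h3, h4⟩ := key k
    have h5 : m.sum + 2 = 2 ^ (k + 1) := h4
    refine ⟨h1, h2, ?_, h5 ▸ Nat.le_add_right _ _⟩
    have : 2 ^ (k + 1) - m.sum = 2 := by rw [← h5]; simp
    rw [this, ← h3, Nat.factorial_two, mul_comm]

lemma card_centralizer_eq {α : Type*} [Fintype α] [DecidableEq α] {x : Equiv.Perm α}
    (h : x.cycleType.Nodup) : Nat.card (Subgroup.centralizer {x}) =
      (Fintype.card α - x.cycleType.sum).factorial * x.cycleType.prod := by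
  rw [Equiv.Perm.nat_card_centralizer, Finset.prod_eq_one, mul_one]
  intro n hn
  rw [Multiset.count_eq_one_of_mem h (Multiset.mem_toFinset.1 hn), Nat.factorial_one]

lemma card_centralizer_le_pickyCentralizer {k : ℕ} {α : Type*} [Fintype α] [DecidableEq α]
    {x : Equiv.Perm α} (hx : cycleParts x = pickyParts k) :
    Nat.card (Subgroup.centralizer {x}) ≤ pickyCentralizer k := by
  have hα : Fintype.card α = 2 ^ k := by rw [← cycleParts_sum x, hx, pickyParts_sum]
  have h := pickyParts_filter k
  rw [← hx, filter_cycleParts] at h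
  rw [card_centralizer_eq h.1, hα]
  exact h.2.2.1

lemma card_centralizer_le_of_singleton {n : ℕ} (hn : 2 ≤ n) {α : Type*} [Fintype α]
    [DecidableEq α] {g : Equiv.Perm α} (hg : cycleParts g = {n}) :
    Nat.card (Subgroup.centralizer {g}) ≤ n := by
  have hα : Fintype.card α = n := by rw [← cycleParts_sum g, hg, Multiset.sum_singleton]
  have h1 : g.cycleType = {n} := by
    rw [← filter_cycleParts, hg, Multiset.filter_singleton, if_pos hn]
  rw [card_centralizer_eq (by rw [h1]; exact Multiset.nodup_singleton _), h1, hα]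
  simp

lemma pow_eq_one_of_singleton {n : ℕ} (hn : 2 ≤ n) {α : Type*} [Fintype α]
    [DecidableEq α] {g : Equiv.Perm α} (hg : cycleParts g = {n}) : g ^ n = 1 := by
  have h1 : g.cycleType = {n} := by
    rw [← filter_cycleParts, hg, Multiset.filter_singleton, if_pos hn]
  have h2 : orderOf g = n := by rw [← Equiv.Perm.lcm_cycleType, h1]; simp
  rw [← h2, pow_orderOf_eq_one]

lemma pickyParts_ne_singleton {k : ℕ} (hk : 1 ≤ k) (n : ℕ) : pickyParts k ≠ {n} := by
  obtain ⟨k, rfl⟩ := Nat.exists_eq_succ_of_ne_zero (by omega : k ≠ 0)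
  intro h
  have h2 : ∀ k, (pickyParts k).card = k + 1 := fun k => by
    induction k with
    | zero => rfl
    | succ k ih => rw [pickyParts, Multiset.card_cons, ih]
  have := congrArg Multiset.card h
  rw [h2, Multiset.card_singleton] at this
  omega

section

variable {N k : ℕ} {α : Type} [Fintype α] [DecidableEq α]

lemma specht_apply_eq_or {β : Fin N → ℕ} {σ : Equiv.Perm α} {Q : MvPolynomial (Fin N) ℤ}
    (hσ : permPoly N σ = Q) {z : ℤ} (h : frobChar β Q = z ∨ frobChar β Q = -z) :
    specht α β σ = z ∨ specht α β σ = -z := by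
  have h1 : frobClass α β σ = ((frobChar β Q : ℤ) : ℂ) := by rw [← hσ]; rfl
  rcases specht_eq_or (α := α) β with e | e <;> rcases h with h | h <;> rw [e] <;>
    simp [h1, h]

lemma charDeg_specht {β : Fin N → ℕ} (hβ : IsBeta (Fintype.card α) β) :
    charDeg (specht α β) = betaDeg (Fintype.card α) β := by
  have h1 := Irr_one (specht_mem_Irr (α := α) hβ.1 hβ.2)
  have h2 := specht_apply_eq_or (α := α) (permPoly_one (N := N) (α := α)) (β := β)
    (z := frobChar β (MvPolynomial.psum (Fin N) ℤ 1 ^ Fintype.card α)) (Or.inl rfl)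
  rw [h1] at h2
  rw [betaDeg]
  rcases h2 with h2 | h2
  · norm_cast at h2
    omega
  · norm_cast at h2
    omega

lemma pPart_charDeg_specht {β : Fin N → ℕ} (hβ : IsBeta (Fintype.card α) β) :
    pPart 2 (charDeg (specht α β)) = 2 ^ padicValNat 2 (betaDeg (Fintype.card α) β) := by
  rw [charDeg_specht hβ, pPart, Nat.factorization_def _ Nat.prime_two]

lemma exists_eq_of_comp_hookBeta {m : ℕ} {i j : Fin N} (hm : m ≠ 0) {w : Equiv.Perm (Fin N)}
    (h : hookBeta i m ∘ w = hookBeta j m) : i = j := by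
  by_contra hij
  have h1 := congrFun h i
  rw [Function.comp_apply, hookBeta, hookBeta, addHook, addHook, Function.update_of_ne hij] at h1
  by_cases hw : w i = i
  · rw [hw, Function.update_self] at h1
    omega
  · rw [Function.update_of_ne hw] at h1
    exact hw (Fin.ext h1)

theorem pickyTable_perm (hk : 1 ≤ k) {x g : Equiv.Perm α} (hx : cycleParts x = pickyParts k)
    (hg : cycleParts g = {2 ^ k}) : PickyTable (Equiv.Perm α) x g k := by
  classical
  have hα : Fintype.card α = 2 ^ k := by rw [← cycleParts_sum x, hx, pickyParts_sum]
  have h2 : 2 ≤ 2 ^ k := Nat.le_self_pow (by omega) 2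
  have hne : Nonempty α := Fintype.card_pos_iff.1 (by omega)
  have hm : 2 ^ k ≠ 0 := by positivity
  choose M hM using exists_pickyFamily (N := 2 ^ k) (k := k) le_rfl
  have hpx := permPoly_of_cycleParts_eq (2 ^ k) hx
  have hpg : permPoly (2 ^ k) g = MvPolynomial.psum (Fin (2 ^ k)) ℤ (2 ^ k) := by
    rw [permPoly_of_sameCycle (sameCycle_of_cycleParts (by rw [hg, hα])), hα]
  have hb : ∀ i : Fin (2 ^ k), IsBeta (Fintype.card α) (hookBeta i (2 ^ k)) := fun i => by
    rw [hα]; exact IsBeta.hookBeta hm (by omega)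
  have hb' : ∀ a, ∀ β ∈ M a, IsBeta (Fintype.card α) β := fun a β hβ => by
    rw [hα]; exact ((hM a).1 β hβ).1
  refine pickyTable_of_families hk (pow_eq_one_of_singleton h2 hg) ?_
    (card_centralizer_le_pickyCentralizer hx) (card_centralizer_le_of_singleton h2 hg)
    (fun a => match a with
      | 0 => Finset.univ.image fun i : Fin (2 ^ k) => specht α (hookBeta i (2 ^ k))
      | a + 1 => (M a).image (specht α)) ?_ ?_ ?_ ?_ ?_
  · rw [← cycleParts_eq_iff, hx, hg]
    exact pickyParts_ne_singleton hk _
  · rintro (_ | a) ψ hψ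
    · obtain ⟨i, -, rfl⟩ := Finset.mem_image.1 hψ
      refine ⟨specht_mem_Irr (hb i).1 (hb i).2, ?_⟩
      rw [pPart_charDeg_specht (hb i), hα,
        padicValNat.eq_zero_of_not_dvd (betaDeg_hookBeta_odd k i (by omega))]
    · obtain ⟨β, hβ, rfl⟩ := Finset.mem_image.1 hψ
      refine ⟨specht_mem_Irr (hb' a β hβ).1 (hb' a β hβ).2, ?_⟩
      rw [pPart_charDeg_specht (hb' a β hβ), hα, ((hM a).1 β hβ).2.2.1]
  · intro ψ hψ
    obtain ⟨i, -, rfl⟩ := Finset.mem_image.1 hψ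
    constructor
    · exact_mod_cast specht_apply_eq_or hpx (z := 1)
        (frobChar_hookBeta_pickyPoly k i (by omega))
    · exact_mod_cast specht_apply_eq_or hpg (z := 1)
        (Or.inl (frobChar_hookBeta_psum (by omega)))
  · intro a ψ hψ
    obtain ⟨β, hβ, rfl⟩ := Finset.mem_image.1 hψ
    exact_mod_cast specht_apply_eq_or hpx (z := 2) ((hM a).1 β hβ).2.2.2
  · show (Finset.univ.image fun i : Fin (2 ^ k) => specht α (hookBeta i (2 ^ k))).card = _
    rw [Finset.card_image_of_injective, Finset.card_univ, Fintype.card_fin]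
    intro i j hij
    obtain ⟨w, hw⟩ := exists_comp_eq_of_specht_eq (hb i).1 (hb i).2 hij
    exact exists_eq_of_comp_hookBeta hm hw
  · intro a
    show ((M a).image (specht α)).card = _
    rw [Finset.card_image_of_injOn, (hM a).2.2]
    intro β hβ γ hγ h
    obtain ⟨w, hw⟩ := exists_comp_eq_of_specht_eq (hb' a β hβ).1 (hb' a β hβ).2 h
    exact (hM a).2.1 β hβ γ hγ w hw

end

section

variable {A : Type} [Group A]

/-- A homomorphism to `{1, -1}`, as a complex function. -/
def signFun (l : A →* ℤˣ) (a : A) : ℂ := ((l a : ℤ) : ℂ)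

lemma signFun_eq_or (l : A →* ℤˣ) (a : A) : signFun l a = 1 ∨ signFun l a = -1 := by
  rcases Int.units_eq_one_or (l a) with h | h <;> simp [signFun, h]

lemma signFun_injective : Function.Injective (signFun (A := A)) := fun l m h => by
  ext a
  have := congrFun h a
  simpa [signFun] using this

lemma signFun_mem_Irr [Fintype A] (l : A →* ℤˣ) : signFun l ∈ Irr A := by
  let ρ : Representation ℂ A ℂ :=
    (Algebra.lmul ℂ ℂ : ℂ →* Module.End ℂ ℂ).comp
      (((Int.castRingHom ℂ : ℤ →* ℂ).comp (Units.coeHom ℤ)).comp l)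
  have hρ : ρ.character = signFun l := by
    ext a
    have : ρ a = ((l a : ℤ) : ℂ) • LinearMap.id := by
      ext; simp [ρ]
    rw [Representation.character, this, map_smul, LinearMap.trace_id]
    simp [signFun]
  rw [← hρ]
  refine Irr_of_charInner_self ρ ?_
  rw [hρ, charInner, Finset.sum_congr rfl (g := fun _ => (1 : ℂ)) fun a _ => ?_]
  · simp
  · rw [signFun, signFun, map_inv, ← Int.cast_mul, ← Units.val_mul, mul_inv_cancel]
    simp

lemma charDeg_signFun [Fintype A] (l : A →* ℤˣ) : charDeg (signFun l) = 1 := by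
  have := Irr_one (signFun_mem_Irr l)
  rw [signFun, map_one, Units.val_one, Int.cast_one] at this
  exact_mod_cast this.symm

end

/-- `G` is a wreath product of `A` with the group of order two generated by `s`. -/
structure IsWreathProduct {A G : Type} [Group A] [Group G] (i : A × A →* G) (s : G) : Prop where
  injective : Function.Injective i
  mul_self : s * s = 1
  swap : ∀ p, s * i p = i p.swap * s
  ne : ∀ p, i p ≠ s
  cover : ∀ y, (∃ p, y = i p) ∨ ∃ p, y = i p * s

namespace IsWreathProduct

variable {A G : Type} [Group A] [Group G] {i : A × A →* G} {s : G}

lemma notMem_range (h : IsWreathProduct i s) (p : A × A) : i p * s ∉ Set.range i := by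
  rintro ⟨q, hq⟩
  refine h.ne (p⁻¹ * q) ?_
  rw [map_mul, hq, map_inv, inv_mul_cancel_left]

lemma natCard (h : IsWreathProduct i s) [Finite A] :
    Nat.card G = 2 * (Nat.card A * Nat.card A) := by
  let e : (A × A) ⊕ (A × A) → G := Sum.elim i fun p => i p * s
  have he : Function.Bijective e := by
    constructor
    · rintro (p | p) (q | q) hpq
      · exact congrArg _ (h.injective hpq)
      · exact (h.notMem_range q ⟨p, hpq⟩).elim
      · exact (h.notMem_range p ⟨q, hpq.symm⟩).elim
      · exact congrArg _ (h.injective (mul_right_cancel hpq))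
    · intro y
      rcases h.cover y with ⟨p, rfl⟩ | ⟨p, rfl⟩
      · exact ⟨Sum.inl p, rfl⟩
      · exact ⟨Sum.inr p, rfl⟩
  rw [← Nat.card_congr (Equiv.ofBijective e he), Nat.card_sum, Nat.card_prod, two_mul]

lemma exists_extension (h : IsWreathProduct i s) (m : ℤˣ) (l : A →* ℤˣ) :
    ∃ φ : G →* ℤˣ, (∀ p, φ (i p) = l p.1 * l p.2) ∧ φ s = m := by
  classical
  obtain ⟨f, hf0⟩ : ∃ f : A × A → ℤˣ, ∀ p, f p = l p.1 * l p.2 := ⟨_, fun _ => rfl⟩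
  have hf : ∀ p q, f (p * q) = f p * f q := fun p q => by
    simp only [hf0, Prod.fst_mul, Prod.snd_mul, map_mul, mul_mul_mul_comm]
  have hf' : ∀ p : A × A, f p.swap = f p := fun p => by
    simp only [hf0, Prod.fst_swap, Prod.snd_swap, mul_comm]
  obtain ⟨F, h1, h2⟩ : ∃ F : G → ℤˣ, (∀ p, F (i p) = f p) ∧ ∀ p, F (i p * s) = m * f p := by
    refine ⟨fun y => if y ∈ Set.range i then f (Function.invFun i y) else
      m * f (Function.invFun i (y * s)), fun p => ?_, fun p => ?_⟩
    · simp only [Set.mem_range_self, if_true, Function.leftInverse_invFun h.injective p]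
    · simp only [if_neg (h.notMem_range p), mul_assoc, h.mul_self, mul_one,
        Function.leftInverse_invFun h.injective p]
  refine ⟨MonoidHom.mk' F fun y z => ?_, fun p => (h1 p).trans (hf0 p), ?_⟩
  · rcases h.cover y with ⟨p, rfl⟩ | ⟨p, rfl⟩ <;> rcases h.cover z with ⟨q, rfl⟩ | ⟨q, rfl⟩
    · rw [← map_mul, h1, h1, h1, hf]
    · rw [← mul_assoc, ← map_mul, h2, h2, h1, hf, mul_left_comm]
    · rw [mul_assoc, h.swap, ← mul_assoc, ← map_mul, h2, h2, h1, hf, hf', mul_assoc]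
    · rw [mul_assoc, ← mul_assoc s, h.swap, mul_assoc, h.mul_self, mul_one, ← map_mul, h1, h2, h2,
        hf, hf', mul_mul_mul_comm, Int.units_mul_self, one_mul]
  · have h3 := h2 1
    rwa [map_one, one_mul, hf0, Prod.fst_one, Prod.snd_one, map_one, mul_one, mul_one] at h3

lemma exists_homs (h : IsWreathProduct i s) (L : Finset (A →* ℤˣ)) :
    ∃ L' : Finset (G →* ℤˣ), L'.card = 2 * L.card := by
  classical
  choose φ h1 h2 using fun a : ℤˣ × (A →* ℤˣ) => h.exists_extension a.1 a.2
  refine ⟨(Finset.univ ×ˢ L).image φ, ?_⟩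
  rw [Finset.card_image_of_injective, Finset.card_product, Finset.card_univ]
  · rfl
  · rintro a b heq
    refine Prod.ext ?_ ?_
    · rw [← h2 a, ← h2 b, heq]
    · ext c
      have h3 := h1 a (c, 1)
      rw [heq, h1 b] at h3
      simp only [map_one, mul_one] at h3
      rw [h3]

/-- The function induced from the product of two functions on the factors of the base group. -/
def induced (i : A × A →* G) (f f' : A → ℂ) : G → ℂ :=
  Function.extend i (fun p => f p.1 * f' p.2 + f p.2 * f' p.1) 0

lemma induced_apply (h : IsWreathProduct i s) (f f' : A → ℂ) (p : A × A) :
    induced i f f' (i p) = f p.1 * f' p.2 + f p.2 * f' p.1 :=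
  h.injective.extend_apply _ _ _

lemma induced_apply_of_notMem (f f' : A → ℂ) {y : G} (hy : y ∉ Set.range i) :
    induced i f f' y = 0 :=
  Function.extend_apply' _ _ _ hy

lemma isClassFun_induced (h : IsWreathProduct i s) {f f' : A → ℂ} (hf : IsClassFun f)
    (hf' : IsClassFun f') : IsClassFun (induced i f f') := by
  have hs : s⁻¹ = s := inv_eq_of_mul_eq_one_left h.mul_self
  have hconj : ∀ p y, ∃ q, y * i p * y⁻¹ = i q ∧
      f q.1 * f' q.2 + f q.2 * f' q.1 = f p.1 * f' p.2 + f p.2 * f' p.1 := fun p y => by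
    rcases h.cover y with ⟨q, rfl⟩ | ⟨q, rfl⟩
    · refine ⟨q * p * q⁻¹, by simp only [map_mul, map_inv], ?_⟩
      simp only [Prod.fst_mul, Prod.snd_mul, Prod.fst_inv, Prod.snd_inv, hf _ _, hf' _ _]
    · refine ⟨q * p.swap * q⁻¹, ?_, ?_⟩
      · rw [mul_assoc (i q), h.swap, mul_inv_rev, hs, map_mul, map_mul, map_inv]
        simp only [mul_assoc]
        rw [← mul_assoc s s, h.mul_self, one_mul]
      · simp only [Prod.fst_mul, Prod.snd_mul, Prod.fst_inv, Prod.snd_inv, hf _ _, hf' _ _,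
          Prod.fst_swap, Prod.snd_swap]
        ring
  intro y z
  by_cases hy : y ∈ Set.range i
  · obtain ⟨p, rfl⟩ := hy
    obtain ⟨q, hq, hq'⟩ := hconj p z
    rw [hq, h.induced_apply, h.induced_apply, hq']
  · rw [induced_apply_of_notMem _ _ hy, induced_apply_of_notMem]
    rintro ⟨p, hp⟩
    obtain ⟨q, hq, -⟩ := hconj p z⁻¹
    refine hy ⟨q, ?_⟩
    rw [← hq, hp]
    group

variable [Fintype A] [Fintype G]

lemma charInner_induced (h : IsWreathProduct i s) (f f' : A → ℂ) {χ : G → ℂ} (hχ : IsClassFun χ) :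
    charInner (induced i f f') χ = charInner (fun p : A × A => f p.1 * f' p.2) (χ ∘ i) := by
  classical
  have hs : s⁻¹ = s := inv_eq_of_mul_eq_one_left h.mul_self
  have hswap : ∀ p : A × A, χ (i p.swap)⁻¹ = χ (i p)⁻¹ := fun p => by
    rw [← hχ (i p)⁻¹ s, hs, ← map_inv, ← map_inv, h.swap, mul_assoc, h.mul_self, mul_one]
    rfl
  have h1 : ∑ y, induced i f f' y * χ y⁻¹ =
      ∑ p : A × A, (f p.1 * f' p.2 + f p.2 * f' p.1) * χ (i p)⁻¹ := by
    refine (Fintype.sum_of_injective i h.injective _ _ (fun y hy => ?_) fun p => ?_).symm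
    · rw [induced_apply_of_notMem _ _ hy, zero_mul]
    · rw [h.induced_apply]
  have h2 : ∑ p : A × A, f p.2 * f' p.1 * χ (i p)⁻¹ = ∑ p : A × A, f p.1 * f' p.2 * χ (i p)⁻¹ := by
    rw [← Equiv.sum_comp (Equiv.prodComm A A)]
    refine Finset.sum_congr rfl fun p _ => ?_
    rw [Equiv.prodComm_apply, hswap]
    rfl
  simp only [charInner, h1, add_mul, Finset.sum_add_distrib, h2, h.natCard, Nat.card_prod,
    Function.comp_apply, map_inv]
  have : (Nat.card A : ℂ) ≠ 0 := natCard_ne_zero_complex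
  push_cast
  field_simp
  ring

lemma charInner_mul (f f' g g' : A → ℂ) :
    charInner (fun p : A × A => f p.1 * f' p.2) (fun p => g p.1 * g' p.2) =
      charInner f g * charInner f' g' := by
  simp only [charInner, Nat.card_prod, Fintype.sum_prod_type, Prod.fst_inv, Prod.snd_inv]
  rw [mul_mul_mul_comm, Finset.sum_mul_sum, Nat.cast_mul, mul_inv]
  congr 1
  refine Finset.sum_congr rfl fun a _ => Finset.sum_congr rfl fun b _ => by ring

lemma charInner_induced_induced (h : IsWreathProduct i s) {f f' g g' : A → ℂ} (hg : IsClassFun g)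
    (hg' : IsClassFun g') : charInner (induced i f f') (induced i g g') =
      charInner f g * charInner f' g' + charInner f g' * charInner f' g := by
  rw [h.charInner_induced f f' (h.isClassFun_induced hg hg'), ← charInner_mul, ← charInner_mul,
    charInner, charInner, charInner, ← mul_add, ← Finset.sum_add_distrib]
  congr 1
  refine Finset.sum_congr rfl fun p _ => ?_
  rw [Function.comp_apply, h.induced_apply]
  ring

lemma exists_int_charInner_induced (h : IsWreathProduct i s) {f f' : A → ℂ} (hf : f ∈ Irr A)
    (hf' : f' ∈ Irr A) {χ : G → ℂ} (hχ : χ ∈ Irr G) :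
    ∃ z : ℤ, charInner (induced i f f') χ = z := by
  rw [h.charInner_induced f f' (Irr_isClassFun hχ)]
  obtain ⟨V, -, rfl⟩ := hf
  obtain ⟨V', -, rfl⟩ := hf'
  obtain ⟨W, -, rfl⟩ := hχ
  let ρ : Representation ℂ (A × A) V := V.ρ.comp (MonoidHom.fst A A)
  let ρ' : Representation ℂ (A × A) V' := V'.ρ.comp (MonoidHom.snd A A)
  let σ : Representation ℂ (A × A) W := W.ρ.comp i
  have h1 : (ρ.tprod ρ').character = fun p : A × A => V.character p.1 * V'.character p.2 := by
    rw [Representation.char_tensor]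
    rfl
  have h2 : σ.character = W.character ∘ i := rfl
  rw [← h1, ← h2]
  exact ⟨_, (charInner_character σ (ρ.tprod ρ')).trans (Int.cast_natCast _).symm⟩

lemma induced_one (h : IsWreathProduct i s) (f f' : A → ℂ) :
    induced i f f' 1 = 2 * (f 1 * f' 1) := by
  rw [← map_one i, h.induced_apply, Prod.fst_one, Prod.snd_one]
  ring

lemma induced_mem_Irr (h : IsWreathProduct i s) {f f' : A → ℂ} (hf : f ∈ Irr A) (hf' : f' ∈ Irr A)
    (hne : f ≠ f') : induced i f f' ∈ Irr G := by
  have hc := Irr_isClassFun hf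
  have hc' := Irr_isClassFun hf'
  have h1 : charInner (induced i f f') (induced i f f') = 1 := by
    rw [h.charInner_induced_induced hc hc', charInner_Irr_self hf, charInner_Irr_self hf',
      charInner_Irr_ne hf hf' hne]
    ring
  refine (Irr_or_neg_of_norm_one (h.isClassFun_induced hc hc')
    (fun χ hχ => h.exists_int_charInner_induced hf hf' hχ) h1).resolve_right fun hneg => ?_
  have h2 := Irr_one hneg
  rw [Pi.neg_apply, h.induced_one, Irr_one hf, Irr_one hf'] at h2
  have h3 : -(2 * ((charDeg f : ℤ) * charDeg f')) = charDeg (-induced i f f') := by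
      exact_mod_cast h2
  have h4 : 0 < (charDeg f : ℤ) * charDeg f' := by
    have := Nat.pos_of_ne_zero (charDeg_ne_zero hf)
    have := Nat.pos_of_ne_zero (charDeg_ne_zero hf')
    positivity
  omega

lemma charDeg_induced (h : IsWreathProduct i s) {f f' : A → ℂ} (hf : f ∈ Irr A) (hf' : f' ∈ Irr A)
    (hne : f ≠ f') : charDeg (induced i f f') = 2 * (charDeg f * charDeg f') := by
  have h1 := Irr_one (h.induced_mem_Irr hf hf' hne)
  rw [h.induced_one, Irr_one hf, Irr_one hf'] at h1
  exact_mod_cast h1.symm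

lemma induced_eq_iff (h : IsWreathProduct i s) {f f' g g' : A → ℂ} (hf : f ∈ Irr A)
    (hf' : f' ∈ Irr A) (hne : f ≠ f') (hg : g ∈ Irr A) (hg' : g' ∈ Irr A) :
    induced i f f' = induced i g g' ↔ (f = g ∧ f' = g') ∨ (f = g' ∧ f' = g) := by
  classical
  constructor
  · intro heq
    have h1 := charInner_Irr_self (h.induced_mem_Irr hf hf' hne)
    nth_rw 2 [heq] at h1
    rw [h.charInner_induced_induced (Irr_isClassFun hg) (Irr_isClassFun hg'), charInner_Irr hf hg,
      charInner_Irr hf' hg', charInner_Irr hf hg', charInner_Irr hf' hg] at h1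
    by_contra hc
    push Not at hc
    split_ifs at h1 <;> simp_all
  · rintro (⟨rfl, rfl⟩ | ⟨rfl, rfl⟩)
    · rfl
    · unfold induced
      congr 1
      ext p
      ring

end IsWreathProduct

theorem IsWreathProduct.pickyTable {A G : Type} [Group A] [Group G] [Finite A] [Finite G]
    {i : A × A →* G} {s : G} (h : IsWreathProduct i s) {k : ℕ} (hk : 1 ≤ k)
    {L : Finset (A →* ℤˣ)} (hL : L.card = 2 ^ k) {x g : A} (hT : PickyTable A x g k)
    {x' g' : G} (hx' : x' = i (g, x)) (hgk : g' ^ 2 ^ (k + 1) = 1) (hxg : ¬ IsConj x' g')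
    (hcx : Nat.card (Subgroup.centralizer {x'}) ≤ pickyCentralizer (k + 1))
    (hcg : Nat.card (Subgroup.centralizer {g'}) ≤ 2 ^ (k + 1)) : PickyTable G x' g' (k + 1) := by
  classical
  have := Fintype.ofFinite A
  have := Fintype.ofFinite G
  obtain ⟨Ψ, hdeg, h0, h1, hc0, hhalf, hc1, -, hodd⟩ := hT
  have hΨ0 : L.image signFun = Ψ 0 := by
    refine Finset.eq_of_subset_of_card_le (fun ψ hψ => ?_) ?_
    · obtain ⟨l, -, rfl⟩ := Finset.mem_image.1 hψ
      refine hodd _ (signFun_mem_Irr l) ?_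
      rw [charDeg_signFun]
      decide
    · rw [Finset.card_image_of_injective _ signFun_injective, hL, hc0]
  have hdeg0 : ∀ ψ ∈ Ψ 0, charDeg ψ = 1 := fun ψ hψ => by
    rw [← hΨ0] at hψ
    obtain ⟨l, -, rfl⟩ := Finset.mem_image.1 hψ
    exact charDeg_signFun l
  have hI : ∀ {a ψ}, ψ ∈ Ψ a → ψ ∈ Irr A := fun hψ => (hdeg _ _ hψ).1
  have hg0 : ∀ ψ ∈ Ψ 0, ψ g ≠ 0 := fun ψ hψ => by
    rcases (h0 ψ hψ).2 with h | h <;> rw [h] <;> simp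
  have hne : ∀ {a}, ∀ l ∈ Ψ 0, ∀ ψ ∈ Ψ (a + 1), l ≠ ψ := by
    rintro a l hl ψ hψ rfl
    exact hg0 l hl (h1 a l hψ).2
  have hpPart : ∀ n, n ≠ 0 → pPart 2 (2 * n) = 2 * pPart 2 n := fun n hn => by
    rw [pPart, pPart, Nat.factorization_mul two_ne_zero hn, Finsupp.add_apply,
      Nat.Prime.factorization_self Nat.prime_two, pow_add, pow_one]
  obtain ⟨L', hL'⟩ := h.exists_homs L
  have hp : (Ψ 0).card = 2 ^ (k - 1) + 2 ^ (k - 1) := by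
    rw [hc0, ← two_mul, ← pow_succ', Nat.sub_add_cancel hk]
  have hhalf1 : ((Ψ 0).filter fun ψ => ψ x = ψ g).card = 2 ^ (k - 1) := by
    rw [← hhalf, ← Nat.card_eq_finsetCard]
    exact Nat.card_congr (Equiv.subtypeEquivRight fun ψ => by simp)
  have hhalf2 : ((Ψ 0).filter fun ψ => ¬ ψ x = ψ g).card = 2 ^ (k - 1) := by
    have := Finset.card_filter_add_card_filter_not (s := Ψ 0) (fun ψ => ψ x = ψ g)
    omega
  let F : (A → ℂ) × (A → ℂ) → G → ℂ := fun a => induced i a.1 a.2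
  have hFx : ∀ a, F a x' = a.1 g * a.2 x + a.1 x * a.2 g := fun a => by
    rw [hx']; exact h.induced_apply _ _ _
  refine pickyTable_of_families (by omega) hgk hxg hcx hcg (fun a => match a with
    | 0 => L'.image signFun
    | 1 => ((Ψ 0).offDiag.filter fun a => a.1 x = a.1 g ↔ a.2 x = a.2 g).image F
    | a + 2 => (Ψ 0 ×ˢ Ψ (a + 1)).image F) ?_ ?_ ?_ ?_ ?_
  · rintro (_ | _ | a) ψ hψ
    · obtain ⟨l, -, rfl⟩ := Finset.mem_image.1 hψ
      refine ⟨signFun_mem_Irr l, ?_⟩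
      rw [charDeg_signFun]
      simp [pPart]
    · obtain ⟨⟨l, m⟩, hlm, rfl⟩ := Finset.mem_image.1 hψ
      obtain ⟨hl, hm, hlm⟩ := Finset.mem_offDiag.1 (Finset.mem_filter.1 hlm).1
      refine ⟨h.induced_mem_Irr (hI hl) (hI hm) hlm, ?_⟩
      rw [h.charDeg_induced (hI hl) (hI hm) hlm, hdeg0 _ hl, hdeg0 _ hm, hpPart _ (by simp)]
      simp [pPart]
    · obtain ⟨⟨l, m⟩, hlm, rfl⟩ := Finset.mem_image.1 hψ
      obtain ⟨hl, hm⟩ := Finset.mem_product.1 hlm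
      refine ⟨h.induced_mem_Irr (hI hl) (hI hm) (hne _ hl _ hm), ?_⟩
      rw [h.charDeg_induced (hI hl) (hI hm) (hne _ hl _ hm), hdeg0 _ hl, one_mul,
        hpPart _ (charDeg_ne_zero (hI hm)), (hdeg _ _ hm).2, ← pow_succ']
  · intro ψ hψ
    obtain ⟨l, -, rfl⟩ := Finset.mem_image.1 hψ
    exact ⟨signFun_eq_or l _, signFun_eq_or l _⟩
  · rintro (_ | a) ψ hψ
    · obtain ⟨⟨l, m⟩, hlm, rfl⟩ := Finset.mem_image.1 hψ
      obtain ⟨hlm, hP⟩ := Finset.mem_filter.1 hlm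
      obtain ⟨hl, hm, -⟩ := Finset.mem_offDiag.1 hlm
      obtain ⟨h2, h3⟩ := h0 _ hl
      obtain ⟨h4, h5⟩ := h0 _ hm
      simp only at h2 h3 h4 h5 hP
      rw [hFx]
      rcases h2 with h2 | h2 <;> rcases h3 with h3 | h3 <;> rcases h4 with h4 | h4 <;>
        rcases h5 with h5 | h5 <;> simp only [h2, h3, h4, h5] at hP ⊢ <;>
        first | (norm_num; done) | norm_num at hP
    · obtain ⟨⟨l, m⟩, hlm, rfl⟩ := Finset.mem_image.1 hψ
      obtain ⟨hl, hm⟩ := Finset.mem_product.1 hlm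
      obtain ⟨-, h3⟩ := h0 _ hl
      obtain ⟨h4, h5⟩ := h1 _ _ hm
      simp only at h3 h4 h5
      rw [hFx]
      rcases h3 with h3 | h3 <;> rcases h4 with h4 | h4 <;> simp only [h3, h4, h5] <;> norm_num
  · show (L'.image signFun).card = _
    rw [Finset.card_image_of_injective _ signFun_injective, hL', hL, pow_succ']
  · rintro (_ | a)
    · refine card_image_pairs (Ψ 0) (fun ψ => ψ x = ψ g) hhalf1 hhalf2 F ?_
      rintro ⟨l, m⟩ ha ⟨l', m'⟩ hb
      obtain ⟨hl, hm, hlm⟩ := Finset.mem_offDiag.1 ha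
      obtain ⟨hl', hm', -⟩ := Finset.mem_offDiag.1 hb
      simp only [Prod.swap_prod_mk, Prod.mk.injEq]
      exact h.induced_eq_iff (hI hl) (hI hm) hlm (hI hl') (hI hm')
    · show ((Ψ 0 ×ˢ Ψ (a + 1)).image F).card = 2 ^ k * pickyCount k (a + 1)
      rw [Finset.card_image_of_injOn, Finset.card_product, hc0, hc1]
      rintro ⟨l, m⟩ ha ⟨l', m'⟩ hb heq
      obtain ⟨hl, hm⟩ := Finset.mem_product.1 ha
      obtain ⟨hl', hm'⟩ := Finset.mem_product.1 hb
      rcases (h.induced_eq_iff (hI hl) (hI hm) (hne _ hl _ hm) (hI hl') (hI hm')).1 heq with e | e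
      · exact Prod.ext e.1 e.2
      · exact (hne _ hl _ hm' e.1).elim

section Transport

lemma Irr_comp_mulEquiv {G H : Type} [Group G] [Group H] [Finite G] [Finite H] (e : H ≃* G)
    {χ : G → ℂ} (hχ : χ ∈ Irr G) : χ ∘ e ∈ Irr H := by
  have := Fintype.ofFinite G
  have := Fintype.ofFinite H
  have h1 := charInner_Irr_self hχ
  obtain ⟨V, -, rfl⟩ := hχ
  let ρ : Representation ℂ H V := V.ρ.comp e.toMonoidHom
  refine Irr_of_charInner_self ρ ?_
  rw [← h1, charInner, charInner, Nat.card_congr e.toEquiv, ← Equiv.sum_comp e.toEquiv]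
  congr 1
  refine Finset.sum_congr rfl fun a _ => ?_
  simp only [Representation.character, FDRep.character, ρ, MonoidHom.comp_apply, map_inv]
  rfl

lemma charDeg_comp_mulEquiv {G H : Type} [Group G] [Group H] (e : H ≃* G) (χ : G → ℂ) :
    charDeg (χ ∘ e) = charDeg χ := by
  rw [charDeg, charDeg, Function.comp_apply, map_one]

lemma PickyTable.of_mulEquiv {G H : Type} [Group G] [Group H] [Finite G] [Finite H] (e : H ≃* G)
    {x g : H} {k : ℕ} (h : PickyTable G (e x) (e g) k) : PickyTable H x g k := by
  classical
  obtain ⟨Ψ, hdeg, h0, h1, hc0, hhalf, hc1, hall, hodd⟩ := h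
  have hinj : Function.Injective fun χ : G → ℂ => χ ∘ e := e.surjective.injective_comp_right
  have hmem : ∀ {a} {χ : G → ℂ}, χ ∘ e ∈ (Ψ a).image (fun χ => χ ∘ e) ↔ χ ∈ Ψ a := fun {a χ} =>
    Finset.mem_image.trans ⟨fun ⟨χ', h1, h2⟩ => hinj h2 ▸ h1, fun h => ⟨χ, h, rfl⟩⟩
  have hψ : ∀ ψ : H → ℂ, ψ = (ψ ∘ e.symm) ∘ e := fun ψ => by ext y; simp
  refine ⟨fun a => (Ψ a).image fun χ => χ ∘ e, ?_, ?_, ?_, ?_, ?_, ?_, ?_, ?_⟩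
  · intro a ψ hψ
    obtain ⟨χ, hχ, rfl⟩ := Finset.mem_image.1 hψ
    exact ⟨Irr_comp_mulEquiv e (hdeg a χ hχ).1, by rw [charDeg_comp_mulEquiv, (hdeg a χ hχ).2]⟩
  · intro ψ hψ
    obtain ⟨χ, hχ, rfl⟩ := Finset.mem_image.1 hψ
    exact h0 χ hχ
  · intro a ψ hψ
    obtain ⟨χ, hχ, rfl⟩ := Finset.mem_image.1 hψ
    exact h1 a χ hχ
  · rw [Finset.card_image_of_injective _ hinj, hc0]
  · rw [← hhalf]
    refine (Nat.card_congr (Equiv.ofBijective (fun χ => ⟨χ.1 ∘ e, hmem.2 χ.2.1, χ.2.2⟩)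
      ⟨fun χ χ' h => Subtype.ext (hinj (congrArg Subtype.val h)), fun ψ => ?_⟩)).symm
    obtain ⟨ψ, h2, h3⟩ := ψ
    obtain ⟨χ, hχ, rfl⟩ := Finset.mem_image.1 h2
    exact ⟨⟨χ, hχ, h3⟩, rfl⟩
  · intro a
    rw [Finset.card_image_of_injective _ hinj, hc1]
  · intro ψ h2 h3
    obtain ⟨a, ha⟩ := hall _ (Irr_comp_mulEquiv e.symm h2) (by simpa using h3)
    exact ⟨a, by rw [hψ ψ]; exact hmem.2 ha⟩
  · intro ψ h2 h3
    rw [hψ ψ]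
    exact hmem.2 (hodd _ (Irr_comp_mulEquiv e.symm h2) (by rwa [charDeg_comp_mulEquiv]))

lemma card_centralizer_le_of_injective {G H : Type*} [Group G] [Group H] [Finite H] (f : G →* H)
    (hf : Function.Injective f) (x : G) :
    Nat.card (Subgroup.centralizer {x}) ≤ Nat.card (Subgroup.centralizer {f x}) := by
  refine Nat.card_le_card_of_injective (fun y => ⟨f y.1, ?_⟩)
    fun y z hyz => Subtype.ext (hf (congrArg Subtype.val hyz))
  have := Subgroup.mem_centralizer_singleton_iff.1 y.2
  rw [Subgroup.mem_centralizer_singleton_iff, ← map_mul, ← map_mul, this]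

end Transport

section CycleParts

variable {α : Type*} [Fintype α] [DecidableEq α]

lemma one_le_of_mem_cycleParts {σ : Equiv.Perm α} {n : ℕ} (h : n ∈ cycleParts σ) : 1 ≤ n := by
  rcases Multiset.mem_add.1 h with h | h
  · exact one_le_two.trans (Equiv.Perm.two_le_of_mem_cycleType h)
  · exact (Multiset.eq_of_mem_replicate h).ge

lemma cycleParts_eq_singleton_of_mem {σ : Equiv.Perm α} (h : Fintype.card α ∈ cycleParts σ) :
    cycleParts σ = {Fintype.card α} := by
  obtain ⟨t, ht⟩ := Multiset.exists_cons_of_mem h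
  have h1 := cycleParts_sum σ
  rw [ht, Multiset.sum_cons] at h1
  have h2 : t = 0 := Multiset.eq_zero_of_forall_notMem fun n hn => by
    have h3 := one_le_of_mem_cycleParts (σ := σ) (ht ▸ Multiset.mem_cons_of_mem hn)
    have h4 := Multiset.le_sum_of_mem hn
    omega
  rw [ht, h2]
  rfl

lemma exists_fixed_of_one_mem {σ : Equiv.Perm α} (h : 1 ∈ cycleParts σ) : ∃ a, σ a = a := by
  by_contra hc
  push Not at hc
  have hs : σ.support = Finset.univ := by
    ext a
    simp [hc a]
  rcases Multiset.mem_add.1 h with h | h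
  · exact absurd (Equiv.Perm.two_le_of_mem_cycleType h) (by norm_num)
  · rw [Equiv.Perm.sum_cycleType, hs, Finset.card_univ, Nat.sub_self] at h
    simp at h

lemma one_mem_pickyParts (k : ℕ) : 1 ∈ pickyParts k := by
  induction k with
  | zero => simp [pickyParts]
  | succ k ih => exact Multiset.mem_cons_of_mem ih

end CycleParts

section Wreath

variable {β : Type} (A : Subgroup (Equiv.Perm β))

/-- The action of the base group of the wreath product on two copies of a set. -/
def baseHom : A × A →* Equiv.Perm (β ⊕ β) :=
  (Equiv.Perm.sumCongrHom β β).comp (A.subtype.prodMap A.subtype)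

/-- The interchange of two copies of a set. -/
def swapSum (β : Type) : Equiv.Perm (β ⊕ β) := Equiv.sumComm β β

lemma swapSum_mul_self : swapSum β * swapSum β = 1 := by
  ext (b | b) <;> rfl

lemma swapSum_mul_baseHom (p : A × A) :
    swapSum β * baseHom A p = baseHom A p.swap * swapSum β := by
  ext (b | b) <;> rfl

/-- The wreath product of a permutation group with the group of order two, on two copies of a
set. -/
def wreathSubgroup : Subgroup (Equiv.Perm (β ⊕ β)) where
  carrier := {y | (∃ p, y = baseHom A p) ∨ ∃ p, y = baseHom A p * swapSum β}
  one_mem' := Or.inl ⟨1, (map_one _).symm⟩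
  mul_mem' := by
    rintro y z (⟨p, rfl⟩ | ⟨p, rfl⟩) (⟨q, rfl⟩ | ⟨q, rfl⟩)
    · exact Or.inl ⟨p * q, (map_mul _ _ _).symm⟩
    · exact Or.inr ⟨p * q, by rw [map_mul, mul_assoc]⟩
    · exact Or.inr ⟨p * q.swap, by rw [map_mul, mul_assoc, mul_assoc, swapSum_mul_baseHom]⟩
    · refine Or.inl ⟨p * q.swap, ?_⟩
      rw [mul_assoc, ← mul_assoc (swapSum β), swapSum_mul_baseHom, mul_assoc, swapSum_mul_self,
        mul_one, map_mul]
  inv_mem' := by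
    have hs : (swapSum β)⁻¹ = swapSum β := inv_eq_of_mul_eq_one_left swapSum_mul_self
    rintro y (⟨p, rfl⟩ | ⟨p, rfl⟩)
    · exact Or.inl ⟨p⁻¹, (map_inv _ _).symm⟩
    · exact Or.inr ⟨p⁻¹.swap, by rw [mul_inv_rev, hs, ← map_inv, swapSum_mul_baseHom]⟩

/-- The inclusion of the base group. -/
def wreathBase : A × A →* wreathSubgroup A :=
  (baseHom A).codRestrict (wreathSubgroup A) fun p => Or.inl ⟨p, rfl⟩

/-- The interchange of the factors, as an element of the wreath product. -/
def wreathSwap : wreathSubgroup A :=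
  ⟨swapSum β, Or.inr ⟨1, by rw [map_one, one_mul]⟩⟩

lemma isWreathProduct_wreathSubgroup [Nonempty β] :
    IsWreathProduct (wreathBase A) (wreathSwap A) where
  injective p q h := by
    have h1 := Equiv.Perm.sumCongrHom_injective (congrArg Subtype.val h)
    exact Prod.ext (Subtype.ext (congrArg Prod.fst h1)) (Subtype.ext (congrArg Prod.snd h1))
  mul_self := Subtype.ext swapSum_mul_self
  swap p := Subtype.ext (swapSum_mul_baseHom A p)
  ne p h := by
    obtain ⟨b⟩ := ‹Nonempty β›
    have h1 := Equiv.congr_fun (congrArg Subtype.val h) (Sum.inl b)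
    exact Sum.inl_ne_inr h1
  cover := by
    rintro ⟨y, ⟨p, rfl⟩ | ⟨p, rfl⟩⟩
    · exact Or.inl ⟨p, rfl⟩
    · exact Or.inr ⟨p, rfl⟩

lemma exists_eq_wreathBase_of_fixed {y : wreathSubgroup A} {b : β ⊕ β}
    (h : (y : Equiv.Perm (β ⊕ β)) b = b) : ∃ p, y = wreathBase A p := by
  obtain ⟨y, ⟨p, rfl⟩ | ⟨p, rfl⟩⟩ := y
  · exact ⟨p, rfl⟩
  · rcases b with b | b
    · exact (Sum.inr_ne_inl h).elim
    · exact (Sum.inl_ne_inr h).elim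

end Wreath

/-- Every pair of elements of the given cycle types has a table of characters. -/
def HasPickyTables {α : Type} [Fintype α] [DecidableEq α] (k : ℕ)
    (P : Subgroup (Equiv.Perm α)) : Prop :=
  ∀ x g : P, cycleParts (x : Equiv.Perm α) = pickyParts k →
    cycleParts (g : Equiv.Perm α) = {2 ^ k} → PickyTable P x g k

lemma hasPickyTables_wreathSubgroup {β : Type} [Fintype β] [DecidableEq β] {k : ℕ} (hk : 1 ≤ k)
    (hβ : Fintype.card β = 2 ^ k) {A : Subgroup (Equiv.Perm β)} (hA : HasPickyTables k A)
    {L : Finset (A →* ℤˣ)} (hL : L.card = 2 ^ k) :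
    HasPickyTables (k + 1) (wreathSubgroup A) := by
  have hne : Nonempty β := Fintype.card_pos_iff.1 (hβ ▸ by positivity)
  have hW := isWreathProduct_wreathSubgroup A
  have h2 : 2 ≤ 2 ^ (k + 1) := Nat.le_self_pow (by omega) 2
  have key : ∀ (p : A × A) (g : wreathSubgroup A),
      cycleParts (p.1 : Equiv.Perm β) = {2 ^ k} → cycleParts (p.2 : Equiv.Perm β) = pickyParts k →
      cycleParts (g : Equiv.Perm (β ⊕ β)) = {2 ^ (k + 1)} →
      PickyTable (wreathSubgroup A) (wreathBase A p) g (k + 1) := by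
    intro p g h1 h3 hg
    have hx : cycleParts (wreathBase A p : Equiv.Perm (β ⊕ β)) = pickyParts (k + 1) := by
      refine (cycleParts_sumCongr _ _).trans ?_
      change cycleParts (p.1 : Equiv.Perm β) + cycleParts (p.2 : Equiv.Perm β) = _
      rw [h1, h3, pickyParts, Multiset.singleton_add]
    refine hW.pickyTable hk hL (hA p.2 p.1 h3 h1) rfl
      (Subtype.ext (pow_eq_one_of_singleton h2 hg)) (fun hc => ?_)
      ((card_centralizer_le_of_injective _ (Subgroup.subtype_injective _) _).trans
        (card_centralizer_le_pickyCentralizer hx))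
      ((card_centralizer_le_of_injective _ (Subgroup.subtype_injective _) _).trans
        (card_centralizer_le_of_singleton h2 hg))
    have h4 := cycleParts_eq_iff.2 ((Subgroup.subtype _).map_isConj hc)
    exact pickyParts_ne_singleton (by omega) _ (hx.symm.trans (h4.trans hg))
  intro x g hx hg
  obtain ⟨b, hb⟩ := exists_fixed_of_one_mem (hx ▸ one_mem_pickyParts _)
  obtain ⟨p, rfl⟩ := exists_eq_wreathBase_of_fixed A hb
  have hsum : cycleParts (p.1 : Equiv.Perm β) + cycleParts (p.2 : Equiv.Perm β) =
      2 ^ k ::ₘ pickyParts k := (cycleParts_sumCongr _ _).symm.trans hx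
  have hmem : 2 ^ k ∈ cycleParts (p.1 : Equiv.Perm β) + cycleParts (p.2 : Equiv.Perm β) :=
    hsum ▸ Multiset.mem_cons_self _ _
  rw [← Multiset.singleton_add] at hsum
  rcases Multiset.mem_add.1 hmem with h | h
  · rw [← hβ] at h
    have h1 := cycleParts_eq_singleton_of_mem h
    rw [hβ] at h1
    rw [h1] at hsum
    exact key p g h1 (add_left_cancel hsum) hg
  · rw [← hβ] at h
    have h1 := cycleParts_eq_singleton_of_mem h
    rw [hβ] at h1
    rw [h1, add_comm] at hsum
    have h3 : wreathSwap A * wreathBase A p * (wreathSwap A)⁻¹ = wreathBase A p.swap := by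
      rw [hW.swap, mul_inv_cancel_right]
    refine PickyTable.of_mulEquiv (MulAut.conj (wreathSwap A)) ?_
    rw [MulAut.conj_apply, MulAut.conj_apply, h3]
    refine key p.swap _ h1 (add_left_cancel hsum) ?_
    rw [← hg]
    exact cycleParts_eq_iff.2 (isConj_iff.2 ⟨(wreathSwap A : Equiv.Perm (β ⊕ β))⁻¹, by
      simp only [Subgroup.coe_mul, Subgroup.coe_inv]; group⟩)

lemma exists_hasPickyTables (k : ℕ) :
    ∃ (α : Type) (_ : Fintype α) (_ : DecidableEq α) (P : Subgroup (Equiv.Perm α)),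
      Fintype.card α = 2 ^ (k + 1) ∧ 2 * Nat.card P = 2 ^ 2 ^ (k + 1) ∧
        (∃ L : Finset (P →* ℤˣ), L.card = 2 ^ (k + 1)) ∧ HasPickyTables (k + 1) P := by
  classical
  induction k with
  | zero =>
    refine ⟨Fin 2, inferInstance, inferInstance, ⊤, rfl, ?_, ?_, fun x g hx hg => ?_⟩
    · rw [Subgroup.card_top, Nat.card_perm, Nat.card_fin]
      rfl
    · refine ⟨{1, Equiv.Perm.sign.comp (Subgroup.subtype _)}, Finset.card_pair fun h => ?_⟩
      have := DFunLike.congr_fun h ⟨Equiv.swap 0 1, Subgroup.mem_top _⟩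
      simp at this
    · exact PickyTable.of_mulEquiv Subgroup.topEquiv (pickyTable_perm le_rfl hx hg)
  | succ k ih =>
    obtain ⟨β, h1, h2, A, hβ, hA, ⟨L, hL⟩, hT⟩ := ih
    have hne : Nonempty β := Fintype.card_pos_iff.1 (hβ ▸ by positivity)
    have hW := isWreathProduct_wreathSubgroup A
    refine ⟨β ⊕ β, inferInstance, inferInstance, wreathSubgroup A, ?_, ?_, ?_,
      hasPickyTables_wreathSubgroup (by omega) hβ hT hL⟩
    · rw [Fintype.card_sum, hβ]
      ring
    · rw [hW.natCard, pow_succ 2 (k + 1), pow_mul, ← hA]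
      ring
    · obtain ⟨L', hL'⟩ := hW.exists_homs L
      exact ⟨L', by rw [hL', hL]; ring⟩

lemma card_sylow_perm {α : Type} [Fintype α] [DecidableEq α] {k : ℕ} (hα : Fintype.card α = 2 ^ k)
    (P : Sylow 2 (Equiv.Perm α)) : 2 * Nat.card P = 2 ^ 2 ^ k := by
  rw [Sylow.card_eq_multiplicity, Nat.card_perm, Nat.card_eq_fintype_card, hα,
    Nat.factorization_def _ Nat.prime_two, ← pow_succ', padicValNat_factorial_two_pow]

theorem pickyTable_sylow {α : Type} [Fintype α] [DecidableEq α] {k : ℕ} (hk : 1 ≤ k)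
    (hα : Fintype.card α = 2 ^ k) (P : Sylow 2 (Equiv.Perm α)) :
    HasPickyTables k (P : Subgroup (Equiv.Perm α)) := by
  obtain ⟨k, rfl⟩ := Nat.exists_eq_succ_of_ne_zero (by omega : k ≠ 0)
  obtain ⟨β, h1, h2, Q, hβ, hQ, -, hT⟩ := exists_hasPickyTables k
  let e : α ≃ β := Fintype.equivOfCardEq (hα.trans hβ.symm)
  let E : Equiv.Perm α ≃* Equiv.Perm β := e.permCongrHom
  let Q' : Sylow 2 (Equiv.Perm α) := Sylow.ofCard (Q.map E.symm.toMonoidHom) (by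
    have h3 := card_sylow_perm hα P
    rw [Sylow.card_eq_multiplicity] at h3
    have h4 : Nat.card (Q.map E.symm.toMonoidHom) = Nat.card Q :=
      (Nat.card_congr (E.symm.subgroupMap Q).toEquiv).symm
    rw [h4]
    rw [← hQ] at h3
    omega)
  obtain ⟨c, hc⟩ := MulAction.exists_smul_eq (Equiv.Perm α) P Q'
  let C : Equiv.Perm α ≃* Equiv.Perm β := (MulAut.conj c).trans E
  have hmem : (P : Subgroup (Equiv.Perm α)).map C.toMonoidHom = Q := by
    have h3 : (P : Subgroup (Equiv.Perm α)).map (MulAut.conj c).toMonoidHom =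
        Q.map E.symm.toMonoidHom := congrArg Sylow.toSubgroup hc
    have h4 : C.toMonoidHom = E.toMonoidHom.comp (MulAut.conj c).toMonoidHom := rfl
    have h5 : E.toMonoidHom.comp E.symm.toMonoidHom = MonoidHom.id _ :=
      MonoidHom.ext E.apply_symm_apply
    rw [h4, ← Subgroup.map_map, h3, Subgroup.map_map, h5, Subgroup.map_id]
  have hC : ∀ y : Equiv.Perm α, cycleParts (C y) = cycleParts y := fun y =>
    (cycleParts_permCongr e _).trans (cycleParts_eq_iff.2 (isConj_iff.2 ⟨c⁻¹, by
      change c⁻¹ * (c * y * c⁻¹) * c⁻¹⁻¹ = y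
      group⟩))
  intro x g hx hg
  let F : (P : Subgroup (Equiv.Perm α)) ≃* Q :=
    (C.subgroupMap (P : Subgroup (Equiv.Perm α))).trans (MulEquiv.subgroupCongr hmem)
  refine PickyTable.of_mulEquiv F (hT _ _ ?_ ?_)
  · rw [← hx, ← hC]
    rfl
  · rw [← hg, ← hC]
    rfl

lemma digits_two_pow_sub_two (k : ℕ) :
    Nat.digits 2 (2 ^ (k + 2) - 2) = 0 :: List.replicate (k + 1) 1 := by
  have h1 : ∀ m, Nat.digits 2 (2 ^ m - 1) = List.replicate m 1 := by
    intro m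
    induction m with
    | zero => simp
    | succ m ih =>
      have h2 : 2 ^ (m + 1) - 1 = 1 + 2 * (2 ^ m - 1) := by
        have := Nat.one_le_two_pow (n := m)
        rw [pow_succ]
        omega
      rw [h2, Nat.digits_add 2 one_lt_two 1 _ one_lt_two (Or.inl one_ne_zero), ih,
        List.replicate_succ]
  have h3 : 2 ^ (k + 2) - 2 = 0 + 2 * (2 ^ (k + 1) - 1) := by
    rw [pow_succ]
    omega
  have h4 : 2 ^ (k + 1) - 1 ≠ 0 := by
    have := Nat.one_le_two_pow (n := k)
    rw [pow_succ]
    omega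
  rw [h3, Nat.digits_add 2 one_lt_two 0 _ zero_lt_two (Or.inr h4), h1]

lemma pickyParts_eq_sum (k : ℕ) :
    pickyParts k = (∑ i ∈ Finset.range k, {2 ^ i}) + {1} := by
  induction k with
  | zero => simp [pickyParts]
  | succ k ih =>
    rw [pickyParts, ih, Finset.sum_range_succ, ← Multiset.singleton_add]
    abel

lemma padicCycleMultiset_two_pow_sub_two (k : ℕ) :
    padicCycleMultiset 2 (2 ^ (k + 2) - 2) + Multiset.replicate 2 1 = pickyParts (k + 2) := by
  rw [padicCycleMultiset, digits_two_pow_sub_two, List.length_cons, List.length_replicate,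
    Finset.sum_range_succ', pickyParts_eq_sum, Finset.sum_range_succ' _ (k + 1)]
  have h : ∀ i ∈ Finset.range (k + 1), Multiset.replicate
      ((0 :: List.replicate (k + 1) 1).getD (i + 1) 0) (2 ^ (i + 1)) = {2 ^ (i + 1)} := by
    intro i hi
    rw [List.getD_cons_succ, List.getD_replicate _ (Finset.mem_range.1 hi)]
    rfl
  rw [Finset.sum_congr rfl h, add_assoc, add_assoc]
  rfl

lemma IsTypeII.cycleParts_eq {k : ℕ} (hk : 2 ≤ k) {x : Equiv.Perm (Fin (2 ^ k))}
    (hx : IsTypeII x) : cycleParts x = pickyParts k := by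
  obtain ⟨k, rfl⟩ := Nat.exists_eq_add_of_le' hk
  refine Eq.trans ?_ (Eq.trans hx (padicCycleMultiset_two_pow_sub_two k))
  rw [fullCycleType, cycleParts, Equiv.Perm.sum_cycleType, Fintype.card_fin]

/-- For `k ≥ 3`, `g` a `2^k`-cycle, `x` a picky element of Type II of `S_{2^k}` and
`P` its unique Sylow `2`-subgroup (with `g ∈ P` so that evaluation at `g` makes
sense), there is a bijection `Γ : Irr^x(S_{2^k}) → Irr^x(P)` with properties (I),
(II), (III); moreover, for `H ∈ {S_{2^k}, P}`, characters of odd degree take value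
`±1` at `x` and the remaining characters of `Irr^x(H)` take value `±2` at `x`. -/
theorem typeII_power_of_two_case (k : ℕ) (hk : 3 ≤ k)
    (g : Equiv.Perm (Fin (2 ^ k))) (hg : g.cycleType = {2 ^ k})
    (x : Equiv.Perm (Fin (2 ^ k))) (hx : IsTypeII x)
    (P : Sylow 2 (Equiv.Perm (Fin (2 ^ k))))
    (hxP : x ∈ (P : Subgroup (Equiv.Perm (Fin (2 ^ k)))))
    (hgP : g ∈ (P : Subgroup (Equiv.Perm (Fin (2 ^ k))))) :
    (∃ Γ : ↥(IrrX (Equiv.Perm (Fin (2 ^ k))) x) ≃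
          ↥(IrrX ↥(P : Subgroup (Equiv.Perm (Fin (2 ^ k)))) ⟨x, hxP⟩),
      (∀ χ, pPart 2 (charDeg (Γ χ).1) = pPart 2 (charDeg χ.1)) ∧
      (∀ χ, (Γ χ).1 ⟨x, hxP⟩ = χ.1 x ∨ (Γ χ).1 ⟨x, hxP⟩ = - χ.1 x) ∧
      (∀ χ, χ.1 ∈ IrrP' 2 (Equiv.Perm (Fin (2 ^ k))) →
        ∃ ε : ℂ, (ε = 1 ∨ ε = -1) ∧
          (Γ χ).1 ⟨x, hxP⟩ = ε * χ.1 x ∧ (Γ χ).1 ⟨g, hgP⟩ = ε * χ.1 g)) ∧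
    (∀ χ ∈ IrrP' 2 (Equiv.Perm (Fin (2 ^ k))), χ x = 1 ∨ χ x = -1) ∧
    (∀ ψ ∈ IrrP' 2 ↥(P : Subgroup (Equiv.Perm (Fin (2 ^ k)))),
      ψ ⟨x, hxP⟩ = 1 ∨ ψ ⟨x, hxP⟩ = -1) ∧
    (∀ χ ∈ IrrX (Equiv.Perm (Fin (2 ^ k))) x,
      χ ∉ IrrP' 2 (Equiv.Perm (Fin (2 ^ k))) → χ x = 2 ∨ χ x = -2) ∧
    (∀ ψ ∈ IrrX ↥(P : Subgroup (Equiv.Perm (Fin (2 ^ k)))) ⟨x, hxP⟩,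
      ψ ∉ IrrP' 2 ↥(P : Subgroup (Equiv.Perm (Fin (2 ^ k)))) →
        ψ ⟨x, hxP⟩ = 2 ∨ ψ ⟨x, hxP⟩ = -2) := by
  have hk1 : 1 ≤ k := by omega
  have hx' : cycleParts x = pickyParts k := hx.cycleParts_eq (by omega)
  have hg' : cycleParts g = {2 ^ k} := cycleParts_of_cycleType (Fintype.card_fin _) hg
  have hG := pickyTable_perm hk1 hx' hg'
  have hH := pickyTable_sylow hk1 (Fintype.card_fin _) P ⟨x, hxP⟩ ⟨g, hgP⟩ hx' hg'
  exact ⟨exists_equiv_of_pickyTables hk1 hG hH, (hG.values hk1).1, (hH.values hk1).1,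
    (hG.values hk1).2, (hH.values hk1).2⟩

end
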